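/- arXiv:1009.0454 — 2 statements merged into one kernel-verified Lean document; each statement's English description precedes it below -/
import Mathlib

section
/- Let k ≥ 1 and n > k. Then every surjective homomorphism φ : F_n →* N_k onto the nonorientable genus-k surface group is reducible: there is an automorphism α of F_n and an index i with (φ ∘ α)(x_i) = 1. -/
/-- The single relator `x_0² x_1² ⋯ x_{k-1}²` of the nonorientable genus-`k`
surface group, as an element of the free group on `Fin k`. -/
def nonorientableRelator (k : ℕ) : FreeGroup (Fin k) :=
  ((List.finRange k).map (fun i => (FreeGroup.of i) ^ 2)).prod

/-- The nonorientable genus-`k` surface group. -/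
def NonorientableSurfaceGroup (k : ℕ) : Type :=
  PresentedGroup ({nonorientableRelator k} : Set (FreeGroup (Fin k)))

instance (k : ℕ) : Group (NonorientableSurfaceGroup k) :=
  inferInstanceAs (Group (PresentedGroup _))

/-- The standard epimorphism `ρ_k : F_k →* N_k`, the quotient map of the presentation. -/
def standardRho (k : ℕ) : FreeGroup (Fin k) →* NonorientableSurfaceGroup k :=
  PresentedGroup.mk _


namespace NSG
open FreeGroup (of)

section paths
variable {V E V' E' : Type}

/-- Elements of the free group on the edges that are represented by edge paths. -/
inductive IsPath (src tgt : E → V) : V → V → FreeGroup E → Prop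
  | nil (a : V) : IsPath src tgt a a 1
  | fwd {a : V} {w : FreeGroup E} (e : E) : IsPath src tgt a (src e) w →
      IsPath src tgt a (tgt e) (w * of e)
  | bwd {a : V} {w : FreeGroup E} (e : E) : IsPath src tgt a (tgt e) w →
      IsPath src tgt a (src e) (w * (of e)⁻¹)

variable {src tgt : E → V} {src' tgt' : E' → V'}

theorem IsPath.trans {a b c : V} {w w' : FreeGroup E} (h : IsPath src tgt a b w)
    (h' : IsPath src tgt b c w') : IsPath src tgt a c (w * w') := by
  induction h' with
  | nil => simpa using h
  | fwd e _ ih => rw [← mul_assoc]; exact ih.fwd e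
  | bwd e _ ih => rw [← mul_assoc]; exact ih.bwd e

theorem IsPath.edge (src tgt : E → V) (e : E) : IsPath src tgt (src e) (tgt e) (of e) := by
  simpa using (IsPath.nil (src := src) (tgt := tgt) (src e)).fwd e

theorem IsPath.edge_inv (src tgt : E → V) (e : E) :
    IsPath src tgt (tgt e) (src e) (of e)⁻¹ := by
  simpa using (IsPath.nil (src := src) (tgt := tgt) (tgt e)).bwd e

theorem IsPath.symm {a b : V} {w : FreeGroup E} (h : IsPath src tgt a b w) :
    IsPath src tgt b a w⁻¹ := by
  induction h with
  | nil => simpa using IsPath.nil _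
  | fwd e _ ih => rw [mul_inv_rev]; exact (IsPath.edge_inv src tgt e).trans ih
  | bwd e _ ih => rw [mul_inv_rev, inv_inv]; exact (IsPath.edge src tgt e).trans ih

theorem IsPath.map (m : V → V') (h : FreeGroup E →* FreeGroup E')
    (hp : ∀ e, IsPath src' tgt' (m (src e)) (m (tgt e)) (h (of e)))
    {a b : V} {w : FreeGroup E} (hw : IsPath src tgt a b w) :
    IsPath src' tgt' (m a) (m b) (h w) := by
  induction hw with
  | nil => simpa using IsPath.nil _
  | fwd e _ ih => rw [map_mul]; exact ih.trans (hp e)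
  | bwd e _ ih => rw [map_mul, map_inv]; exact ih.trans (hp e).symm

theorem IsPath.act {Z : Type} (A : FreeGroup E →* Equiv.Perm Z) (z : V → Z)
    (hA : ∀ e, A (of e) (z (tgt e)) = z (src e))
    {a b : V} {w : FreeGroup E} (hw : IsPath src tgt a b w) : A w (z b) = z a := by
  induction hw with
  | nil => simp
  | fwd e _ ih => rw [map_mul, Equiv.Perm.mul_apply, hA, ih]
  | bwd e _ ih =>
    rw [map_mul, Equiv.Perm.mul_apply, map_inv, Equiv.Perm.inv_eq_iff_eq.2 (hA e).symm, ih]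

theorem IsPath.gauge {H : Type} [Group H] (f : FreeGroup E →* H) (t : V → H) (M : Subgroup H)
    (hM : ∀ e, t (src e) * f (of e) * (t (tgt e))⁻¹ ∈ M)
    {a b : V} {w : FreeGroup E} (hw : IsPath src tgt a b w) : t a * f w * (t b)⁻¹ ∈ M := by
  induction hw with
  | nil => simp [M.one_mem]
  | fwd e _ ih =>
    have := M.mul_mem ih (hM e)
    simpa [mul_assoc] using this
  | bwd e _ ih =>
    have := M.mul_mem ih (M.inv_mem (hM e))
    simpa [mul_assoc] using this

/-- Gauge transformation with equalities. -/
theorem IsPath.gauge_eq {H : Type} [Group H] (f f' : FreeGroup E →* H) (t : V → H)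
    (hM : ∀ e, f' (of e) = t (src e) * f (of e) * (t (tgt e))⁻¹)
    {a b : V} {w : FreeGroup E} (hw : IsPath src tgt a b w) : f' w = t a * f w * (t b)⁻¹ := by
  induction hw with
  | nil => simp
  | fwd e _ ih => simp [ih, hM, mul_assoc]
  | bwd e _ ih => simp [ih, hM, mul_assoc]

theorem IsPath.lift (m : V → V') (h : FreeGroup E →* FreeGroup E')
    (N : Subgroup (FreeGroup E')) [N.Normal]
    (l1 : ∀ e', ∃ a b w, IsPath src tgt a b w ∧ m a = src' e' ∧ m b = tgt' e' ∧
      (h w)⁻¹ * of e' ∈ N)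
    (l2 : ∀ a b, m a = m b → ∃ w, IsPath src tgt a b w ∧ h w ∈ N)
    {a' b' : V'} {w' : FreeGroup E'} (hw : IsPath src' tgt' a' b' w') :
    ∀ a b, m a = a' → m b = b' → ∃ w, IsPath src tgt a b w ∧ (h w)⁻¹ * w' ∈ N := by
  induction hw with
  | nil =>
    intro a b ha hb
    obtain ⟨w, hw, hN⟩ := l2 a b (by rw [ha, hb])
    exact ⟨w, hw, by simpa using hN⟩
  | fwd e _ ih =>
    intro a b ha hb
    obtain ⟨p, q, u, hu, hp, hq, hn⟩ := l1 e
    obtain ⟨w, hw, hN⟩ := ih a p ha hp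
    obtain ⟨s, hs, hsN⟩ := l2 q b (by rw [hq, hb])
    refine ⟨w * u * s, (hw.trans hu).trans hs, ?_⟩
    rw [← QuotientGroup.eq] at *
    rw [← QuotientGroup.eq_one_iff] at hsN
    simp only [map_mul, QuotientGroup.mk_mul, hsN, mul_one, hN, hn]
  | bwd e _ ih =>
    intro a b ha hb
    obtain ⟨p, q, u, hu, hp, hq, hn⟩ := l1 e
    obtain ⟨w, hw, hN⟩ := ih a q ha hq
    obtain ⟨s, hs, hsN⟩ := l2 p b (by rw [hp, hb])
    refine ⟨w * u⁻¹ * s, (hw.trans hu.symm).trans hs, ?_⟩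
    rw [← QuotientGroup.eq] at *
    rw [← QuotientGroup.eq_one_iff] at hsN
    simp only [map_mul, map_inv, QuotientGroup.mk_mul, QuotientGroup.mk_inv, hsN, mul_one, hN, hn]

/-- Extending a partial injection of a finite set to a permutation. -/
theorem exists_perm_extend [Finite V] (s t : E → V) (h : ∀ e e', s e = s e' ↔ t e = t e') :
    ∃ σ : Equiv.Perm V, ∀ e, σ (t e) = s e := by
  classical
  have := Fintype.ofFinite V
  let f : V → V := fun v => if hv : ∃ e, t e = v then s hv.choose else v
  have hf : ∀ e, f (t e) = s e := by
    intro e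
    have hv : ∃ e', t e' = t e := ⟨e, rfl⟩
    simp only [f, dif_pos hv]
    exact (h _ _).2 hv.choose_spec
  let S : Finset V := Finset.univ.filter fun v => ∃ e, t e = v
  obtain ⟨g, hg⟩ := Finset.exists_equiv_extend_of_card_eq (α := V) (β := V) (t := Finset.univ)
    (by simp) (s := S) (f := f) (by simp) (by
      intro x hx y hy hxy
      simp only [S, Finset.coe_filter, Finset.mem_univ, true_and, Set.mem_ofPred_eq] at hx hy
      obtain ⟨e, rfl⟩ := hx
      obtain ⟨e', rfl⟩ := hy
      rw [hf, hf] at hxy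
      exact (h _ _).1 hxy)
  refine ⟨g.trans (Equiv.subtypeUnivEquiv (by simp)), fun e => ?_⟩
  have := hg (t e) (by simp [S])
  simp only [Equiv.trans_apply, Equiv.subtypeUnivEquiv_apply]
  rw [this, hf]

end paths
end NSG

namespace NSG
open FreeGroup (of)

section free
variable {n : ℕ} {B : Type}

/-- label evaluation -/
def optEval {E : Type} (lab : E → Option B) : FreeGroup E →* FreeGroup B :=
  FreeGroup.lift fun e => (lab e).elim 1 of

@[simp] theorem optEval_of {E : Type} (lab : E → Option B) (e : E) :
    optEval lab (of e) = (lab e).elim 1 of := by simp [optEval]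

/-- A marked labelled graph representing a homomorphism between free groups. -/
structure NState (ψ : FreeGroup (Fin n) →* FreeGroup B) (V E : Type) where
  src : E → V
  tgt : E → V
  lab : E → Option B
  o : V
  J : FreeGroup (Fin n) →* FreeGroup E
  M : FreeGroup E →* FreeGroup (Fin n)
  τ : V → FreeGroup E
  hτ : ∀ v, IsPath src tgt o v (τ v)
  Mτ : ∀ v, M (τ v) = 1
  MJ : ∀ g, M (J g) = g
  Jp : ∀ g, IsPath src tgt o o (J g)
  JM : ∀ e, J (M (of e)) = τ (src e) * of e * (τ (tgt e))⁻¹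
  lb : ∀ g, optEval lab (J g) = ψ g

variable {ψ : FreeGroup (Fin n) →* FreeGroup B} {V E : Type}

theorem NState.JMpath (S : NState ψ V E) {a b : V} {w : FreeGroup E}
    (h : IsPath S.src S.tgt a b w) : S.J (S.M w) = S.τ a * w * (S.τ b)⁻¹ :=
  IsPath.gauge_eq (MonoidHom.id _) (S.J.comp S.M) S.τ (fun e => by simpa using S.JM e) h

/-- Change of the graph by an automorphism. -/
def NState.change (S : NState ψ V E) (src' tgt' : E → V) (lab' : E → Option B)
    (σ σ' : FreeGroup E →* FreeGroup E) (h1 : ∀ e, σ' (σ (of e)) = of e)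
    (h2 : ∀ e, σ (σ' (of e)) = of e)
    (hp : ∀ e, IsPath src' tgt' (S.src e) (S.tgt e) (σ (of e)))
    (hp' : ∀ e, IsPath S.src S.tgt (src' e) (tgt' e) (σ' (of e)))
    (hl : ∀ e, optEval lab' (σ (of e)) = optEval S.lab (of e)) : NState ψ V E :=
  have h1' : ∀ g, σ' (σ g) = g := fun g => by
    have : σ'.comp σ = MonoidHom.id _ := FreeGroup.ext_hom _ _ (by simpa using h1)
    exact DFunLike.congr_fun this g
  have hl' : ∀ g, optEval lab' (σ g) = optEval S.lab g := fun g => by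
    have : (optEval lab').comp σ = optEval S.lab := FreeGroup.ext_hom _ _ (by simpa using hl)
    exact DFunLike.congr_fun this g
  { src := src', tgt := tgt', lab := lab', o := S.o, J := σ.comp S.J, M := S.M.comp σ',
    τ := fun v => σ (S.τ v)
    hτ := fun v => (S.hτ v).map id σ hp
    Mτ := fun v => by simp [h1', S.Mτ]
    MJ := fun g => by simp [h1', S.MJ]
    Jp := fun g => (S.Jp g).map id σ hp
    JM := fun e => by simp [S.JMpath (hp' e), h2]
    lb := fun g => by simp [hl', S.lb] }

/-- contraction of an edge -/
theorem NState.contract (S : NState ψ V E) (e : E) (hl : S.lab e = none)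
    (hab : S.src e ≠ S.tgt e) (hbo : S.o ≠ S.tgt e) :
    ∃ S' : NState ψ {x : V // x ≠ S.tgt e} {f : E // f ≠ e}, ∀ f, S'.lab f = S.lab f.1 := by
  classical
  let m : V → {x : V // x ≠ S.tgt e} := fun x => if h : x = S.tgt e then ⟨S.src e, hab⟩ else ⟨x, h⟩
  let κ : FreeGroup E →* FreeGroup {f : E // f ≠ e} :=
    FreeGroup.lift fun f => if h : f = e then 1 else of ⟨f, h⟩
  have hκe : κ (of e) = 1 := by simp [κ]
  have hκ : ∀ f : {f : E // f ≠ e}, κ (of f.1) = of f := fun f => by simp [κ, f.2]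
  have hmb : m (S.tgt e) = ⟨S.src e, hab⟩ := by simp [m]
  have hm : ∀ x : {x : V // x ≠ S.tgt e}, m x.1 = x := fun x => by simp [m, x.2]
  let src' : {f : E // f ≠ e} → {x : V // x ≠ S.tgt e} := fun f => m (S.src f.1)
  let tgt' : {f : E // f ≠ e} → {x : V // x ≠ S.tgt e} := fun f => m (S.tgt f.1)
  have hp : ∀ f, IsPath src' tgt' (m (S.src f)) (m (S.tgt f)) (κ (of f)) := by
    intro f
    by_cases hf : f = e
    · subst hf
      rw [hκe, hmb, hm ⟨_, hab⟩]
      exact IsPath.nil _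
    · rw [hκ ⟨f, hf⟩]
      exact IsPath.edge src' tgt' ⟨f, hf⟩
  let δ : V → FreeGroup (Fin n) := fun x => if x = S.tgt e then S.M (of e) else 1
  let M1 : FreeGroup E →* FreeGroup (Fin n) :=
    FreeGroup.lift fun f => δ (S.src f) * S.M (of f) * (δ (S.tgt f))⁻¹
  let M' : FreeGroup {f : E // f ≠ e} →* FreeGroup (Fin n) :=
    FreeGroup.lift fun f => δ (S.src f.1) * S.M (of f.1) * (δ (S.tgt f.1))⁻¹
  have hM' : ∀ g, M' (κ g) = M1 g := by
    intro g
    have : M'.comp κ = M1 := by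
      apply FreeGroup.ext_hom
      intro f
      by_cases hf : f = e
      · subst hf
        simp [hκe, M1, δ, hab]
      · simp [hκ ⟨f, hf⟩, M', M1]
    exact DFunLike.congr_fun this g
  have hδ : ∀ x, x ≠ S.tgt e → δ x = 1 := fun x hx => by simp [δ, hx]
  have hM1 : ∀ {a b w}, IsPath S.src S.tgt a b w → M1 w = δ a * S.M w * (δ b)⁻¹ := fun h =>
    h.gauge_eq S.M M1 δ (by simp [M1])
  have hδτ : ∀ x, κ (S.J (δ x)) * κ (S.τ x) = κ (S.τ (m x)) := by
    intro x
    by_cases hx : x = S.tgt e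
    · subst hx
      simp [δ, hmb, S.JM, hκe]
    · simp [hδ x hx, hm ⟨x, hx⟩]
  have hlb : ∀ g, optEval (fun f : {f : E // f ≠ e} => S.lab f.1) (κ g) = optEval S.lab g := by
    intro g
    have : (optEval (fun f : {f : E // f ≠ e} => S.lab f.1)).comp κ = optEval S.lab := by
      apply FreeGroup.ext_hom
      intro f
      by_cases hf : f = e
      · subst hf
        simp [hκe, hl]
      · simp [hκ ⟨f, hf⟩]
    exact DFunLike.congr_fun this g
  refine ⟨{ src := src', tgt := tgt', lab := fun f => S.lab f.1, o := ⟨S.o, hbo⟩,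
            J := κ.comp S.J, M := M', τ := fun x => κ (S.τ x.1), hτ := ?_, Mτ := ?_, MJ := ?_,
            Jp := ?_, JM := ?_, lb := ?_ }, fun f => rfl⟩
  · intro v
    have := (S.hτ v.1).map m κ hp
    rwa [hm v, hm ⟨S.o, hbo⟩] at this
  · intro v
    rw [hM', hM1 (S.hτ v.1), hδ _ hbo, hδ _ v.2, S.Mτ]; simp
  · intro g
    rw [MonoidHom.comp_apply, hM', hM1 (S.Jp g), hδ _ hbo, S.MJ]; simp
  · intro g
    have := (S.Jp g).map m κ hp
    rwa [hm ⟨S.o, hbo⟩] at this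
  · intro f
    simp only [MonoidHom.comp_apply, M', FreeGroup.lift_apply_of, map_mul, map_inv, S.JM, src', tgt']
    rw [← hδτ, ← hδτ, hκ]
    group
  · intro g
    rw [MonoidHom.comp_apply, hlb, S.lb]

/-- reversal of an edge with trivial label -/
theorem NState.reverse (S : NState ψ V E) (e : E) (hl : S.lab e = none) :
    ∃ S' : NState ψ V E, S'.lab = S.lab ∧ S'.o = S.o ∧ S'.src e = S.tgt e ∧ S'.tgt e = S.src e := by
  classical
  let σ : FreeGroup E →* FreeGroup E := FreeGroup.lift fun f => if f = e then (of f)⁻¹ else of f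
  have hσ : σ (of e) = (of e)⁻¹ := by simp [σ]
  have hσ' : ∀ f, f ≠ e → σ (of f) = of f := fun f hf => by simp [σ, hf]
  have hσσ : ∀ f, σ (σ (of f)) = of f := by
    intro f
    by_cases hf : f = e
    · subst hf; simp [hσ]
    · simp [hσ' f hf]
  refine ⟨S.change (Function.update S.src e (S.tgt e)) (Function.update S.tgt e (S.src e)) S.lab
    σ σ hσσ hσσ ?_ ?_ ?_, rfl, rfl, by simp [NState.change], by simp [NState.change]⟩
  · intro f
    by_cases hf : f = e
    · subst hf
      rw [hσ]
      simpa using IsPath.edge_inv (Function.update S.src f (S.tgt f))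
        (Function.update S.tgt f (S.src f)) f
    · rw [hσ' f hf]
      simpa [hf] using IsPath.edge (Function.update S.src e (S.tgt e))
        (Function.update S.tgt e (S.src e)) f
  · intro f
    by_cases hf : f = e
    · subst hf
      rw [hσ]
      simpa using IsPath.edge_inv S.src S.tgt f
    · rw [hσ' f hf]
      simpa [hf] using IsPath.edge S.src S.tgt f
  · intro f
    by_cases hf : f = e
    · subst hf
      rw [hσ]
      simp [hl]
    · rw [hσ' f hf]

/-- slide of an edge at its source -/
theorem NState.slideSrc (S : NState ψ V E) (e e' : E) (hne : e' ≠ e) (hl : S.lab e = S.lab e')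
    (hs : S.src e = S.src e') :
    ∃ S' : NState ψ V E, S'.lab e' = none ∧ ∀ f, f ≠ e' → S'.lab f = S.lab f := by
  classical
  let σ : FreeGroup E →* FreeGroup E := FreeGroup.lift fun f => if f = e' then of e * of f else of f
  let σ' : FreeGroup E →* FreeGroup E :=
    FreeGroup.lift fun f => if f = e' then (of e)⁻¹ * of f else of f
  have hσ : σ (of e') = of e * of e' := by simp [σ]
  have hσ' : ∀ f, f ≠ e' → σ (of f) = of f := fun f hf => by simp [σ, hf]
  have hτ : σ' (of e') = (of e)⁻¹ * of e' := by simp [σ']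
  have hτ' : ∀ f, f ≠ e' → σ' (of f) = of f := fun f hf => by simp [σ', hf]
  let src' := Function.update S.src e' (S.tgt e)
  refine ⟨S.change src' S.tgt (Function.update S.lab e' none)
    σ σ' ?_ ?_ ?_ ?_ ?_, by simp [NState.change], fun f hf => by simp [NState.change, hf]⟩
  · intro f
    by_cases hf : f = e'
    · subst hf; simp [hσ, hτ, hτ' e hne.symm]
    · simp [hσ' f hf, hτ' f hf]
  · intro f
    by_cases hf : f = e'
    · subst hf; simp [hσ, hτ, hσ' e hne.symm]
    · simp [hσ' f hf, hτ' f hf]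
  · intro f
    by_cases hf : f = e'
    · subst hf
      rw [hσ]
      have h1 := IsPath.edge src' S.tgt e
      have h2 := IsPath.edge src' S.tgt f
      simp only [src', Function.update_self, Function.update_of_ne hne.symm, hs] at h1 h2
      exact h1.trans h2
    · rw [hσ' f hf]
      simpa [hf, src'] using IsPath.edge src' S.tgt f
  · intro f
    by_cases hf : f = e'
    · subst hf
      rw [hτ]
      have h1 := IsPath.edge_inv S.src S.tgt e
      have h2 := IsPath.edge S.src S.tgt f
      rw [hs] at h1
      simpa [src'] using h1.trans h2
    · rw [hτ' f hf]
      simpa [hf, src'] using IsPath.edge S.src S.tgt f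
  · intro f
    by_cases hf : f = e'
    · subst hf
      rw [hσ]
      simp [hl, hne.symm]
    · rw [hσ' f hf]
      simp [hf]

/-- slide of an edge at its target -/
theorem NState.slideTgt (S : NState ψ V E) (e e' : E) (hne : e' ≠ e) (hl : S.lab e = S.lab e')
    (hs : S.tgt e = S.tgt e') :
    ∃ S' : NState ψ V E, S'.lab e' = none ∧ ∀ f, f ≠ e' → S'.lab f = S.lab f := by
  classical
  let σ : FreeGroup E →* FreeGroup E := FreeGroup.lift fun f => if f = e' then of f * of e else of f
  let σ' : FreeGroup E →* FreeGroup E :=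
    FreeGroup.lift fun f => if f = e' then of f * (of e)⁻¹ else of f
  have hσ : σ (of e') = of e' * of e := by simp [σ]
  have hσ' : ∀ f, f ≠ e' → σ (of f) = of f := fun f hf => by simp [σ, hf]
  have hτ : σ' (of e') = of e' * (of e)⁻¹ := by simp [σ']
  have hτ' : ∀ f, f ≠ e' → σ' (of f) = of f := fun f hf => by simp [σ', hf]
  let tgt' := Function.update S.tgt e' (S.src e)
  refine ⟨S.change S.src tgt' (Function.update S.lab e' none)
    σ σ' ?_ ?_ ?_ ?_ ?_, by simp [NState.change], fun f hf => by simp [NState.change, hf]⟩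
  · intro f
    by_cases hf : f = e'
    · subst hf; simp [hσ, hτ, hτ' e hne.symm]
    · simp [hσ' f hf, hτ' f hf]
  · intro f
    by_cases hf : f = e'
    · subst hf; simp [hσ, hτ, hσ' e hne.symm]
    · simp [hσ' f hf, hτ' f hf]
  · intro f
    by_cases hf : f = e'
    · subst hf
      rw [hσ]
      have h1 := IsPath.edge S.src tgt' e
      have h2 := IsPath.edge S.src tgt' f
      simp only [tgt', Function.update_self, Function.update_of_ne hne.symm, hs] at h1 h2
      exact h2.trans h1
    · rw [hσ' f hf]
      simpa [hf, tgt'] using IsPath.edge S.src tgt' f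
  · intro f
    by_cases hf : f = e'
    · subst hf
      rw [hτ]
      have h1 := IsPath.edge_inv S.src S.tgt e
      have h2 := IsPath.edge S.src S.tgt f
      rw [hs] at h1
      simpa [tgt'] using h2.trans h1
    · rw [hτ' f hf]
      simpa [hf, tgt'] using IsPath.edge S.src S.tgt f
  · intro f
    by_cases hf : f = e'
    · subst hf
      rw [hσ]
      simp [hl, hne.symm]
    · rw [hσ' f hf]
      simp [hf]

/-- The rank of a free group is well defined. -/
theorem card_eq_of_freeGroup_equiv {A A' : Type} [Finite A] [Finite A']
    (f : FreeGroup A ≃* FreeGroup A') : Nat.card A = Nat.card A' := by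
  have e : (A → Multiplicative (ZMod 2)) ≃ (A' → Multiplicative (ZMod 2)) :=
    FreeGroup.lift.trans (f.monoidHomCongrLeftEquiv.trans FreeGroup.lift.symm)
  have h := Nat.card_congr e
  rw [Nat.card_fun, Nat.card_fun] at h
  have h2 : Nat.card (Multiplicative (ZMod 2)) = 2 := by simp
  rw [h2] at h
  exact Nat.pow_right_injective le_rfl h

end free
end NSG

namespace NSG
open FreeGroup (of)

/-- reducibility of a homomorphism -/
def Red {n : ℕ} {H : Type} [Group H] (φ : FreeGroup (Fin n) →* H) : Prop :=
  ∃ (α : FreeGroup (Fin n) ≃* FreeGroup (Fin n)) (i : Fin n), φ (α (of i)) = 1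

section loops
variable {V E : Type}

/-- closed paths form a subgroup -/
def loops (src tgt : E → V) (o : V) : Subgroup (FreeGroup E) where
  carrier := {w | IsPath src tgt o o w}
  mul_mem' := fun h h' => IsPath.trans h h'
  one_mem' := IsPath.nil o
  inv_mem' := fun h => IsPath.symm h

theorem mem_loops {src tgt : E → V} {o : V} {w : FreeGroup E} :
    w ∈ loops src tgt o ↔ IsPath src tgt o o w := Iff.rfl

theorem hom_mem_of_gen {A H : Type} [Group H] (f : FreeGroup A →* H) (S : Subgroup H)
    (h : ∀ a, f (of a) ∈ S) (g : FreeGroup A) : f g ∈ S := by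
  refine FreeGroup.induction_on (C := fun g => f g ∈ S) g ?_ h ?_ ?_
  · simp [S.one_mem]
  · intro x hx
    rw [map_inv]; exact S.inv_mem hx
  · intro x y hx hy
    rw [map_mul]; exact S.mul_mem hx hy

theorem hom_eq_of_gen {A H : Type} [Group H] (f g : FreeGroup A →* H)
    (h : ∀ a, f (of a) = g (of a)) (x : FreeGroup A) : f x = g x :=
  DFunLike.congr_fun (FreeGroup.ext_hom f g h) x

end loops

section free
variable {n : ℕ} {B : Type} {ψ : FreeGroup (Fin n) →* FreeGroup B} {V E : Type}

theorem NState.final [Finite V] [Finite E] [Finite B] (S : NState ψ V E)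
    (hψ : Function.Surjective ψ) (hB : Nat.card B < n)
    (h1 : ∀ e, S.lab e = none → S.src e = S.tgt e)
    (h2 : ∀ e e' b, S.lab e = some b → S.lab e' = some b → S.src e = S.src e' → e = e')
    (h3 : ∀ e e' b, S.lab e = some b → S.lab e' = some b → S.tgt e = S.tgt e' → e = e') :
    Red ψ := by
  classical
  have hσ : ∀ b : B, ∃ σ : Equiv.Perm V, ∀ e : {e // S.lab e = some b},
      σ (S.tgt e.1) = S.src e.1 := by
    intro b
    apply exists_perm_extend (fun e : {e // S.lab e = some b} => S.src e.1)
      (fun e : {e // S.lab e = some b} => S.tgt e.1)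
    intro e e'
    constructor
    · intro h
      have := h2 e.1 e'.1 b e.2 e'.2 h
      rw [this]
    · intro h
      have := h3 e.1 e'.1 b e.2 e'.2 h
      rw [this]
  choose σ hσ using hσ
  let A : FreeGroup B →* Equiv.Perm V := FreeGroup.lift σ
  have hA : ∀ {a b w}, IsPath S.src S.tgt a b w → A (optEval S.lab w) b = a := by
    intro a b w h
    refine h.act (A.comp (optEval S.lab)) id ?_
    intro e
    rcases hl : S.lab e with _ | b
    · simp [hl, h1 e hl]
    · simpa [hl, A] using hσ b ⟨e, hl⟩
  have hAo : ∀ x, A x S.o = S.o := by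
    intro x
    obtain ⟨g, rfl⟩ := hψ x
    rw [← S.lb]
    exact hA (S.Jp g)
  have hV : ∀ v, v = S.o := by
    intro v
    have := hA (S.hτ v)
    rw [← hAo (optEval S.lab (S.τ v))] at this
    exact (A _).injective this
  have hτo : S.τ S.o = 1 := by
    have := S.JMpath (S.hτ S.o)
    rw [S.Mτ] at this
    simpa using this.symm
  have hτ : ∀ v, S.τ v = 1 := fun v => by rw [hV v, hτo]
  have hJM : ∀ w, S.J (S.M w) = w :=
    hom_eq_of_gen (S.J.comp S.M) (MonoidHom.id _) (fun e => by simp [S.JM, hτ])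
  let θ : FreeGroup (Fin n) ≃* FreeGroup E := MonoidHom.toMulEquiv S.J S.M
    (MonoidHom.ext S.MJ) (MonoidHom.ext hJM)
  have hcard := card_eq_of_freeGroup_equiv θ
  have hex : ∃ e, S.lab e = none := by
    by_contra hcon
    push Not at hcon
    have hs : ∀ e, ∃ b, S.lab e = some b := fun e => Option.ne_none_iff_exists'.1 (hcon e)
    choose b hb using hs
    have : Function.Injective b := by
      intro e e' h
      refine h2 e e' (b e) (hb e) (by rw [hb e', h]) ?_
      rw [hV (S.src e), hV (S.src e')]
    have := Nat.card_le_card_of_injective b this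
    simp at hcard
    omega
  obtain ⟨e, he⟩ := hex
  let ε : Fin n ≃ E := (Finite.card_eq.1 hcard).some
  refine ⟨(FreeGroup.freeGroupCongr ε).trans θ.symm, ε.symm e, ?_⟩
  have : ((FreeGroup.freeGroupCongr ε).trans θ.symm) (of (ε.symm e)) = S.M (of e) := by
    simp [θ]
  rw [this, ← S.lb, hJM]
  simp [he]

theorem NState.red [Finite B] (hψ : Function.Surjective ψ) (hB : Nat.card B < n) :
    ∀ (N : ℕ) (V E : Type) [Finite V] [Finite E] (S : NState ψ V E),
      Nat.card V + {e | S.lab e ≠ none}.ncard = N → Red ψ := by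
  intro N
  induction N using Nat.strong_induction_on with
  | _ N ih =>
  intro V E _ _ S hN
  have key : ∀ (S : NState ψ V E) (e : E), Nat.card V + {e | S.lab e ≠ none}.ncard = N →
      S.lab e = none → S.src e ≠ S.tgt e → S.o ≠ S.tgt e → Red ψ := by
    intro S e hN hl hab hbo
    obtain ⟨S', hS'⟩ := S.contract e hl hab hbo
    refine ih _ ?_ _ _ S' rfl
    have c1 : Nat.card {x : V // x ≠ S.tgt e} < Nat.card V :=
      Finite.card_subtype_lt (x := S.tgt e) (by simp)
    have c2 : {e | S'.lab e ≠ none}.ncard ≤ {e | S.lab e ≠ none}.ncard := by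
      refine Set.ncard_le_ncard_of_injOn Subtype.val ?_ ?_ (Set.toFinite _)
      · intro f hf
        simpa [hS'] using hf
      · intro a _ b _ h
        exact Subtype.ext h
    omega
  have key2 : ∀ (e' : E) (S' : NState ψ V E), S.lab e' ≠ none → S'.lab e' = none →
      (∀ f, f ≠ e' → S'.lab f = S.lab f) → Red ψ := by
    intro e' S' h0 h1 h2
    refine ih _ ?_ _ _ S' rfl
    have : {e | S'.lab e ≠ none}.ncard < {e | S.lab e ≠ none}.ncard := by
      apply Set.ncard_lt_ncard _ (Set.toFinite _)
      rw [Set.ssubset_iff_of_subset]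
      · exact ⟨e', h0, by simpa using h1⟩
      · intro f hf
        by_cases hfe : f = e'
        · subst hfe; exact h0
        · simpa [h2 f hfe] using hf
    omega
  by_contra hcon
  apply hcon
  refine S.final hψ hB ?_ ?_ ?_
  · intro e hl
    by_contra hab
    by_cases hbo : S.o = S.tgt e
    · obtain ⟨S', h1, h2, h3, h4⟩ := S.reverse e hl
      refine hcon (key S' e (by rw [h1]; exact hN) (by rw [h1, hl]) ?_ ?_)
      · rw [h3, h4]; exact Ne.symm hab
      · rw [h2, h4, hbo]; exact Ne.symm hab
    · exact hcon (key S e hN hl hab hbo)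
  · intro e e' b he he' hs
    by_contra hne
    obtain ⟨S', h1, h2⟩ := S.slideSrc e e' (Ne.symm hne) (by rw [he, he']) hs
    exact hcon (key2 e' S' (by simp [he']) h1 h2)
  · intro e e' b he he' hs
    by_contra hne
    obtain ⟨S', h1, h2⟩ := S.slideTgt e e' (Ne.symm hne) (by rw [he, he']) hs
    exact hcon (key2 e' S' (by simp [he']) h1 h2)

end free

section trie
variable (B C : Type) (L : ℕ)

/-- vertices of the trie -/
abbrev TV : Type := {l : List (B × Bool) // l.length ≤ L + 1}
/-- edges of the trie -/
abbrev TE : Type := ((B × Bool) × {l : List (B × Bool) // l.length ≤ L}) ⊕ C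

variable {B C L}

instance [Finite B] : Finite (TV B L) := (List.finite_length_le (B × Bool) (L + 1)).to_subtype
instance [Finite B] [Finite C] : Finite (TE B C L) :=
  haveI : Finite {l : List (B × Bool) // l.length ≤ L} :=
    (List.finite_length_le (B × Bool) L).to_subtype
  inferInstance

/-- root -/
def troot : TV B L := ⟨[], by simp⟩

/-- child -/
def tcons (p : B × Bool) (l : {l : List (B × Bool) // l.length ≤ L}) : TV B L :=
  ⟨p :: l.1, by simpa using l.2⟩
/-- inclusion -/
def tinc (l : {l : List (B × Bool) // l.length ≤ L}) : TV B L := ⟨l.1, l.2.trans (Nat.le_succ L)⟩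

/-- source in the trie -/
def tsrc (cs : C → TV B L) : TE B C L → TV B L
  | .inl (p, l) => if p.2 then tinc l else tcons p l
  | .inr c => cs c

/-- target in the trie -/
def ttgt (ct : C → TV B L) : TE B C L → TV B L
  | .inl (p, l) => if p.2 then tcons p l else tinc l
  | .inr c => ct c

/-- tree paths -/
def tτ' (C : Type) (L : ℕ) : (l : List (B × Bool)) → l.length ≤ L + 1 → FreeGroup (TE B C L)
  | [], _ => 1
  | p :: l, h => tτ' C L l (by simp at h; omega) *
      (if p.2 then of (.inl (p, ⟨l, by simpa using h⟩))
        else (of (.inl (p, ⟨l, by simpa using h⟩)))⁻¹)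

/-- tree paths -/
def tτ (v : TV B L) : FreeGroup (TE B C L) := tτ' C L v.1 v.2

@[simp] theorem tτ_root : tτ (troot : TV B L) = (1 : FreeGroup (TE B C L)) := rfl

theorem tτ_cons (p : B × Bool) (l : {l : List (B × Bool) // l.length ≤ L}) :
    (tτ (tcons p l) : FreeGroup (TE B C L)) = tτ (tinc l) *
      (if p.2 then of (.inl (p, l)) else (of (.inl (p, l)))⁻¹) := rfl

theorem TV.induction {P : TV B L → Prop} (h0 : P troot) (h1 : ∀ p l, P (tinc l) → P (tcons p l))
    (v : TV B L) : P v := by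
  obtain ⟨l, hl⟩ := v
  induction l with
  | nil => exact h0
  | cons p l ih => exact h1 p ⟨l, by simpa using hl⟩ (ih _)

theorem tτ_tree (cs ct : C → TV B L) (p : B × Bool) (l : {l : List (B × Bool) // l.length ≤ L}) :
    (tτ (tsrc cs (.inl (p, l))) : FreeGroup (TE B C L)) * of (.inl (p, l)) *
      (tτ (ttgt ct (.inl (p, l))))⁻¹ = 1 := by
  rcases p with ⟨b, s⟩
  cases s <;> simp [tsrc, ttgt, tτ_cons]

theorem tτ_path (cs ct : C → TV B L) (v : TV B L) :
    IsPath (tsrc cs) (ttgt ct) troot v (tτ v) := by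
  induction v using TV.induction with
  | h0 => exact IsPath.nil _
  | h1 p l ih =>
    rw [tτ_cons]
    rcases p with ⟨b, s⟩
    cases s
    · refine ih.trans ?_
      simpa [tsrc, ttgt] using IsPath.edge_inv (tsrc cs) (ttgt ct) (.inl ((b, false), l))
    · refine ih.trans ?_
      simpa [tsrc, ttgt] using IsPath.edge (tsrc cs) (ttgt ct) (.inl ((b, true), l))

theorem tτ_eval (f : FreeGroup (TE B C L) →* FreeGroup B)
    (hf : ∀ p l, f (of (.inl (p, l))) = of p.1) (v : TV B L) :
    f (tτ v) = FreeGroup.mk v.1.reverse := by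
  induction v using TV.induction with
  | h0 => rw [tτ_root, map_one]; rfl
  | h1 p l ih =>
    rw [tτ_cons, map_mul, ih]
    rcases p with ⟨b, s⟩
    cases s
    · simp only [Bool.false_eq_true, if_false, map_inv, hf]
      simp [tinc, tcons, FreeGroup.of, ← FreeGroup.mul_mk, FreeGroup.inv_mk, FreeGroup.invRev]
    · simp only [if_true, hf]
      simp [tinc, tcons, FreeGroup.of, ← FreeGroup.mul_mk]

theorem tτ_kill {H : Type} [Group H] (f : FreeGroup (TE B C L) →* H)
    (hf : ∀ p l, f (of (.inl (p, l))) = 1) (v : TV B L) : f (tτ v) = 1 := by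
  induction v using TV.induction with
  | h0 => simp
  | h1 p l ih =>
    rw [tτ_cons, map_mul, ih]
    split_ifs <;> simp [hf]

end trie

theorem exists_list {B : Type} (x : FreeGroup B) :
    ∃ l : List (B × Bool), FreeGroup.mk l.reverse = x := by
  obtain ⟨l, rfl⟩ := Quot.exists_rep x
  exact ⟨l.reverse, by simp [FreeGroup.quot_mk_eq_mk]⟩

theorem exists_bound {A : Type} [Finite A] (f : A → ℕ) : ∃ N, ∀ a, f a ≤ N := by
  obtain ⟨N, hN⟩ := (Set.finite_range f).bddAbove
  exact ⟨N, fun a => hN ⟨a, rfl⟩⟩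

/-- Lemma N: surjections between free groups that lower the rank are reducible. -/
theorem red_of_free {n : ℕ} {B : Type} [Finite B] (ψ : FreeGroup (Fin n) →* FreeGroup B)
    (hψ : Function.Surjective ψ) (hB : Nat.card B < n) : Red ψ := by
  have h := fun j : Fin n => exists_list (ψ (of j))
  choose g hg using h
  obtain ⟨L, hL⟩ := exists_bound fun j => (g j).length
  let gv : Fin n → TV B L := fun j => ⟨g j, (hL j).trans (Nat.le_succ L)⟩
  let ct : Fin n → TV B L := fun _ => troot
  let lab : TE B (Fin n) L → Option B := Sum.elim (fun q => some q.1.1) (fun _ => none)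
  let J : FreeGroup (Fin n) →* FreeGroup (TE B (Fin n) L) :=
    FreeGroup.lift fun j => tτ (gv j) * of (.inr j)
  let M : FreeGroup (TE B (Fin n) L) →* FreeGroup (Fin n) :=
    FreeGroup.lift (Sum.elim (fun _ => 1) of)
  have hMτ : ∀ v : TV B L, M (tτ v) = 1 := tτ_kill M (by simp [M])
  have hlab : ∀ v : TV B L, optEval lab (tτ v) = FreeGroup.mk v.1.reverse :=
    tτ_eval _ (by simp [lab])
  let S : NState ψ (TV B L) (TE B (Fin n) L) :=
    { src := tsrc gv, tgt := ttgt ct, lab := lab, o := troot, J := J, M := M, τ := tτ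
      hτ := tτ_path gv ct
      Mτ := hMτ
      MJ := hom_eq_of_gen (M.comp J) (MonoidHom.id _) (fun j => by
        simp [J, hMτ]; simp [M])
      Jp := hom_mem_of_gen J (loops (tsrc gv) (ttgt ct) troot) (fun j => by
        rw [mem_loops]
        simp only [J, FreeGroup.lift_apply_of]
        exact (tτ_path gv ct (gv j)).trans (IsPath.edge (tsrc gv) (ttgt ct) (.inr j)))
      JM := by
        rintro (⟨p, l⟩ | j)
        · rw [tτ_tree]; simp [M]
        · simp [M, J, tsrc, ttgt, ct]
      lb := hom_eq_of_gen ((optEval lab).comp J) ψ (fun j => by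
        simp [J, hlab]; simp [gv, hg, lab]) }
  exact NState.red hψ hB _ _ _ S rfl

end NSG

namespace NSG
open FreeGroup (of)

section words
variable {m : ℕ} {E E' : Type}

theorem zmod_reach [NeZero m] {P : ZMod m → Prop} {j1 j : ZMod m} (hj : P j)
    (h : ∀ i, i ≠ j1 → P i → P (i + 1)) : P j1 := by
  have key : ∀ (d : ℕ) (j : ZMod m), P j → j + d = j1 → P j1 := by
    intro d
    induction d with
    | zero => intro j hj h1; simpa [← h1] using hj
    | succ d ih =>
      intro j hj h1
      by_cases hjj : j = j1
      · rwa [← hjj]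
      · exact ih (j + 1) (h j hjj hj) (by rw [← h1]; push_cast; ring)
  exact key (j1 - j).val j hj (by simp)

theorem zmod_reach_back [NeZero m] {P : ZMod m → Prop} {j1 j : ZMod m} (hj : P j)
    (h : ∀ i, i ≠ j1 → P i → P (i - 1)) : P j1 := by
  have := zmod_reach (P := fun i => P (-i)) (j1 := -j1) (j := -j) (by simpa using hj)
    (fun i hi hp => by
      have := h (-i) (fun hh => hi (by rw [← hh]; simp)) hp
      rwa [show -(i + 1) = -i - 1 by ring])
  simpa using this

/-- cyclic word -/
def W (c : ZMod m → E) (s : ZMod m) (len : ℕ) : FreeGroup E :=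
  ((List.range len).map fun t => of (c (s + t))).prod

@[simp] theorem W_zero (c : ZMod m → E) (s : ZMod m) : W c s 0 = 1 := by simp [W]

theorem W_succ (c : ZMod m → E) (s : ZMod m) (len : ℕ) :
    W c s (len + 1) = W c s len * of (c (s + len)) := by
  simp [W, List.range_succ]

theorem W_add (c : ZMod m → E) (s : ZMod m) (a b : ℕ) :
    W c s (a + b) = W c s a * W c (s + a) b := by
  induction b with
  | zero => simp
  | succ b ih => rw [← add_assoc, W_succ, W_succ, ih, mul_assoc]; push_cast; rw [add_assoc s]

theorem W_map (h : FreeGroup E →* FreeGroup E') (c : ZMod m → E) (c' : ZMod m → E') (s : ZMod m)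
    (len : ℕ) (hc : ∀ t < len, h (of (c (s + (t : ℕ)))) = of (c' (s + (t : ℕ)))) :
    h (W c s len) = W c' s len := by
  induction len with
  | zero => simp
  | succ b ih =>
    rw [W_succ, W_succ, map_mul, ih (fun t ht => hc t (by omega)), hc b (by omega)]

theorem W_rot [NeZero m] (c : ZMod m → E) (s : ZMod m) :
    W c 0 m * W c 0 s.val = W c 0 s.val * W c s m := by
  have h1 := W_add c 0 s.val m
  have h2 := W_add c 0 m s.val
  rw [add_comm, h2] at h1
  simpa using h1

theorem W_rot_mem [NeZero m] {H : Type} [Group H] (f : FreeGroup E →* H) (N : Subgroup H)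
    [hN : N.Normal] (c : ZMod m → E) (s : ZMod m) (h : f (W c 0 m) ∈ N) : f (W c s m) ∈ N := by
  have h1 : W c s m = (W c 0 s.val)⁻¹ * W c 0 m * ((W c 0 s.val)⁻¹)⁻¹ := by
    rw [inv_inv, mul_assoc, W_rot]; group
  rw [h1]
  simpa using hN.conj_mem _ h (f (W c 0 s.val))⁻¹

theorem W_path {V : Type} {src tgt : E → V} (c : ZMod m → E) (s : ZMod m) (len : ℕ)
    (h : ∀ t < len, tgt (c (s + (t : ℕ))) = src (c (s + (t : ℕ) + 1))) :
    IsPath src tgt (src (c s)) (src (c (s + len))) (W c s len) := by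
  induction len with
  | zero => simpa using IsPath.nil _
  | succ b ih =>
    rw [W_succ]
    have := (ih (fun t ht => h t (by omega))).fwd (c (s + b))
    rw [h b (by omega)] at this
    push_cast
    rwa [← add_assoc]

theorem natCast_ne_neg_one {t : ℕ} (ht : t + 1 < m) : (t : ZMod m) + 1 ≠ 0 := by
  intro h
  have h' : ((t + 1 : ℕ) : ZMod m) = 0 := by push_cast; exact h
  rw [ZMod.natCast_eq_zero_iff] at h'
  have := Nat.le_of_dvd (by omega) h'
  omega

/-- path of a cyclic word broken at one place -/
theorem W_path_broken [NeZero m] {V : Type} {src tgt : E → V} (c : ZMod m → E) (j : ZMod m)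
    (h : ∀ i, i ≠ j - 1 → i ≠ j → tgt (c i) = src (c (i + 1)))
    (h' : j - 1 ≠ j → tgt (c (j - 1)) = src (c j)) :
    IsPath src tgt (src (c (j + 1))) (src (c j)) (W c (j + 1) (m - 1)) := by
  have hm : ((m - 1 : ℕ) : ZMod m) = -1 := by
    rw [Nat.cast_sub (NeZero.one_le)]; simp
  have := W_path (src := src) (tgt := tgt) c (j + 1) (m - 1) (by
    intro t ht
    have h1 : j + 1 + (t : ZMod m) ≠ j := by
      intro h2
      apply natCast_ne_neg_one (t := t) (m := m) (by omega)
      linear_combination h2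
    by_cases h3 : j + 1 + (t : ZMod m) = j - 1
    · rw [h3, sub_add_cancel]
      exact h' (by rw [← h3]; exact h1)
    · exact h _ h3 h1)
  rw [hm] at this
  simpa using this

end words

section graphs
variable {V E B V' E' : Type}

/-- labelled graphs -/
structure Gr (V E B : Type) where
  src : E → V
  tgt : E → V
  lab : E → B

/-- paths -/
abbrev Gr.Path (Γ : Gr V E B) (a b : V) (w : FreeGroup E) : Prop := IsPath Γ.src Γ.tgt a b w

/-- every group element is the label of a closed path -/
def Gr.Full (Γ : Gr V E B) (o : V) : Prop :=
  ∀ g : FreeGroup B, ∃ w, Γ.Path o o w ∧ FreeGroup.map Γ.lab w = g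

/-- connected -/
def Gr.Conn (Γ : Gr V E B) (o : V) : Prop := ∀ a, ∃ w, Γ.Path o a w

/-- folded graphs -/
structure Gr.Folded (Γ : Gr V E B) : Prop where
  s : ∀ e f, Γ.src e = Γ.src f → Γ.lab e = Γ.lab f → e = f
  t : ∀ e f, Γ.tgt e = Γ.tgt f → Γ.lab e = Γ.lab f → e = f

theorem Gr.Full.map {Γ : Gr V E B} {o : V} (hF : Γ.Full o) (Γ' : Gr V' E' B) (q : V → V')
    (h : E → E') (hs : ∀ e, Γ'.src (h e) = q (Γ.src e)) (ht : ∀ e, Γ'.tgt (h e) = q (Γ.tgt e))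
    (hl : ∀ e, Γ'.lab (h e) = Γ.lab e) : Γ'.Full (q o) := by
  intro g
  obtain ⟨w, hw, rfl⟩ := hF g
  refine ⟨FreeGroup.map h w, hw.map q _ ?_, ?_⟩
  · intro e
    rw [FreeGroup.map.of, ← hs, ← ht]
    exact IsPath.edge _ _ _
  · exact hom_eq_of_gen ((FreeGroup.map Γ'.lab).comp (FreeGroup.map h)) (FreeGroup.map Γ.lab)
      (by simp [hl]) w

theorem Gr.Folded.perm [Finite V] {Γ : Gr V E B} (hΓ : Γ.Folded) :
    ∃ σ : B → Equiv.Perm V, ∀ e, σ (Γ.lab e) (Γ.tgt e) = Γ.src e := by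
  have hσ : ∀ b : B, ∃ σ : Equiv.Perm V, ∀ e : {e // Γ.lab e = b},
      σ (Γ.tgt e.1) = Γ.src e.1 := by
    intro b
    apply exists_perm_extend (fun e : {e // Γ.lab e = b} => Γ.src e.1)
      (fun e : {e // Γ.lab e = b} => Γ.tgt e.1)
    intro e e'
    constructor
    · intro h
      rw [hΓ.s e.1 e'.1 h (by rw [e.2, e'.2])]
    · intro h
      rw [hΓ.t e.1 e'.1 h (by rw [e.2, e'.2])]
  choose σ hσ using hσ
  exact ⟨σ, fun e => hσ _ ⟨e, rfl⟩⟩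

theorem Gr.Folded.act [Finite V] {Γ : Gr V E B} (hΓ : Γ.Folded) :
    ∃ A : FreeGroup B →* Equiv.Perm V, ∀ a b w, Γ.Path a b w → A (FreeGroup.map Γ.lab w) b = a := by
  obtain ⟨σ, hσ⟩ := hΓ.perm
  refine ⟨FreeGroup.lift σ, fun a b w h => ?_⟩
  exact h.act ((FreeGroup.lift σ).comp (FreeGroup.map Γ.lab)) id (by simpa using hσ)

theorem Gr.Folded.subsingleton [Finite V] {Γ : Gr V E B} (hΓ : Γ.Folded) {o : V} (hF : Γ.Full o)
    (hc : Γ.Conn o) (v : V) : v = o := by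
  obtain ⟨A, hA⟩ := hΓ.act
  obtain ⟨w, hw⟩ := hc v
  obtain ⟨w', hw', h⟩ := hF (FreeGroup.map Γ.lab w)
  have h1 := hA _ _ _ hw
  have h2 := hA _ _ _ hw'
  rw [h] at h2
  exact (A _).injective (h1.trans h2.symm)

theorem Gr.Folded.inj [Finite V] {Γ : Gr V E B} (hΓ : Γ.Folded) {a b : V} {w : FreeGroup E}
    (hw : Γ.Path a b w) (h1 : FreeGroup.map Γ.lab w = 1) : w = 1 := by
  classical
  obtain ⟨σ, hσ⟩ := hΓ.perm
  let ε : B → V → FreeGroup E := fun b v =>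
    if h : ∃ e, Γ.lab e = b ∧ Γ.tgt e = v then of h.choose else 1
  have hε : ∀ e, ε (Γ.lab e) (Γ.tgt e) = of e := by
    intro e
    have h : ∃ f, Γ.lab f = Γ.lab e ∧ Γ.tgt f = Γ.tgt e := ⟨e, rfl, rfl⟩
    simp only [ε, dif_pos h]
    rw [hΓ.t _ e h.choose_spec.2 h.choose_spec.1]
  let A : FreeGroup B →* Equiv.Perm (V × FreeGroup E) := FreeGroup.lift fun b =>
    Equiv.prodShear (σ b) (fun v => Equiv.mulLeft (ε b v))
  have hA : ∀ e g, A (of (Γ.lab e)) (Γ.tgt e, g) = (Γ.src e, of e * g) := by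
    intro e g
    simp [A, hσ, hε]
  have key : ∀ g, A (FreeGroup.map Γ.lab w) (b, g) = (a, w * g) := by
    clear h1
    induction hw with
    | nil => simp
    | fwd e _ ih =>
      intro g
      rw [map_mul, map_mul, Equiv.Perm.mul_apply, FreeGroup.map.of, hA, ih, mul_assoc]
    | bwd e _ ih =>
      intro g
      rw [map_mul, map_mul, Equiv.Perm.mul_apply, map_inv, map_inv, FreeGroup.map.of]
      have h2 := hA e ((of e)⁻¹ * g)
      rw [mul_inv_cancel_left] at h2
      rw [Equiv.Perm.inv_eq_iff_eq.2 h2.symm, ih, mul_assoc]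
  have := key 1
  rw [h1] at this
  simpa using (congrArg Prod.snd this).symm

/-- existence of the folded quotient -/
theorem Gr.exists_fold [Finite V] [Finite B] (Γ : Gr V E B) :
    ∃ (VX EX : Type) (_ : Finite VX) (_ : Finite EX) (X : Gr VX EX B) (q : V → VX) (qE : E → EX),
      X.Folded ∧ Function.Surjective q ∧ Function.Surjective qE ∧
      (∀ e, X.src (qE e) = q (Γ.src e)) ∧ (∀ e, X.tgt (qE e) = q (Γ.tgt e)) ∧
      (∀ e, X.lab (qE e) = Γ.lab e) ∧
      (∀ a b, q a = q b → ∃ w, Γ.Path a b w ∧ FreeGroup.map Γ.lab w = 1) := by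
  let st : Setoid V :=
    { r := fun a b => ∃ w, Γ.Path a b w ∧ FreeGroup.map Γ.lab w = 1
      iseqv := ⟨fun a => ⟨1, IsPath.nil a, by simp⟩,
        fun ⟨w, h, h'⟩ => ⟨w⁻¹, h.symm, by simp [h']⟩,
        fun ⟨w, h, h'⟩ ⟨u, k, k'⟩ => ⟨w * u, h.trans k, by simp [h', k']⟩⟩ }
  let q : V → Quotient st := fun v => Quotient.mk st v
  have hq : ∀ a b, q a = q b → ∃ w, Γ.Path a b w ∧ FreeGroup.map Γ.lab w = 1 :=
    fun a b h => Quotient.exact h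
  let EX := {x : Quotient st × B // ∃ e, (q (Γ.src e), Γ.lab e) = x}
  let qE : E → EX := fun e => ⟨(q (Γ.src e), Γ.lab e), e, rfl⟩
  let X : Gr (Quotient st) EX B :=
    { src := fun x => x.1.1, tgt := fun x => q (Γ.tgt x.2.choose), lab := fun x => x.1.2 }
  have hqE : Function.Surjective qE := by
    rintro ⟨x, e, rfl⟩
    exact ⟨e, rfl⟩
  have ht : ∀ e, X.tgt (qE e) = q (Γ.tgt e) := by
    intro e
    have h := (qE e).2.choose_spec
    set f := (qE e).2.choose with hf
    have h1 : q (Γ.src f) = q (Γ.src e) := congrArg Prod.fst h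
    have h2 : Γ.lab f = Γ.lab e := congrArg Prod.snd h
    obtain ⟨w, hw, hw'⟩ := hq _ _ h1
    apply Quotient.sound
    refine ⟨(of f)⁻¹ * w * of e, ((IsPath.edge_inv _ _ f).trans hw).trans (IsPath.edge _ _ e), ?_⟩
    simp [hw', h2]
  refine ⟨Quotient st, EX, inferInstance, inferInstance, X, q, qE, ⟨?_, ?_⟩, Quotient.mk_surjective,
    hqE, fun _ => rfl, ht, fun _ => rfl, hq⟩
  · intro e f h1 h2
    exact Subtype.ext (Prod.ext h1 h2)
  · intro x y h1 h2
    obtain ⟨e, rfl⟩ := hqE x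
    obtain ⟨f, rfl⟩ := hqE y
    rw [ht, ht] at h1
    have h2 : Γ.lab e = Γ.lab f := h2
    obtain ⟨w, hw, hw'⟩ := hq _ _ h1
    refine Subtype.ext (Prod.ext (Quotient.sound ?_) h2)
    refine ⟨of e * w * (of f)⁻¹, ((IsPath.edge _ _ e).trans hw).trans (IsPath.edge_inv _ _ f), ?_⟩
    simp [hw', h2]

end graphs
end NSG

namespace NSG
open FreeGroup (of)

/-- the combinatorial features of the boundary word -/
structure Bdry (m : ℕ) (B : Type) where
  ℓ : ZMod m → B
  π : ZMod m → ZMod m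
  surj : Function.Surjective ℓ
  fib : ∀ j j', ℓ j = ℓ j' → j' = j ∨ j' = π j
  inv : ∀ j, π (π j) = j
  ne : ∀ j, π j ≠ j
  adj : ∀ j, π j = j + 1 ∨ j = π j + 1

section main
variable {m n : ℕ} {B V E V' E' G : Type} [Group G]

/-- cells -/
structure Gr.IsCell (Γ : Gr V E B) (D : Bdry m B) (c : ZMod m → E) : Prop where
  l : ∀ j, Γ.lab (c j) = D.ℓ j
  c : ∀ j, Γ.tgt (c j) = Γ.src (c (j + 1))

/-- collapsibility -/
def Coll (Q : Set (ZMod m → E)) : Prop :=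
  ∀ K ⊆ Q, K.Nonempty → ∃ c ∈ K, ∃ j, ∀ c' ∈ K, ∀ j', c' j' = c j → c' = c ∧ j' = j

/-- normal closure of the cells -/
def NQ (Q : Set (ZMod m → E)) : Subgroup (FreeGroup E) :=
  Subgroup.normalClosure ((fun c => W c 0 m) '' Q)

instance (Q : Set (ZMod m → E)) : (NQ Q).Normal := Subgroup.normalClosure_normal

theorem mem_NQ {Q : Set (ZMod m → E)} {c : ZMod m → E} (h : c ∈ Q) : W c 0 m ∈ NQ Q :=
  Subgroup.subset_normalClosure ⟨c, h, rfl⟩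

/-- the states of the descent -/
structure MState (D : Bdry m B) (ρ : FreeGroup B →* G) (φ : FreeGroup (Fin n) →* G)
    (Γ : Gr V E B) (Q : Set (ZMod m → E)) where
  o : V
  cell : ∀ c ∈ Q, Γ.IsCell D c
  conn : Γ.Conn o
  ψ : FreeGroup (Fin n) →* FreeGroup E
  ψp : ∀ g, Γ.Path o o (ψ g)
  ψρ : ∀ g, ρ (FreeGroup.map Γ.lab (ψ g)) = φ g
  gen : ∀ w, Γ.Path o o w → w ∈ ψ.range ⊔ NQ Q

variable {D : Bdry m B} {ρ : FreeGroup B →* G} {φ : FreeGroup (Fin n) →* G}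
  {Γ : Gr V E B} {Q : Set (ZMod m → E)}

theorem MState.transfer (S : MState D ρ φ Γ Q) (Γ' : Gr V' E' B) (Q' : Set (ZMod m → E'))
    (q : V → V') (hq : Function.Surjective q) (h : FreeGroup E →* FreeGroup E')
    (hcell : ∀ c ∈ Q', Γ'.IsCell D c)
    (hp : ∀ e, Γ'.Path (q (Γ.src e)) (q (Γ.tgt e)) (h (of e)))
    (hl : ∀ e, ρ (FreeGroup.map Γ'.lab (h (of e))) = ρ (of (Γ.lab e)))
    (hN : ∀ c ∈ Q, h (W c 0 m) ∈ NQ Q')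
    (l1 : ∀ e', ∃ a b w, Γ.Path a b w ∧ q a = Γ'.src e' ∧ q b = Γ'.tgt e' ∧
      (h w)⁻¹ * of e' ∈ NQ Q')
    (l2 : ∀ a b, q a = q b → ∃ w, Γ.Path a b w ∧ h w ∈ NQ Q') :
    ∃ S' : MState D ρ φ Γ' Q', S'.o = q S.o := by
  have hN' : NQ Q ≤ (NQ Q').comap h := by
    apply Subgroup.normalClosure_le_normal
    rintro _ ⟨c, hc, rfl⟩
    exact hN c hc
  refine ⟨{ o := q S.o, cell := hcell, conn := ?_, ψ := h.comp S.ψ, ψp := ?_, ψρ := ?_, gen := ?_ },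
    rfl⟩
  · intro a'
    obtain ⟨a, rfl⟩ := hq a'
    obtain ⟨w, hw⟩ := S.conn a
    exact ⟨h w, hw.map q h hp⟩
  · intro g
    exact (S.ψp g).map q h hp
  · intro g
    rw [← S.ψρ]
    exact hom_eq_of_gen (ρ.comp ((FreeGroup.map Γ'.lab).comp h)) (ρ.comp (FreeGroup.map Γ.lab))
      (by simpa using hl) (S.ψ g)
  · intro w' hw'
    obtain ⟨w, hw, hn⟩ := hw'.lift q h (NQ Q') l1 l2 S.o S.o rfl rfl
    have h1 := S.gen w hw
    have h2 : S.ψ.range ⊔ NQ Q ≤ ((h.comp S.ψ).range ⊔ NQ Q').comap h := by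
      refine sup_le ?_ ?_
      · rintro _ ⟨g, rfl⟩
        exact Subgroup.mem_sup_left ⟨g, rfl⟩
      · exact hN'.trans (Subgroup.comap_mono le_sup_right)
    have h3 : h w ∈ (h.comp S.ψ).range ⊔ NQ Q' := h2 h1
    have h5 : (h w)⁻¹ * w' ∈ (h.comp S.ψ).range ⊔ NQ Q' := Subgroup.mem_sup_right hn
    have h4 := Subgroup.mul_mem _ h3 h5
    rwa [mul_inv_cancel_left] at h4

/-- The case without cells. -/
theorem MState.red_of_free_full [Finite B] (hn : Nat.card B < n) (S : MState D ρ φ Γ Q)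
    (hQ : Q = ∅) (hF : Γ.Full S.o) : Red φ := by
  have hN : NQ Q = ⊥ := by simp [NQ, hQ]
  have : Red ((FreeGroup.map Γ.lab).comp S.ψ) := by
    refine red_of_free _ ?_ hn
    intro g
    obtain ⟨w, hw, rfl⟩ := hF g
    have := S.gen w hw
    rw [hN, sup_bot_eq] at this
    obtain ⟨y, rfl⟩ := this
    exact ⟨y, rfl⟩
  obtain ⟨α, i, h⟩ := this
  refine ⟨α, i, ?_⟩
  rw [← S.ψρ]
  simp only [MonoidHom.comp_apply] at h
  rw [h, map_one]

/-- few edges at a single vertex -/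
theorem MState.red_of_few [Finite E] (hn : Nat.card E < n) (S : MState D ρ φ Γ Q)
    (hQ : Q = ∅) (hV : ∀ v, v = S.o) : Red φ := by
  have hN : NQ Q = ⊥ := by simp [NQ, hQ]
  have : Red S.ψ := by
    refine red_of_free _ ?_ hn
    intro g
    have hg : ∀ g, Γ.Path S.o S.o g := by
      refine hom_mem_of_gen (MonoidHom.id _) (loops Γ.src Γ.tgt S.o) ?_
      intro e
      have := IsPath.edge Γ.src Γ.tgt e
      rw [hV (Γ.src e), hV (Γ.tgt e)] at this
      exact this
    have := S.gen g (hg g)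
    rwa [hN, sup_bot_eq] at this
  obtain ⟨α, i, h⟩ := this
  refine ⟨α, i, ?_⟩
  rw [← S.ψρ, h, map_one, map_one]

/-- Determinism of cells in a folded graph. -/
theorem Gr.Folded.cell_ext [NeZero m] (hΓ : Γ.Folded) {c c' : ZMod m → E} (hc : Γ.IsCell D c)
    (hc' : Γ.IsCell D c') {j : ZMod m} (h : c j = c' j) : c = c' := by
  funext i
  refine zmod_reach (P := fun i => c i = c' i) h ?_
  intro i _ hi
  refine hΓ.s _ _ ?_ (by rw [hc.l, hc'.l])
  rw [← hc.c, ← hc'.c, hi]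

theorem Gr.Folded.cell_broken [NeZero m] (hΓ : Γ.Folded) {c p : ZMod m → E} (hc : Γ.IsCell D c)
    (hp : ∀ j, Γ.lab (p j) = D.ℓ j) (j1 : ZMod m)
    (hb : ∀ j, j ≠ j1 → Γ.tgt (p j) = Γ.src (p (j + 1)))
    (huv : Γ.src (p (j1 + 1)) ≠ Γ.tgt (p j1)) (j : ZMod m) : p j ≠ c j := by
  intro h
  have h1 : p j1 = c j1 := by
    refine zmod_reach (P := fun i => p i = c i) h ?_
    intro i hij hi
    refine hΓ.s _ _ ?_ (by rw [hc.l, hp])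
    rw [← hc.c, ← hb i hij, hi]
  have h2 : p (j1 + 1) = c (j1 + 1) := by
    refine zmod_reach_back (P := fun i => p i = c i) h ?_
    intro i hij hi
    refine hΓ.t _ _ ?_ (by rw [hc.l, hp])
    rw [hc.c, hb (i - 1) (fun hh => hij (by rw [← hh]; ring)), sub_add_cancel, hi]
  apply huv
  rw [h1, h2, hc.c]

/-- sum of boundary contributions -/
theorem sum_cell [NeZero m] (src tgt : E → V) (χ : V → ZMod 2) (c : ZMod m → E)
    (hc : ∀ j, tgt (c j) = src (c (j + 1))) : ∑ j, (χ (src (c j)) + χ (tgt (c j))) = 0 := by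
  simp only [hc, Finset.sum_add_distrib]
  have : ∑ j, χ (src (c (j + 1))) = ∑ j, χ (src (c j)) :=
    Equiv.sum_comp (Equiv.addRight (1 : ZMod m)) (fun j => χ (src (c j)))
  rw [this]
  exact CharTwo.add_self_eq_zero _

theorem sum_broken [NeZero m] (src tgt : E → V) (χ : V → ZMod 2) (c : ZMod m → E) (j1 : ZMod m)
    (hc : ∀ j, j ≠ j1 → tgt (c j) = src (c (j + 1))) :
    ∑ j, (χ (src (c j)) + χ (tgt (c j))) = χ (src (c (j1 + 1))) + χ (tgt (c j1)) := by
  classical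
  have h1 : ∀ j, χ (tgt (c j)) = χ (src (c (j + 1))) +
      if j = j1 then χ (src (c (j1 + 1))) + χ (tgt (c j1)) else 0 := by
    intro j
    by_cases h : j = j1
    · subst h
      rw [if_pos rfl, ← add_assoc, CharTwo.add_self_eq_zero, zero_add]
    · simp [h, hc j h]
  rw [Finset.sum_add_distrib, Finset.sum_congr rfl (fun j _ => h1 j), Finset.sum_add_distrib,
    ← add_assoc]
  have : ∑ j, χ (src (c (j + 1))) = ∑ j, χ (src (c j)) :=
    Equiv.sum_comp (Equiv.addRight (1 : ZMod m)) (fun j => χ (src (c j)))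
  rw [this, CharTwo.add_self_eq_zero]
  simp

end main
end NSG

namespace NSG
open FreeGroup (of)

section main
variable {m n : ℕ} {B V E V' E' G : Type} [Group G]
variable {D : Bdry m B} {ρ : FreeGroup B →* G} {φ : FreeGroup (Fin n) →* G}
  {Γ : Gr V E B} {Q : Set (ZMod m → E)}

theorem W_cell_map {c : ZMod m → E} (hc : ∀ j, Γ.lab (c j) = D.ℓ j) (s : ZMod m) (len : ℕ) :
    FreeGroup.map Γ.lab (W c s len) = W D.ℓ s len :=
  W_map _ _ _ _ _ (fun t _ => by simp [hc])

theorem Gr.IsCell.path {c : ZMod m → E} (hc : Γ.IsCell D c) (s : ZMod m) :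
    Γ.Path (Γ.src (c s)) (Γ.src (c s)) (W c s m) := by
  simpa using W_path (src := Γ.src) (tgt := Γ.tgt) c s m (fun t _ => hc.c _)

theorem coll_closed [NeZero m] [Finite V] (hΓ : Γ.Folded)
    (S : MState D ρ φ Γ Q) (hφ : Function.Surjective φ)
    (hρ : ∀ w, ρ w = 1 → w ∈ Subgroup.normalClosure {W D.ℓ 0 m})
    (K : Set (ZMod m → E)) (hK : K.Nonempty) (hc : ∀ c ∈ K, Γ.IsCell D c)
    (hpart : ∀ c ∈ K, ∀ j, ∃ c' ∈ K, c' (D.π j) = c j) : Γ.Full S.o := by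
  have hW1 : ∀ j x, (∃ c ∈ K, Γ.src (c j) = x) → ∃ c ∈ K, Γ.src (c (D.π j)) = x := by
    rintro j x ⟨c, hcK, rfl⟩
    obtain ⟨c', h1, h2⟩ := hpart c hcK j
    exact ⟨c', h1, by rw [h2]⟩
  have hW2 : ∀ j x, (∃ c ∈ K, Γ.src (c (D.π j + 1)) = x) → ∃ c ∈ K, Γ.src (c (j + 1)) = x := by
    rintro j x ⟨c, hcK, rfl⟩
    obtain ⟨c', h1, h2⟩ := hpart c hcK (D.π j)
    rw [D.inv] at h2
    exact ⟨c', h1, by rw [← (hc c hcK).c, ← h2, (hc c' h1).c]⟩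
  have hstep : ∀ j x, (∃ c ∈ K, Γ.src (c j) = x) → ∃ c ∈ K, Γ.src (c (j + 1)) = x := by
    intro j x h
    rcases D.adj j with h1 | h1
    · rw [← h1]; exact hW1 j x h
    · apply hW2
      rwa [← h1]
  have hall : ∀ i j x, (∃ c ∈ K, Γ.src (c i) = x) → ∃ c ∈ K, Γ.src (c j) = x := by
    intro i j x h
    exact zmod_reach (P := fun i => ∃ c ∈ K, Γ.src (c i) = x) h (fun i _ => hstep i x)
  have hedge : ∀ f, (∃ c ∈ K, Γ.src (c 0) = Γ.src f) ↔ ∃ c ∈ K, Γ.src (c 0) = Γ.tgt f := by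
    intro f
    obtain ⟨j, hj⟩ := D.surj (Γ.lab f)
    constructor
    · intro h
      obtain ⟨c, hcK, h1⟩ := hall 0 j _ h
      have h2 : c j = f := hΓ.s _ _ h1 (by rw [(hc c hcK).l, hj])
      exact hall (j + 1) 0 _ ⟨c, hcK, by rw [← (hc c hcK).c, h2]⟩
    · intro h
      obtain ⟨c, hcK, h1⟩ := hall 0 (j + 1) _ h
      rw [← (hc c hcK).c] at h1
      have h2 : c j = f := hΓ.t _ _ h1 (by rw [(hc c hcK).l, hj])
      exact hall j 0 _ ⟨c, hcK, by rw [h2]⟩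
  have hpath : ∀ a b w, Γ.Path a b w →
      ((∃ c ∈ K, Γ.src (c 0) = a) ↔ ∃ c ∈ K, Γ.src (c 0) = b) := by
    intro a b w h
    induction h with
    | nil => rfl
    | fwd e _ ih => rw [ih, hedge]
    | bwd e _ ih => rw [ih, hedge]
  have hU : ∀ x, ∃ c ∈ K, Γ.src (c 0) = x := by
    intro x
    obtain ⟨c, hcK⟩ := hK
    obtain ⟨w, hw⟩ := S.conn (Γ.src (c 0))
    obtain ⟨w', hw'⟩ := S.conn x
    exact (hpath _ _ _ (hw.symm.trans hw')).1 ⟨c, hcK, rfl⟩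
  obtain ⟨A, hA⟩ := hΓ.act
  have hker : Subgroup.normalClosure {W D.ℓ 0 m} ≤ A.ker := by
    apply Subgroup.normalClosure_le_normal
    rintro _ rfl
    refine MonoidHom.mem_ker.2 (Equiv.ext fun x => ?_)
    obtain ⟨c, hcK, rfl⟩ := hU x
    have := hA _ _ _ ((hc c hcK).path 0)
    rwa [W_cell_map (hc c hcK).l] at this
  have hAo : ∀ g, A g S.o = S.o := by
    intro g
    obtain ⟨y, hy⟩ := hφ (ρ g)
    have h1 := hA _ _ _ (S.ψp y)
    rw [← S.ψρ] at hy
    have h2 : A (g⁻¹ * FreeGroup.map Γ.lab (S.ψ y)) = 1 := hker (hρ _ (by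
      rw [map_mul, map_inv, hy, inv_mul_cancel]))
    rw [map_mul, map_inv, inv_mul_eq_one] at h2
    rwa [h2]
  have hV : ∀ v, v = S.o := by
    intro v
    obtain ⟨w, hw⟩ := S.conn v
    have := hA _ _ _ hw
    rw [← hAo (FreeGroup.map Γ.lab w)] at this
    exact (A _).injective this
  intro g
  have : g ∈ (loops Γ.src Γ.tgt S.o).map (FreeGroup.map Γ.lab) := by
    refine hom_mem_of_gen (MonoidHom.id _) _ ?_ g
    intro b
    obtain ⟨j, rfl⟩ := D.surj b
    obtain ⟨c, hcK⟩ := hK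
    refine ⟨of (c j), ?_, by simp [(hc c hcK).l]⟩
    have := IsPath.edge Γ.src Γ.tgt (c j)
    rw [hV (Γ.src (c j)), hV (Γ.tgt (c j))] at this
    exact this
  obtain ⟨w, hw, h⟩ := this
  exact ⟨w, hw, h⟩

theorem coll_break [NeZero m] [Finite V] [Finite E] (hΓ : Γ.Folded)
    (S : MState D ρ φ Γ Q) (hφ : Function.Surjective φ)
    (hρ : ∀ w, ρ w = 1 → w ∈ Subgroup.normalClosure {W D.ℓ 0 m})
    (hF : ¬ Γ.Full S.o) (p : ZMod m → E)
    (hp : ∀ j, Γ.lab (p j) = D.ℓ j) (j1 : ZMod m)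
    (hb : ∀ j, j ≠ j1 → Γ.tgt (p j) = Γ.src (p (j + 1)))
    (huv : Γ.src (p (j1 + 1)) ≠ Γ.tgt (p j1)) : Coll (insert p Q) := by
  classical
  intro K hK hne
  by_contra hcon
  push Not at hcon
  have hlab : ∀ c ∈ K, ∀ j, Γ.lab (c j) = D.ℓ j := by
    intro c hc j
    rcases hK hc with rfl | h
    · exact hp j
    · exact (S.cell c h).l j
  have hdet : ∀ c ∈ K, ∀ c' ∈ K, ∀ j, c j = c' j → c = c' := by
    intro c hc c' hc' j h
    rcases hK hc with rfl | h1 <;> rcases hK hc' with rfl | h2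
    · rfl
    · exact absurd h (hΓ.cell_broken (S.cell _ h2) hp j1 hb huv j)
    · exact absurd h.symm (hΓ.cell_broken (S.cell _ h1) hp j1 hb huv j)
    · exact hΓ.cell_ext (S.cell _ h1) (S.cell _ h2) h
  have hpart : ∀ c ∈ K, ∀ j, ∃ c' ∈ K, c' (D.π j) = c j := by
    intro c hc j
    obtain ⟨c', hc', j', h1, h2⟩ := hcon c hc j
    have h3 := congrArg Γ.lab h1
    rw [hlab c' hc', hlab c hc] at h3
    rcases D.fib j j' h3.symm with h4 | h4
    · subst h4
      exact absurd rfl (h2 (hdet c' hc' c hc _ h1))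
    · subst h4
      exact ⟨c', hc', h1⟩
  by_cases hpK : p ∈ K
  · have : Nonempty (ZMod m → E) := ⟨p⟩
    choose! F hFK hF' using hpart
    let Kf : Finset (ZMod m → E) := K.toFinite.toFinset
    have hKf : ∀ c, c ∈ Kf ↔ c ∈ K := fun c => by simp [Kf]
    let χ : V → ZMod 2 := fun x => if x = Γ.src (p (j1 + 1)) then 1 else 0
    let f : (ZMod m → E) × ZMod m → ZMod 2 := fun x => χ (Γ.src (x.1 x.2)) + χ (Γ.tgt (x.1 x.2))
    have hmem : ∀ x : (ZMod m → E) × ZMod m, x ∈ Kf ×ˢ (Finset.univ : Finset (ZMod m)) → x.1 ∈ K :=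
      fun x hx => by simpa [hKf] using hx
    have h0 : ∑ x ∈ Kf ×ˢ (Finset.univ : Finset (ZMod m)), f x = 0 := by
      refine Finset.sum_involution (fun x _ => (F x.1 x.2, D.π x.2)) ?_ ?_ ?_ ?_
      · intro x hx
        simp only [f, hF' _ (hmem x hx)]
        exact CharTwo.add_self_eq_zero _
      · intro x hx _ h
        exact D.ne _ (congrArg Prod.snd h)
      · intro x hx
        simpa [hKf] using hFK _ (hmem x hx) x.2
      · intro x hx
        have h1 := hFK _ (hmem x hx) x.2
        refine Prod.ext ?_ (D.inv _)
        apply hdet _ (hFK _ h1 _) _ (hmem x hx) x.2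
        have h2 := hF' _ h1 (D.π x.2)
        rw [D.inv] at h2
        exact h2.trans (hF' _ (hmem x hx) x.2)
    rw [Finset.sum_product, ← Finset.add_sum_erase _ _ ((hKf p).2 hpK),
      Finset.sum_eq_zero (s := Kf.erase p)] at h0
    · simp only [f] at h0
      rw [sum_broken Γ.src Γ.tgt χ p j1 hb] at h0
      simp [χ, huv.symm] at h0
    · intro c hc
      rw [Finset.mem_erase, hKf] at hc
      exact sum_cell Γ.src Γ.tgt χ c (S.cell c ((hK hc.2).resolve_left hc.1)).c
  · refine hF (coll_closed hΓ S hφ hρ K hne (fun c hc => ?_) hpart)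
    rcases hK hc with rfl | h
    · exact absurd hc hpK
    · exact S.cell c h

/-- change of the vertices -/
def Gr.mapV (Γ : Gr V E B) (q : V → V') : Gr V' E B := ⟨fun e => q (Γ.src e), fun e => q (Γ.tgt e), Γ.lab⟩

theorem break_step [NeZero m] [Finite V] [Finite E] (hΓ : Γ.Folded)
    (S : MState D ρ φ Γ Q) (hφ : Function.Surjective φ)
    (hρ : ∀ w, ρ w = 1 → w ∈ Subgroup.normalClosure {W D.ℓ 0 m})
    (hF : ¬ Γ.Full S.o) (p : ZMod m → E)
    (hp : ∀ j, Γ.lab (p j) = D.ℓ j) (j1 : ZMod m)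
    (hb : ∀ j, j ≠ j1 → Γ.tgt (p j) = Γ.src (p (j + 1)))
    (huv : Γ.src (p (j1 + 1)) ≠ Γ.tgt (p j1))
    (hfull : ∀ (V' : Type) (q : V → V'), q (Γ.src (p (j1 + 1))) = q (Γ.tgt (p j1)) →
      (Γ.mapV q).Full (q S.o))
    (ih : ∀ (V' : Type) [Finite V'] (Γ' : Gr V' E B) (Q' : Set (ZMod m → E))
      (S' : MState D ρ φ Γ' Q'), Nat.card V' < Nat.card V → Coll Q' → Γ'.Full S'.o → Red φ) :
    Red φ := by
  classical
  set u := Γ.src (p (j1 + 1)) with hu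
  set v := Γ.tgt (p j1) with hv
  let q : V → {x : V // x ≠ v} := fun x => if h : x = v then ⟨u, huv⟩ else ⟨x, h⟩
  have hqv : q v = ⟨u, huv⟩ := by simp [q]
  have hq : ∀ x : {x : V // x ≠ v}, q x.1 = x := fun x => by simp [q, x.2]
  have hquv : q u = q v := by rw [hqv, hq ⟨u, huv⟩]
  have hpQ : W p (j1 + 1) m ∈ NQ (insert p Q) := by
    have := W_rot_mem (MonoidHom.id _) (NQ (insert p Q)) p (j1 + 1) (mem_NQ (by simp))
    simpa using this
  have hpath : Γ.Path u v (W p (j1 + 1) m) := by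
    have h1 := W_path (src := Γ.src) (tgt := Γ.tgt) p (j1 + 1) (m - 1) (by
      intro t ht
      apply hb
      intro h2
      apply natCast_ne_neg_one (t := t) (m := m) (by omega)
      linear_combination h2)
    have hm : ((m - 1 : ℕ) : ZMod m) = -1 := by
      rw [Nat.cast_sub (NeZero.one_le)]; simp
    have h2 : W p (j1 + 1) m = W p (j1 + 1) (m - 1) * of (p j1) := by
      have h3 := W_succ p (j1 + 1) (m - 1)
      rw [hm, Nat.sub_add_cancel NeZero.one_le] at h3
      simpa using h3
    rw [h2]
    rw [hm, add_neg_cancel_right] at h1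
    exact h1.fwd (p j1)
  obtain ⟨S', hS'⟩ := S.transfer (Γ.mapV q) (insert p Q) q (fun x => ⟨x.1, hq x⟩)
    (MonoidHom.id _) (by
      rintro c (rfl | hc)
      · refine ⟨hp, fun j => ?_⟩
        by_cases hj : j = j1
        · subst hj
          exact hquv.symm
        · exact congrArg q (hb j hj)
      · exact ⟨(S.cell c hc).l, fun j => congrArg q ((S.cell c hc).c j)⟩)
    (fun e => IsPath.edge (Γ.mapV q).src (Γ.mapV q).tgt e)
    (fun e => by simp [Gr.mapV])
    (fun c hc => mem_NQ (Set.mem_insert_of_mem _ hc))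
    (fun e => ⟨Γ.src e, Γ.tgt e, of e, IsPath.edge _ _ e, rfl, rfl, by
      simp⟩)
    (by
      intro a b hab
      by_cases ha : a = v
      · by_cases hb' : b = v
        · subst ha; subst hb'
          exact ⟨1, IsPath.nil _, Subgroup.one_mem _⟩
        · subst ha
          rw [hqv, hq ⟨b, hb'⟩] at hab
          have : u = b := congrArg Subtype.val hab
          subst this
          exact ⟨_, hpath.symm, Subgroup.inv_mem _ hpQ⟩
      · by_cases hb' : b = v
        · subst hb'
          rw [hqv, hq ⟨a, ha⟩] at hab
          have : a = u := congrArg Subtype.val hab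
          subst this
          exact ⟨_, hpath, hpQ⟩
        · rw [hq ⟨a, ha⟩, hq ⟨b, hb'⟩] at hab
          have : a = b := congrArg Subtype.val hab
          subst this
          exact ⟨1, IsPath.nil _, Subgroup.one_mem _⟩)
  refine ih _ _ _ S' ?_ (coll_break hΓ S hφ hρ hF p hp j1 hb huv) ?_
  · exact Finite.card_subtype_lt (x := v) (by simp)
  · rw [hS']
    exact hfull _ q hquv

end main
end NSG

namespace NSG
open FreeGroup (of)

section main
variable {m n : ℕ} {B V E V' E' G : Type} [Group G]
variable {D : Bdry m B} {ρ : FreeGroup B →* G} {φ : FreeGroup (Fin n) →* G}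
  {Γ : Gr V E B} {Q : Set (ZMod m → E)}

theorem Bdry.one_ne (D : Bdry m B) (j : ZMod m) : j + 1 ≠ j := by
  intro h
  have h1 : (1 : ZMod m) = 0 := by simpa using h
  have h2 : ∀ x : ZMod m, x = 0 := fun x => by rw [← mul_one x, h1, mul_zero]
  exact D.ne 0 (h2 _)

/-- deletion of an edge -/
def Gr.del (Γ : Gr V E B) (e : E) : Gr V {f : E // f ≠ e} B :=
  ⟨fun f => Γ.src f.1, fun f => Γ.tgt f.1, fun f => Γ.lab f.1⟩

theorem elim_step [NeZero m] [Finite E] (hρ1 : ρ (W D.ℓ 0 m) = 1) (S : MState D ρ φ Γ Q)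
    (hC : Coll Q) (hQ : Q.Nonempty) :
    ∃ (c0 : ZMod m → E) (j0 : ZMod m) (Q' : Set (ZMod m → {f : E // f ≠ c0 j0}))
      (S' : MState D ρ φ (Γ.del (c0 j0)) Q'),
      S'.o = S.o ∧ Coll Q' ∧ Q'.ncard < Q.ncard ∧ Γ.IsCell D c0 ∧ ∀ j, c0 j = c0 j0 → j = j0 := by
  classical
  obtain ⟨c0, hc0, j0, hfree⟩ := hC Q subset_rfl hQ
  have hcell := S.cell c0 hc0
  have hfree0 : ∀ j, c0 j = c0 j0 → j = j0 := fun j hj => (hfree c0 hc0 j hj).2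
  refine ⟨c0, j0, ?_⟩
  set e := c0 j0 with he
  let val : (ZMod m → {f : E // f ≠ e}) → (ZMod m → E) := fun c j => (c j).1
  have hval : Function.Injective val := fun c c' h => by
    funext j
    exact Subtype.ext (congrFun h j)
  let Q' : Set (ZMod m → {f : E // f ≠ e}) := {c | val c ∈ Q}
  have hne : c0 (j0 + 1) ≠ e := fun h => D.one_ne j0 (hfree0 _ h)
  let cm : ZMod m → {f : E // f ≠ e} := fun j =>
    if h : c0 j ≠ e then ⟨c0 j, h⟩ else ⟨c0 (j0 + 1), hne⟩
  have hcm : ∀ j, j ≠ j0 → (cm j).1 = c0 j := by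
    intro j hj
    have : c0 j ≠ e := fun h => hj (hfree0 j h)
    simp [cm, this]
  let X := W cm (j0 + 1) (m - 1)
  have hm : ((m - 1 : ℕ) : ZMod m) = -1 := by
    rw [Nat.cast_sub (NeZero.one_le)]; simp
  have hnt : ∀ t < m - 1, j0 + 1 + ((t : ℕ) : ZMod m) ≠ j0 := by
    intro t ht h2
    apply natCast_ne_neg_one (t := t) (m := m) (by omega)
    linear_combination h2
  let θ : FreeGroup E →* FreeGroup {f : E // f ≠ e} :=
    FreeGroup.lift fun f => if h : f ≠ e then of ⟨f, h⟩ else X⁻¹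
  have hθe : θ (of e) = X⁻¹ := by simp [θ]
  have hθ : ∀ f : {f : E // f ≠ e}, θ (of f.1) = of f := fun f => by simp [θ, f.2]
  have hX : (Γ.del e).Path (Γ.tgt e) (Γ.src e) X := by
    have hmm : ∃ m', m - 1 = m' + 1 := by
      refine ⟨m - 2, ?_⟩
      have h1 : m ≠ 0 := NeZero.ne m
      have h2 : m ≠ 1 := by
        rintro rfl
        exact D.ne 0 (Subsingleton.elim _ _)
      omega
    obtain ⟨m', hm'⟩ := hmm
    have h1 := W_path (src := (Γ.del e).src) (tgt := (Γ.del e).tgt) cm (j0 + 1) m' (by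
      intro t ht
      have h2 := hnt t (by omega)
      have h3 := hnt (t + 1) (by omega)
      push_cast at h3
      rw [← add_assoc] at h3
      simp only [Gr.del, hcm _ h2, hcm _ h3]
      exact hcell.c _)
    have h4 : X = W cm (j0 + 1) m' * of (cm (j0 + 1 + m')) := by
      simp only [X]
      rw [hm', W_succ]
    have h5 := h1.fwd
    rw [h4]
    have h6 := hnt m' (by omega)
    have h7 := h1.fwd (cm (j0 + 1 + m'))
    simp only [Gr.del, hcm _ (D.one_ne j0), hcm _ h6] at h7 ⊢
    rw [hcell.c j0]
    have h8 : j0 + 1 + (m' : ZMod m) + 1 = j0 := by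
      have : ((m' + 1 : ℕ) : ZMod m) = -1 := by rw [← hm', hm]
      push_cast at this
      linear_combination this
    rwa [hcell.c, h8] at h7
  have hWl : FreeGroup.map (Γ.del e).lab X = W D.ℓ (j0 + 1) (m - 1) := by
    apply W_map
    intro t ht
    simp only [FreeGroup.map.of, Gr.del, hcm _ (hnt t ht), hcell.l]
  have hsp : ∀ {A : Type} (c : ZMod m → A), W c (j0 + 1) m = W c (j0 + 1) (m - 1) * of (c j0) := by
    intro A c
    have h3 := W_succ c (j0 + 1) (m - 1)
    rw [hm, Nat.sub_add_cancel NeZero.one_le] at h3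
    simpa using h3
  have hlift : ∀ c ∈ Q, c ≠ c0 → ∃ c' ∈ Q', val c' = c := by
    intro c hc hcc
    have : ∀ j, c j ≠ e := fun j h => hcc (hfree c hc j h).1
    exact ⟨fun j => ⟨c j, this j⟩, hc, rfl⟩
  obtain ⟨S', hS'⟩ := S.transfer (Γ.del e) Q' id Function.surjective_id θ
    (fun c hc => ⟨(S.cell _ hc).l, (S.cell _ hc).c⟩)
    (by
      intro f
      by_cases hf : f = e
      · subst hf
        rw [hθe]
        exact hX.symm
      · rw [hθ ⟨f, hf⟩]
        exact IsPath.edge (Γ.del e).src (Γ.del e).tgt ⟨f, hf⟩)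
    (by
      intro f
      by_cases hf : f = e
      · subst hf
        rw [hθe, map_inv, map_inv, hWl, inv_eq_iff_mul_eq_one, ← map_mul]
        have h1 := W_rot_mem ρ ⊥ D.ℓ (j0 + 1) (by simpa using hρ1)
        rw [hsp] at h1
        rw [hcell.l]
        simpa using h1
      · rw [hθ ⟨f, hf⟩]
        simp [Gr.del])
    (by
      intro c hc
      by_cases hcc : c = c0
      · subst hcc
        have h1 : W c 0 m = W c (j0 + 1) 0 * W c 0 m := by simp
        have h2 : θ (W c (j0 + 1) m) = 1 := by
          rw [hsp, map_mul, ← he, hθe, mul_inv_eq_one]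
          apply W_map
          intro t ht
          have := hcm _ (hnt t ht)
          rw [← this, hθ]
        have h3 := W_rot c (j0 + 1)
        have h4 := congrArg θ h3
        rw [map_mul, map_mul, h2, mul_one] at h4
        have h5 : θ (W c 0 m) = 1 := by simpa using h4
        rw [h5]
        exact Subgroup.one_mem _
      · obtain ⟨c', hc', rfl⟩ := hlift c hc hcc
        have : θ (W (val c') 0 m) = W c' 0 m := W_map _ _ _ _ _ (fun t _ => hθ _)
        rw [this]
        exact mem_NQ hc')
    (fun f => ⟨Γ.src f.1, Γ.tgt f.1, of f.1, IsPath.edge _ _ f.1, rfl, rfl, by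
      rw [hθ, inv_mul_cancel]; exact Subgroup.one_mem _⟩)
    (fun a b h => ⟨1, by
      have : a = b := h
      subst this
      exact IsPath.nil _, by rw [map_one]; exact Subgroup.one_mem _⟩)
  refine ⟨Q', S', hS', ?_, ?_, hcell, hfree0⟩
  · intro K hK hKne
    obtain ⟨c1, ⟨c, hcK, rfl⟩, j, h⟩ := hC (val '' K) (by rintro _ ⟨c, hc, rfl⟩; exact hK hc)
      (hKne.image _)
    refine ⟨c, hcK, j, fun c' hc' j' hh => ?_⟩
    have := h (val c') ⟨c', hc', rfl⟩ j' (congrArg Subtype.val hh)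
    exact ⟨hval this.1, this.2⟩
  · rw [← Set.ncard_image_of_injective Q' hval]
    apply Set.ncard_lt_ncard _ (Set.toFinite _)
    rw [Set.ssubset_iff_of_subset (by rintro _ ⟨c, hc, rfl⟩; exact hc)]
    refine ⟨c0, hc0, ?_⟩
    rintro ⟨c, hc, h⟩
    exact (c j0).2 (congrFun h j0)

theorem descent [NeZero m] [Finite B] (hφ : Function.Surjective φ)
    (hρ1 : ρ (W D.ℓ 0 m) = 1)
    (hρ : ∀ w, ρ w = 1 → w ∈ Subgroup.normalClosure {W D.ℓ 0 m}) (hn : Nat.card B < n) :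
    ∀ (N : ℕ) (V : Type) [Finite V], Nat.card V = N → ∀ (M : ℕ) (E : Type) [Finite E]
      (Γ : Gr V E B) (Q : Set (ZMod m → E)) (S : MState D ρ φ Γ Q), Q.ncard = M → Coll Q →
      Γ.Full S.o → Red φ := by
  classical
  intro N
  induction N using Nat.strong_induction_on with
  | _ N ihN =>
  intro V _ hN M
  induction M using Nat.strong_induction_on with
  | _ M ihM =>
  intro E _ Γ Q S hM hC hF
  rcases Q.eq_empty_or_nonempty with hQ | hQ
  · exact S.red_of_free_full hn hQ hF
  obtain ⟨c0, j0, Q1, S1, ho1, hC1, hQ1, hc0, hfree⟩ := elim_step hρ1 S hC hQ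
  by_cases hF1 : (Γ.del (c0 j0)).Full S1.o
  · exact ihM _ (by omega) _ _ _ S1 rfl hC1 hF1
  generalize he : c0 j0 = e at *
  obtain ⟨VX, EX, _, _, X, q, qE, hX, hq, hqE, hs, ht, hl, hker⟩ := (Γ.del e).exists_fold
  have hcard : Nat.card VX ≤ Nat.card V := Nat.card_le_card_of_surjective q hq
  have hlab : ∀ w, FreeGroup.map X.lab (FreeGroup.map qE w) = FreeGroup.map (Γ.del e).lab w :=
    hom_eq_of_gen ((FreeGroup.map X.lab).comp (FreeGroup.map qE)) _ (by simp [hl])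
  have hedge : ∀ f, X.Path (q ((Γ.del e).src f)) (q ((Γ.del e).tgt f)) (FreeGroup.map qE (of f)) := by
    intro f
    rw [FreeGroup.map.of, ← hs, ← ht]
    exact IsPath.edge _ _ _
  have l2 : ∀ a b, q a = q b → ∃ w, (Γ.del e).Path a b w ∧ FreeGroup.map qE w = 1 := by
    intro a b h
    obtain ⟨w, hw, h1⟩ := hker a b h
    refine ⟨w, hw, hX.inj (hw.map q _ hedge) ?_⟩
    rw [hlab, h1]
  obtain ⟨SX, hoX⟩ := S1.transfer X {c | X.IsCell D c} q hq (FreeGroup.map qE) (fun c hc => hc) hedge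
    (fun f => by simp [hl])
    (fun c hc => by
      have h1 : FreeGroup.map qE (W c 0 m) = W (fun j => qE (c j)) 0 m :=
        W_map _ _ _ _ _ (fun t _ => by simp)
      rw [h1]
      refine mem_NQ ⟨fun j => ?_, fun j => ?_⟩
      · rw [hl, (S1.cell c hc).l]
      · rw [ht, hs, (S1.cell c hc).c])
    (fun f' => by
      obtain ⟨f, rfl⟩ := hqE f'
      exact ⟨_, _, of f, IsPath.edge _ _ f, (hs f).symm, (ht f).symm, by simp⟩)
    (fun a b h => by
      obtain ⟨w, hw, h1⟩ := l2 a b h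
      exact ⟨w, hw, by rw [h1]; exact Subgroup.one_mem _⟩)
  have hFX : ¬ X.Full SX.o := by
    intro h
    apply hF1
    intro g
    obtain ⟨w', hw', rfl⟩ := h g
    obtain ⟨w, hw, h1⟩ := hw'.lift (src := (Γ.del e).src) (tgt := (Γ.del e).tgt) q
      (FreeGroup.map qE) ⊥
      (fun f' => by
        obtain ⟨f, rfl⟩ := hqE f'
        exact ⟨_, _, of f, IsPath.edge _ _ f, (hs f).symm, (ht f).symm, by simp⟩)
      (fun a b h => by
        obtain ⟨w, hw, h1⟩ := l2 a b h
        exact ⟨w, hw, by rw [h1]; exact Subgroup.one_mem _⟩) S1.o S1.o hoX.symm hoX.symm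
    refine ⟨w, hw, ?_⟩
    rw [Subgroup.mem_bot, inv_mul_eq_one] at h1
    rw [← hlab, h1]
  have ih : ∀ (V' : Type) [Finite V'] (Γ' : Gr V' EX B) (Q' : Set (ZMod m → EX))
      (S' : MState D ρ φ Γ' Q'), Nat.card V' < Nat.card VX → Coll Q' → Γ'.Full S'.o → Red φ := by
    intro V' _ Γ' Q' S' h1 h2 h3
    exact ihN _ (by omega) V' rfl _ _ Γ' Q' S' rfl h2 h3
  have hoo : SX.o = q S.o := by rw [hoX, ho1]
  let hE : EX → E → EX := fun f x => if h : x ≠ e then qE ⟨x, h⟩ else f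
  have hEe : ∀ f, hE f e = f := fun f => by simp [hE]
  have hEne : ∀ f x (hx : x ≠ e), hE f x = qE ⟨x, hx⟩ := fun f x hx => by simp [hE, hx]
  have hEs : ∀ f x, x ≠ e → X.src (hE f x) = q (Γ.src x) := fun f x hx => by
    rw [hEne f x hx, hs]; rfl
  have hEt : ∀ f x, x ≠ e → X.tgt (hE f x) = q (Γ.tgt x) := fun f x hx => by
    rw [hEne f x hx, ht]; rfl
  have hEl : ∀ f, X.lab f = Γ.lab e → ∀ x, X.lab (hE f x) = Γ.lab x := fun f hf x => by
    by_cases hx : x = e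
    · subst hx; rw [hEe, hf]
    · rw [hEne f x hx, hl]; rfl
  have hc0e : ∀ j, j ≠ j0 → c0 j ≠ e := fun j hj h => hj (hfree j h)
  by_cases h2 : ∃ f, X.lab f = Γ.lab e ∧ X.src f = q (Γ.src e)
  · obtain ⟨f, hf1, hf2⟩ := h2
    have hs' : ∀ x, X.src (hE f x) = q (Γ.src x) := fun x => by
      by_cases hx : x = e
      · subst hx; rw [hEe, hf2]
      · exact hEs f x hx
    by_cases hf3 : X.tgt f = q (Γ.tgt e)
    · exfalso
      apply hFX
      rw [hoo]
      refine hF.map X q (hE f) hs' (fun x => ?_) (hEl f hf1)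
      by_cases hx : x = e
      · subst hx; rw [hEe, hf3]
      · exact hEt f x hx
    · have hu : X.src (hE f (c0 (j0 + 1))) = q (Γ.tgt e) := by rw [hs', ← hc0.c, he]
      have hv : X.tgt (hE f (c0 j0)) = X.tgt f := by rw [he, hEe]
      refine break_step hX SX hφ hρ hFX (fun j => hE f (c0 j))
        (fun j => by rw [hEl f hf1, hc0.l]) j0 ?_ ?_ ?_ ih
      · intro j hj
        rw [hs', hEt f _ (hc0e j hj), hc0.c]
      · rw [hu, hv]
        exact fun h => hf3 h.symm
      · intro V' q' hq'
        rw [hu, hv] at hq'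
        rw [hoo]
        refine hF.map (X.mapV q') (q' ∘ q) (hE f) (fun x => congrArg q' (hs' x)) (fun x => ?_)
          (hEl f hf1)
        by_cases hx : x = e
        · subst hx
          simp only [Gr.mapV, hEe, Function.comp]
          exact hq'.symm
        · exact congrArg q' (hEt f x hx)
  by_cases h3 : ∃ f, X.lab f = Γ.lab e ∧ X.tgt f = q (Γ.tgt e)
  · obtain ⟨f, hf1, hf2⟩ := h3
    have hf3 : X.src f ≠ q (Γ.src e) := fun h => h2 ⟨f, hf1, h⟩
    have ht' : ∀ x, X.tgt (hE f x) = q (Γ.tgt x) := fun x => by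
      by_cases hx : x = e
      · subst hx; rw [hEe, hf2]
      · exact hEt f x hx
    have hu : X.src (hE f (c0 (j0 - 1 + 1))) = X.src f := by rw [sub_add_cancel, he, hEe]
    have hv : X.tgt (hE f (c0 (j0 - 1))) = q (Γ.src e) := by
      rw [ht', hc0.c, sub_add_cancel, he]
    refine break_step hX SX hφ hρ hFX (fun j => hE f (c0 j))
      (fun j => by rw [hEl f hf1, hc0.l]) (j0 - 1) ?_ ?_ ?_ ih
    · intro j hj
      have : j + 1 ≠ j0 := fun h => hj (by rw [← h]; ring)
      rw [ht', hEs f _ (hc0e _ this), hc0.c]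
    · rw [hu, hv]
      exact hf3
    · intro V' q' hq'
      rw [hu, hv] at hq'
      rw [hoo]
      refine hF.map (X.mapV q') (q' ∘ q) (hE f) (fun x => ?_) (fun x => congrArg q' (ht' x))
        (hEl f hf1)
      by_cases hx : x = e
      · subst hx
        simp only [Gr.mapV, hEe, Function.comp]
        exact hq'
      · exact congrArg q' (hEs f x hx)
  -- the remaining case
  let X' : Gr VX (Option EX) B :=
    ⟨fun x => x.elim (q (Γ.src e)) X.src, fun x => x.elim (q (Γ.tgt e)) X.tgt,
      fun x => x.elim (Γ.lab e) X.lab⟩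
  have hX' : X'.Folded := by
    constructor
    · rintro (_ | f) (_ | g) h4 h5
      · rfl
      · exact absurd ⟨g, h5.symm, h4.symm⟩ h2
      · exact absurd ⟨f, h5, h4⟩ h2
      · exact congrArg some (hX.s f g h4 h5)
    · rintro (_ | f) (_ | g) h4 h5
      · rfl
      · exact absurd ⟨g, h5.symm, h4.symm⟩ h3
      · exact absurd ⟨f, h5, h4⟩ h3
      · exact congrArg some (hX.t f g h4 h5)
  have hFX' : X'.Full (q S.o) := by
    refine hF.map X' q (fun x => if h : x ≠ e then some (qE ⟨x, h⟩) else none) ?_ ?_ ?_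
    · intro x
      by_cases hx : x = e
      · subst hx; simp [X']
      · simp [X', hx, hs, Gr.del]
    · intro x
      by_cases hx : x = e
      · subst hx; simp [X']
      · simp [X', hx, ht, Gr.del]
    · intro x
      by_cases hx : x = e
      · subst hx; simp [X']
      · simp [X', hx, hl, Gr.del]
  have hconn : X'.Conn (q S.o) := by
    intro a
    obtain ⟨w, hw⟩ := SX.conn a
    rw [hoo] at hw
    exact ⟨FreeGroup.map some w, hw.map id _ (fun f => by
      rw [FreeGroup.map.of]; exact IsPath.edge X'.src X'.tgt (some f))⟩
  have hV := hX'.subsingleton hFX' hconn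
  have hno : ∀ f, X.lab f ≠ Γ.lab e := fun f h => h2 ⟨f, h, (hV _).trans (hV _).symm⟩
  refine SX.red_of_few ?_ ?_ (fun v => (hV v).trans hoo.symm)
  · refine lt_of_le_of_lt ?_ hn
    refine Nat.card_le_card_of_injective X.lab ?_
    intro f g h
    exact hX.s f g ((hV _).trans (hV _).symm) h
  · rw [Set.eq_empty_iff_forall_notMem]
    intro c hc
    obtain ⟨j, hj⟩ := D.surj (Γ.lab e)
    exact hno (c j) (by rw [hc.l, hj])

end main
end NSG

namespace NSG
open FreeGroup (of)

section main
variable {m n : ℕ} {B G : Type} [Group G]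
variable {D : Bdry m B} {ρ : FreeGroup B →* G} {φ : FreeGroup (Fin n) →* G}

/-- generators at stage N -/
def stage (w : Fin n → FreeGroup B) (r : FreeGroup B) (N : ℕ) : Set (FreeGroup B) :=
  Set.range w ∪ {x | ∃ l : List (B × Bool), l.length ≤ N ∧
    x = FreeGroup.mk l.reverse * r * (FreeGroup.mk l.reverse)⁻¹}

theorem stage_mono (w : Fin n → FreeGroup B) (r : FreeGroup B) {N N' : ℕ} (h : N ≤ N') :
    stage w r N ⊆ stage w r N' := by
  rintro x (hx | ⟨l, hl, hx⟩)
  · exact Or.inl hx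
  · exact Or.inr ⟨l, hl.trans h, hx⟩

theorem exists_stage [Finite B] (hφ : Function.Surjective φ) (w : Fin n → FreeGroup B)
    (r : FreeGroup B) (hρ : ∀ x, ρ x = 1 → x ∈ Subgroup.normalClosure {r})
    (hw : ∀ j, ρ (w j) = φ (of j)) :
    ∃ N0, ∀ N, N0 ≤ N → ∀ g, g ∈ Subgroup.closure (stage w r N) := by
  have hmono : Monotone fun N => Subgroup.closure (stage w r N) :=
    fun a b h => Subgroup.closure_mono (stage_mono w r h)
  have hU : Subgroup.normalClosure {r} ≤ ⨆ N, Subgroup.closure (stage w r N) := by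
    rw [Subgroup.normalClosure, Subgroup.closure_le]
    intro x hx
    obtain ⟨y, hy, hconj⟩ := Group.mem_conjugatesOfSet_iff.1 hx
    rw [Set.mem_singleton_iff] at hy
    subst hy
    obtain ⟨c, rfl⟩ := isConj_iff.1 hconj
    obtain ⟨l, rfl⟩ := exists_list c
    refine Subgroup.mem_iSup_of_mem l.length (Subgroup.subset_closure (Or.inr ⟨l, le_rfl, rfl⟩))
  have hb : ∀ b : B, ∃ N, of b ∈ Subgroup.closure (stage w r N) := by
    intro b
    obtain ⟨y, hy⟩ := hφ (ρ (of b))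
    have h1 : ρ (FreeGroup.lift w y) = φ y :=
      hom_eq_of_gen (ρ.comp (FreeGroup.lift w)) φ (by simpa using hw) y
    have h2 := hU (hρ (of b * (FreeGroup.lift w y)⁻¹) (by
      rw [map_mul, map_inv, h1, hy, mul_inv_cancel]))
    rw [Subgroup.mem_iSup_of_directed hmono.directed_le] at h2
    obtain ⟨N, hN⟩ := h2
    refine ⟨N, ?_⟩
    have h3 : FreeGroup.lift w y ∈ Subgroup.closure (stage w r N) :=
      hom_mem_of_gen _ _ (fun j => by
        rw [FreeGroup.lift_apply_of]
        exact Subgroup.subset_closure (Or.inl ⟨j, rfl⟩)) y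
    have := Subgroup.mul_mem _ hN h3
    rwa [inv_mul_cancel_right] at this
  choose N hN using hb
  obtain ⟨N0, hN0⟩ := exists_bound N
  refine ⟨N0, fun N' hN' g => ?_⟩
  exact hom_mem_of_gen (MonoidHom.id _) _ (fun b => hmono ((hN0 b).trans hN') (hN b)) g

/-- extension of a list by an initial segment of the boundary word -/
def ext (D : Bdry m B) (l : List (B × Bool)) : ℕ → List (B × Bool)
  | 0 => l
  | t + 1 => (D.ℓ t, true) :: ext D l t

theorem ext_length (D : Bdry m B) (l : List (B × Bool)) (t : ℕ) :
    (ext D l t).length = l.length + t := by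
  induction t with
  | zero => rfl
  | succ t ih => simp [ext, ih]; omega

theorem red_abstract [NeZero m] [Finite B] (hφ : Function.Surjective φ)
    (hρs : Function.Surjective ρ) (hρ1 : ρ (W D.ℓ 0 m) = 1)
    (hρ : ∀ w, ρ w = 1 → w ∈ Subgroup.normalClosure {W D.ℓ 0 m}) (hn : Nat.card B < n) :
    Red φ := by
  classical
  have hm1 : m ≠ 1 := by
    rintro rfl
    exact D.ne 0 (Subsingleton.elim _ _)
  have hm0 : m ≠ 0 := NeZero.ne m
  let b0 : B := D.ℓ 0
  choose w hw using fun j : Fin n => hρs (φ (of j))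
  choose g hg using fun j : Fin n => exists_list (w j * (of b0)⁻¹)
  obtain ⟨N0, hN0⟩ := exists_stage hφ w _ hρ hw
  obtain ⟨N1, hN1⟩ := exists_bound fun j => (g j).length
  obtain ⟨N, hNdef⟩ : ∃ N, N = max N0 N1 := ⟨_, rfl⟩
  have hgN : ∀ j, (g j).length ≤ N := fun j => (hN1 j).trans (hNdef ▸ le_max_right _ _)
  have hNst := hN0 N (hNdef ▸ le_max_left _ _)
  let L := N + m
  let CL := {l : List (B × Bool) // l.length ≤ N}
  have : Finite CL := (List.finite_length_le (B × Bool) N).to_subtype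
  let C := Fin n ⊕ CL
  -- vertices
  let vx : CL → ℕ → TV B L := fun l t =>
    if h : t ≤ m then ⟨ext D l.1 t, by rw [ext_length]; have := l.2; omega⟩ else troot
  let cs : C → TV B L := Sum.elim (fun j => ⟨g j, by have := hgN j; omega⟩) (fun l => vx l (m - 1))
  let ct : C → TV B L := Sum.elim (fun _ => troot) (fun l => vx l 0)
  let Γ : Gr (TV B L) (TE B C L) B :=
    ⟨tsrc cs, ttgt ct, Sum.elim (fun q => q.1.1) (Sum.elim (fun _ => b0)
      (fun _ => D.ℓ ((m - 1 : ℕ) : ZMod m)))⟩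
  let cell : CL → ZMod m → TE B C L := fun l j =>
    if h : j.val + 1 < m then .inl ((D.ℓ j, true), ⟨ext D l.1 j.val, by
      rw [ext_length]; have := l.2; omega⟩) else .inr (.inr l)
  have hcell1 : ∀ l j (h : j.val + 1 < m), cell l j = .inl ((D.ℓ j, true), ⟨ext D l.1 j.val, by
      rw [ext_length]; have := l.2; omega⟩) := fun l j h => by simp only [cell, dif_pos h]
  have hcell2 : ∀ l j, ¬ j.val + 1 < m → cell l j = .inr (.inr l) := fun l j h => by
    simp only [cell, dif_neg h]
  have hlt : ∀ j : ZMod m, j.val < m := fun j => ZMod.val_lt j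
  have hvs : ∀ j : ZMod m, (j + 1).val = if j.val + 1 < m then j.val + 1 else 0 := by
    intro j
    rw [ZMod.val_add, ZMod.val_one'' hm1]
    split_ifs with h
    · exact Nat.mod_eq_of_lt h
    · have : j.val + 1 = m := by have := hlt j; omega
      rw [this, Nat.mod_self]
  have hlast : ∀ j : ZMod m, ¬ j.val + 1 < m → j = ((m - 1 : ℕ) : ZMod m) := by
    intro j h
    have h1 := hlt j
    have h2 : j.val = m - 1 := by omega
    rw [← h2, ZMod.natCast_zmod_val]
  have hsrc : ∀ l j, Γ.src (cell l j) = vx l j.val := by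
    intro l j
    have h1 := hlt j
    by_cases h : j.val + 1 < m
    · rw [hcell1 l j h]
      simp only [Γ, tsrc, vx, if_true, tinc]
      rw [dif_pos h1.le]
    · rw [hcell2 l j h]
      have h2 : j.val = m - 1 := by omega
      simp only [Γ, tsrc, cs, Sum.elim_inr, h2]
  have htgt : ∀ l j, Γ.tgt (cell l j) = vx l (j + 1).val := by
    intro l j
    rw [hvs]
    by_cases h : j.val + 1 < m
    · rw [hcell1 l j h, if_pos h]
      simp only [Γ, ttgt, vx, if_true, tcons]
      rw [dif_pos h.le]
      apply Subtype.ext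
      simp [ext]
    · rw [hcell2 l j h, if_neg h]
      simp only [Γ, ttgt, ct, Sum.elim_inr]
  have hlab : ∀ l j, Γ.lab (cell l j) = D.ℓ j := by
    intro l j
    by_cases h : j.val + 1 < m
    · rw [hcell1 l j h]
      simp [Γ]
    · rw [hcell2 l j h]
      simp only [Γ, Sum.elim_inr]
      rw [← hlast j h]
  have hτ : ∀ l t, t ≤ m - 1 →
      (tτ (vx l t) : FreeGroup (TE B C L)) = tτ (vx l 0) * W (cell l) 0 t := by
    intro l t
    induction t with
    | zero => intro _; simp
    | succ t ih =>
      intro ht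
      have h1 : ((t : ℕ) : ZMod m).val = t := ZMod.val_natCast_of_lt (by omega)
      rw [W_succ, ← mul_assoc, ← ih (by omega), zero_add, hcell1 l _ (by rw [h1]; omega)]
      have h2 : vx l (t + 1) = tcons (D.ℓ t, true) ⟨ext D l.1 t, by
          rw [ext_length]; have := l.2; omega⟩ := by
        simp only [vx]
        rw [dif_pos (by omega)]
        rfl
      have h3 : vx l t = tinc ⟨ext D l.1 t, by
          rw [ext_length]; have := l.2; omega⟩ := by
        simp only [vx]
        rw [dif_pos (by omega)]
        rfl
      rw [h2, h3, tτ_cons]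
      simp [h1]
  have hWm : ∀ l, W (cell l) 0 m = W (cell l) 0 (m - 1) * of (.inr (.inr l)) := by
    intro l
    have h3 := W_succ (cell l) 0 (m - 1)
    rw [Nat.sub_add_cancel NeZero.one_le, zero_add, hcell2] at h3
    · exact h3
    · rw [ZMod.val_natCast_of_lt (by omega)]; omega
  let Q : Set (ZMod m → TE B C L) := Set.range cell
  let ψ : FreeGroup (Fin n) →* FreeGroup (TE B C L) :=
    FreeGroup.lift fun j => tτ (cs (.inl j)) * of (.inr (.inl j))
  have hev : ∀ v : TV B L, FreeGroup.map Γ.lab (tτ v) = FreeGroup.mk v.1.reverse :=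
    tτ_eval _ (by simp [Γ])
  have hψw : ∀ j, FreeGroup.map Γ.lab (ψ (of j)) = w j := by
    intro j
    simp only [ψ, FreeGroup.lift_apply_of, map_mul, hev]
    simp [cs, hg, Γ]
  have hcells : ∀ c ∈ Q, Γ.IsCell D c := by
    rintro _ ⟨l, rfl⟩
    exact ⟨hlab l, fun j => by rw [hsrc, htgt]⟩
  have hψp : ∀ g, Γ.Path troot troot (ψ g) := by
    refine hom_mem_of_gen ψ (loops Γ.src Γ.tgt troot) (fun j => ?_)
    rw [mem_loops]
    simp only [ψ, FreeGroup.lift_apply_of]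
    exact (tτ_path cs ct _).trans (IsPath.edge (tsrc cs) (ttgt ct) (.inr (.inl j)))
  let S : MState D ρ φ Γ Q :=
    { o := troot
      cell := hcells
      conn := fun a => ⟨tτ a, tτ_path cs ct a⟩
      ψ := ψ
      ψp := hψp
      ψρ := hom_eq_of_gen (ρ.comp ((FreeGroup.map Γ.lab).comp ψ)) φ (fun j => by
        simp only [MonoidHom.comp_apply, hψw, hw])
      gen := by
        intro x hx
        have := hx.gauge (MonoidHom.id _) tτ (ψ.range ⊔ NQ Q) (by
          rintro (⟨p, l⟩ | j | l)
          · have h1 := tτ_tree cs ct p l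
            simp only [MonoidHom.id_apply, Γ]
            rw [h1]
            exact Subgroup.one_mem _
          · apply Subgroup.mem_sup_left
            refine ⟨of j, ?_⟩
            simp [ψ, Γ, tsrc, ttgt, ct]
          · apply Subgroup.mem_sup_right
            have h1 : (NQ Q).Normal := inferInstance
            have h2 := h1.conj_mem _ (mem_NQ (Q := Q) ⟨l, rfl⟩) (tτ (vx l 0))
            rw [hWm, ← mul_assoc, ← hτ l (m - 1) le_rfl] at h2
            exact h2)
        simpa using this }
  refine descent hφ hρ1 hρ hn _ (TV B L) rfl _ _ Γ Q S rfl ?_ ?_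
  · rintro K hK ⟨c, hc⟩
    obtain ⟨l, rfl⟩ := hK hc
    have hj : ¬ (((m - 1 : ℕ) : ZMod m)).val + 1 < m := by
      rw [ZMod.val_natCast_of_lt (by omega)]; omega
    refine ⟨cell l, hc, ((m - 1 : ℕ) : ZMod m), fun c' hc' j' h => ?_⟩
    obtain ⟨l', rfl⟩ := hK hc'
    rw [hcell2 l _ hj] at h
    by_cases h' : j'.val + 1 < m
    · rw [hcell1 l' j' h'] at h
      exact absurd h (by simp)
    · rw [hcell2 l' j' h'] at h
      have h2 : l' = l := Sum.inr.inj (Sum.inr.inj h)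
      exact ⟨by rw [h2], hlast j' h'⟩
  · intro x
    have h1 : Subgroup.closure (stage w (W D.ℓ 0 m) N) ≤
        (loops Γ.src Γ.tgt troot).map (FreeGroup.map Γ.lab) := by
      rw [Subgroup.closure_le]
      rintro x (⟨j, rfl⟩ | ⟨l, hl, rfl⟩)
      · exact ⟨ψ (of j), hψp _, hψw j⟩
      · let l' : CL := ⟨l, hl⟩
        have h2 := (tτ_path cs ct (vx l' 0)).trans
          (((hcells _ ⟨l', rfl⟩).path 0 |> fun h => by
            rw [hsrc, ZMod.val_zero] at h; exact h : Γ.Path (vx l' 0) (vx l' 0) _).trans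
          (tτ_path cs ct (vx l' 0)).symm)
        refine ⟨_, h2, ?_⟩
        rw [map_mul, map_mul, map_inv, hev, W_cell_map (hlab l')]
        simp [vx, l', ext, mul_assoc]
    obtain ⟨y, hy, h⟩ := h1 (hNst x)
    exact ⟨y, hy, h⟩

end main
end NSG

namespace NSG
open FreeGroup (of)

theorem pair_prod {M : Type} [Monoid M] (f : ℕ → M) (k : ℕ) :
    ((List.range (2 * k)).map fun t => f (t / 2)).prod = ((List.range k).map fun i => f i ^ 2).prod := by
  induction k with
  | zero => simp
  | succ k ih =>
    rw [show 2 * (k + 1) = 2 * k + 1 + 1 by ring, List.range_succ, List.range_succ, List.range_succ]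
    simp only [List.map_append, List.prod_append, ih, List.map_cons, List.map_nil,
      List.prod_singleton]
    rw [show 2 * k / 2 = k by omega, show (2 * k + 1) / 2 = k by omega, mul_assoc, ← pow_two]

/-- partner position -/
def swp (a : ℕ) : ℕ := if a % 2 = 0 then a + 1 else a - 1

theorem swp_lt {k a : ℕ} (h : a < 2 * k) : swp a < 2 * k := by
  unfold swp; split <;> omega

/-- boundary word data of the nonorientable surface -/
def nBdry (k : ℕ) [NeZero (2 * k)] : Bdry (2 * k) (Fin k) where
  ℓ j := ⟨j.val / 2, by have := ZMod.val_lt j; omega⟩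
  π j := (swp j.val : ℕ)
  surj i := ⟨((2 * i.val : ℕ) : ZMod (2 * k)), by
    ext
    have := i.isLt
    simp only
    rw [ZMod.val_natCast_of_lt (by omega)]
    omega⟩
  fib j j' h := by
    have h1 : j.val / 2 = j'.val / 2 := by simpa using h
    by_cases h2 : j'.val = j.val
    · exact Or.inl (ZMod.val_injective _ h2)
    · right
      apply ZMod.val_injective
      rw [ZMod.val_natCast_of_lt (swp_lt (ZMod.val_lt j))]
      unfold swp; split <;> omega
  inv j := by
    apply ZMod.val_injective
    have h := swp_lt (ZMod.val_lt j)
    rw [ZMod.val_natCast_of_lt h, ZMod.val_natCast_of_lt (swp_lt h)]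
    unfold swp; split <;> split <;> omega
  ne j h := by
    have h2 := congrArg ZMod.val h
    rw [ZMod.val_natCast_of_lt (swp_lt (ZMod.val_lt j))] at h2
    unfold swp at h2; split at h2 <;> omega
  adj j := by
    by_cases h : j.val % 2 = 0
    · left
      rw [swp, if_pos h, Nat.cast_add, ZMod.natCast_zmod_val, Nat.cast_one]
    · right
      rw [swp, if_neg h, Nat.cast_sub (by omega), ZMod.natCast_zmod_val, Nat.cast_one,
        sub_add_cancel]

theorem nBdry_W (k : ℕ) [NeZero (2 * k)] :
    W (nBdry k).ℓ 0 (2 * k) = nonorientableRelator k := by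
  have hk : 0 < k := by have := NeZero.ne (2 * k); omega
  let f : ℕ → FreeGroup (Fin k) := fun a => if h : a < k then of ⟨a, h⟩ else 1
  have h1 : W (nBdry k).ℓ 0 (2 * k) = ((List.range (2 * k)).map fun t => f (t / 2)).prod := by
    unfold W
    simp only [bind_pure_comp, List.map_eq_map, List.map_map]
    congr 1
    apply List.map_congr_left
    intro t ht
    rw [List.mem_range] at ht
    have h2 : t / 2 < k := by omega
    have h3 : (nBdry k).ℓ (0 + (t : ZMod (2 * k))) = ⟨t / 2, h2⟩ := by
      apply Fin.ext
      rw [zero_add]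
      change (t : ZMod (2 * k)).val / 2 = t / 2
      rw [ZMod.val_natCast_of_lt ht]
    simp only [f, h2, dif_pos, Function.comp_apply, h3]
  rw [h1, pair_prod, nonorientableRelator, ← List.map_coe_finRange_eq_range, List.map_map]
  congr 1
  apply List.map_congr_left
  intro i _
  simp [f]

end NSG

theorem epi_to_nonorientable_surface_group_reducible_of_rank_gt (k n : ℕ)
    (hk : 1 ≤ k) (hn : k < n)
    (φ : FreeGroup (Fin n) →* NonorientableSurfaceGroup k) (hφ : Function.Surjective φ) :
    ∃ (α : FreeGroup (Fin n) ≃* FreeGroup (Fin n)) (i : Fin n),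
      (φ.comp α.toMonoidHom) (FreeGroup.of i) = 1 := by
  have : NeZero (2 * k) := ⟨by omega⟩
  obtain ⟨α, i, h⟩ := NSG.red_abstract (D := NSG.nBdry k) (ρ := standardRho k) hφ
    (QuotientGroup.mk'_surjective _)
    (by
      rw [NSG.nBdry_W]
      exact (QuotientGroup.eq_one_iff _).2 (Subgroup.subset_normalClosure rfl))
    (fun w hw => by
      rw [NSG.nBdry_W]
      exact (QuotientGroup.eq_one_iff _).1 hw)
    (by simpa using hn)
  exact ⟨α, i, h⟩
end

section
/- Let k ≥ 1 and n ≥ k. Every surjective homomorphism φ : F_n →* N_k onto the nonorientable genus-k surface group is Nielsen equivalent to the padded standard epimorphism: there is an automorphism α of F_n such that (φ ∘ α)(x_i) is the image of the i-th generator under the presentation quotient map for i < k, and (φ ∘ α)(x_i) = 1 for k ≤ i < n. -/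
theorem NSx_extend {Ω : Type} [Finite Ω] (R : Ω → Ω → Prop)
    (h1 : ∀ u v v', R u v → R u v' → v = v') (h2 : ∀ u u' v, R u v → R u' v → u = u') :
    ∃ σ : Equiv.Perm Ω, ∀ u v, R u v → σ u = v := by
  classical
  have := Fintype.ofFinite Ω
  let e : {u // ∃ v, R u v} ≃ {v // ∃ u, R u v} :=
    { toFun := fun u => ⟨u.2.choose, u.1, u.2.choose_spec⟩
      invFun := fun v => ⟨v.2.choose, v.1, v.2.choose_spec⟩
      left_inv := fun u => by
        apply Subtype.ext
        have a := u.2.choose_spec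
        have b : ∃ u', R u' u.2.choose := ⟨u.1, a⟩
        exact h2 _ _ _ b.choose_spec a
      right_inv := fun v => by
        apply Subtype.ext
        have a := v.2.choose_spec
        have b : ∃ v', R v.2.choose v' := ⟨v.1, a⟩
        exact h1 _ _ _ b.choose_spec a }
  refine ⟨e.extendSubtype, fun u v huv => ?_⟩
  rw [Equiv.extendSubtype_apply_of_mem e u ⟨v, huv⟩]
  have b : ∃ v', R u v' := ⟨v, huv⟩
  exact h1 _ _ _ b.choose_spec huv

theorem NSx_resfin {α : Type} [DecidableEq α] (w : FreeGroup α) (hw : w ≠ 1) :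
    ∃ (N : ℕ) (ψ : FreeGroup α →* Equiv.Perm (Fin N)), ψ w ≠ 1 := by
  classical
  set l := w.toWord with hl
  have hred : FreeGroup.IsReduced l := FreeGroup.isReduced_toWord
  have hlen : l ≠ [] := by
    intro h; exact hw (FreeGroup.toWord_eq_nil_iff.mp h)
  have hadj : ∀ j (hj : j + 1 < l.length), (l[j]'(by omega)).1 = l[j+1].1 → (l[j]'(by omega)).2 = l[j+1].2 := by
    have := List.isChain_iff_getElem.mp hred
    intro j hj
    exact this j hj
  let R : α → Fin (l.length + 1) → Fin (l.length + 1) → Prop := fun a u v =>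
    ∃ (j : ℕ) (hj : j < l.length), (l[j] = (a, true) ∧ u.1 = j + 1 ∧ v.1 = j) ∨
      (l[j] = (a, false) ∧ u.1 = j ∧ v.1 = j + 1)
  have key : ∀ a j j' (hj : j < l.length) (hj' : j' < l.length) b b', l[j] = (a, b) → l[j'] = (a, b') → j' = j + 1 → b = b' := by
    intro a j j' hj hj' b b' e1 e2 e
    subst e
    have := hadj j hj'
    rw [e1, e2] at this
    exact this rfl
  have ex : ∀ a, ∃ σ : Equiv.Perm (Fin (l.length + 1)), ∀ u v, R a u v → σ u = v := by
    intro a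
    apply NSx_extend
    · rintro u v v' ⟨j, hj, (⟨e, hu, hv⟩ | ⟨e, hu, hv⟩)⟩ ⟨j', hj', (⟨e', hu', hv'⟩ | ⟨e', hu', hv'⟩)⟩
      · ext; omega
      · have := key a j j' hj hj' _ _ e e' (by omega); simp at this
      · have := key a j' j hj' hj _ _ e' e (by omega); simp at this
      · ext; omega
    · rintro u v v' ⟨j, hj, (⟨e, hu, hv⟩ | ⟨e, hu, hv⟩)⟩ ⟨j', hj', (⟨e', hu', hv'⟩ | ⟨e', hu', hv'⟩)⟩
      · ext; omega
      · have := key a j' j hj' hj _ _ e' e (by omega); simp at this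
      · have := key a j j' hj hj' _ _ e e' (by omega); simp at this
      · ext; omega
  choose σ hσ using ex
  refine ⟨l.length + 1, FreeGroup.lift σ, ?_⟩
  have step : ∀ m (hm : m ≤ l.length), (FreeGroup.lift σ (FreeGroup.mk (l.take m))) ⟨m, by omega⟩ = ⟨0, by omega⟩ := by
    intro m
    induction m with
    | zero => intro _; simp [← FreeGroup.one_eq_mk]
    | succ m ih =>
      intro hm
      have hm' : m < l.length := hm
      rw [List.take_succ_eq_append_getElem hm', ← FreeGroup.mul_mk, map_mul, Equiv.Perm.mul_apply]
      have : (FreeGroup.lift σ (FreeGroup.mk [l[m]])) ⟨m+1, by omega⟩ = ⟨m, by omega⟩ := by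
        rcases hlm : l[m] with ⟨a, b⟩
        cases b
        · simp only [FreeGroup.lift_mk, List.map_cons, List.map_nil, List.prod_cons, List.prod_nil, mul_one, cond_false]
          rw [Equiv.Perm.inv_eq_iff_eq]
          exact (hσ a _ _ ⟨m, hm', Or.inr ⟨hlm, rfl, rfl⟩⟩).symm
        · simp only [FreeGroup.lift_mk, List.map_cons, List.map_nil, List.prod_cons, List.prod_nil, mul_one, cond_true]
          exact hσ a _ _ ⟨m, hm', Or.inl ⟨hlm, rfl, rfl⟩⟩
      rw [this]
      exact ih (by omega)
  intro h1
  have := step l.length le_rfl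
  have hmk : FreeGroup.mk l = w := FreeGroup.mk_toWord
  rw [List.take_length, hmk, h1] at this
  simp at this
  exact hlen this

theorem NSx_hopf {α : Type} [Finite α] (f : FreeGroup α →* FreeGroup α)
    (hf : Function.Surjective f) : Function.Injective f := by
  classical
  rw [injective_iff_map_eq_one]
  intro w hw
  by_contra hne
  obtain ⟨N, ψ, hψ⟩ := NSx_resfin w hne
  have : Finite (FreeGroup α →* Equiv.Perm (Fin N)) :=
    Finite.of_equiv _ (FreeGroup.lift (α := α) (β := Equiv.Perm (Fin N)))
  have hinj : Function.Injective (fun g : FreeGroup α →* Equiv.Perm (Fin N) => g.comp f) := by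
    intro g1 g2 h
    exact (MonoidHom.cancel_right hf).mp h
  obtain ⟨g, hg⟩ := (Finite.injective_iff_surjective.mp hinj) ψ
  apply hψ
  rw [← hg]
  simp [hw]

structure NSt (k L : ℕ) (F N V E Φ : Type) where
  Vs : Finset V
  Es : Finset E
  Ds : Finset E
  Ts : Finset Φ
  src : E → V
  tgt : E → V
  lab : E → Fin k
  bd : Φ → ZMod L → E
  c : E → F
  h : V → N

structure NPre {k L : ℕ} {F N V E Φ : Type} [Group F] [Group N] (n : ℕ) (φ : F →* N)
    (x : Fin k → N) (lam : ZMod L → Fin k) (tau : ZMod L → ZMod L)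
    (S : NSt k L F N V E Φ) : Prop where
  vne : S.Vs.Nonempty
  disj : ∀ e ∈ S.Es, e ∉ S.Ds
  srcE : ∀ e, e ∈ S.Es ∨ e ∈ S.Ds → S.src e ∈ S.Vs
  tgtE : ∀ e, e ∈ S.Es ∨ e ∈ S.Ds → S.tgt e ∈ S.Vs
  bdE : ∀ f ∈ S.Ts, ∀ p, S.bd f p ∈ S.Es
  bdl : ∀ f ∈ S.Ts, ∀ p, S.lab (S.bd f p) = lam p
  bdc : ∀ f ∈ S.Ts, ∀ p, S.tgt (S.bd f p) = S.src (S.bd f (p + 1))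
  hE : ∀ e ∈ S.Es, φ (S.c e) = S.h (S.src e) * x (S.lab e) * (S.h (S.tgt e))⁻¹
  hD : ∀ e ∈ S.Ds, φ (S.c e) = S.h (S.src e) * (S.h (S.tgt e))⁻¹
  face : ∀ f ∈ S.Ts, ∃ u : ZMod L → F, ∀ p, S.c (S.bd f p) = u p * (u (p + 1))⁻¹
  gen : ∀ (Ω : Type) [MulAction F Ω] (κ : V → Ω),
    (∀ e, e ∈ S.Es ∨ e ∈ S.Ds → κ (S.src e) = S.c e • κ (S.tgt e)) →
      ∀ v ∈ S.Vs, ∀ g : F, g • κ v = κ v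
  count : S.Es.card + S.Ds.card + 1 = n + S.Ts.card + S.Vs.card
  clsC : ∀ f ∈ S.Ts, ∀ g ∈ S.Ts, ∀ p, S.bd f p = S.bd g p → f = g
  coll : ∀ Q ⊆ S.Ts, Q.Nonempty → ∃ f ∈ Q, ∃ p, ∀ g ∈ Q, S.bd g (tau p) ≠ S.bd f p

def NOnto {k L : ℕ} {F N V E Φ : Type} (S : NSt k L F N V E Φ) : Prop :=
  ∀ (Ω : Type) (σ : Fin k → Equiv.Perm Ω) (κ : V → Ω),
    (∀ e ∈ S.Es, κ (S.src e) = σ (S.lab e) (κ (S.tgt e))) →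
    (∀ e ∈ S.Ds, κ (S.src e) = κ (S.tgt e)) →
      ∀ v ∈ S.Vs, (∀ v' ∈ S.Vs, κ v = κ v') ∧ ∀ i, σ i (κ v) = κ v

structure NPos {k L : ℕ} (lam : ZMod L → Fin k) (tau : ZMod L → ZMod L) : Prop where
  eqv : ∀ p q, lam q = lam p → q = p ∨ q = tau p
  lamtau : ∀ p, lam (tau p) = lam p
  inv : ∀ p, tau (tau p) = p
  ne : ∀ p, tau p ≠ p

def NMeas {k L : ℕ} {F N V E Φ : Type} (S : NSt k L F N V E Φ) : ℕ := S.Es.card + S.Vs.card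

theorem NSx_cyc {L : ℕ} [NeZero L] {X : Type} (y : ZMod L → X) (p0 : ZMod L)
    (h : ∀ p, p ≠ p0 → y p = y (p + 1)) : ∀ p q, y p = y q := by
  have key : ∀ m : ℕ, m < L → y (p0 + 1 + m) = y (p0 + 1) := by
    intro m
    induction m with
    | zero => intro _; simp
    | succ m ih =>
      intro hm
      rw [← ih (by omega)]
      have := h (p0 + 1 + m) (by
        intro he
        have h0 : ((m + 1 : ℕ) : ZMod L) = 0 := by
          push_cast
          have : p0 + (m + 1 : ZMod L) = p0 + 0 := by rw [add_zero]; nth_rewrite 2 [← he]; ring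
          exact add_left_cancel this
        rw [ZMod.natCast_eq_zero_iff] at h0
        exact absurd (Nat.le_of_dvd (by omega) h0) (by omega))
      rw [this]; push_cast; congr 1; ring
  have all : ∀ p, y p = y (p0 + 1) := by
    intro p
    have := key (p - (p0 + 1)).val (ZMod.val_lt _)
    rw [ZMod.natCast_zmod_val] at this
    rw [← this]; congr 1; ring
  intro p q
  rw [all p, all q]

section
set_option linter.unusedSectionVars false
open Classical

variable {k L : ℕ} [NeZero L] {F N V E Φ : Type} [Group F] [Group N] {n : ℕ} {φ : F →* N}
    {x : Fin k → N} {lam : ZMod L → Fin k} {tau : ZMod L → ZMod L} {S : NSt k L F N V E Φ}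

theorem NPre.bdpos (hP : NPos lam tau) (hS : NPre n φ x lam tau S) {f g : Φ} (hf : f ∈ S.Ts)
    (hg : g ∈ S.Ts) {p q : ZMod L} (h : S.bd g q = S.bd f p) : (g = f ∧ q = p) ∨ q = tau p := by
  have := hP.eqv p q (by rw [← hS.bdl f hf p, ← hS.bdl g hg q, h])
  rcases this with rfl | h'
  · exact Or.inl ⟨hS.clsC g hg f hf _ h, rfl⟩
  · exact Or.inr h'

theorem NPre.collapse (hP : NPos lam tau) (hS : NPre n φ x lam tau S) {f : Φ} (hf : f ∈ S.Ts)
    {p0 : ZMod L} (hu : ∀ g ∈ S.Ts, S.bd g (tau p0) ≠ S.bd f p0) :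
    NPre n φ x lam tau { S with Es := S.Es.erase (S.bd f p0), Ts := S.Ts.erase f } := by
  have hu' : ∀ g ∈ S.Ts, ∀ p, S.bd g p = S.bd f p0 → g = f ∧ p = p0 := by
    intro g hg p h
    rcases hS.bdpos hP hf hg h with h1 | h1
    · exact h1
    · subst h1; exact absurd h (hu g hg)
  refine ⟨hS.vne, ?_, ?_, ?_, ?_, ?_, ?_, ?_, hS.hD, ?_, ?_, ?_, ?_, ?_⟩
  · intro e he; exact hS.disj e (Finset.mem_of_mem_erase he)
  · intro e he; exact hS.srcE e (he.imp_left Finset.mem_of_mem_erase)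
  · intro e he; exact hS.tgtE e (he.imp_left Finset.mem_of_mem_erase)
  · intro g hg p
    obtain ⟨h1, h2⟩ := Finset.mem_erase.mp hg
    exact Finset.mem_erase.mpr ⟨fun h => h1 (hu' g h2 p h).1, hS.bdE g h2 p⟩
  · intro g hg; exact hS.bdl g (Finset.mem_of_mem_erase hg)
  · intro g hg; exact hS.bdc g (Finset.mem_of_mem_erase hg)
  · intro e he; exact hS.hE e (Finset.mem_of_mem_erase he)
  · intro g hg; exact hS.face g (Finset.mem_of_mem_erase hg)
  · intro Ω _ κ hκ
    apply hS.gen Ω κ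
    intro e he
    by_cases hea : e = S.bd f p0
    · subst hea
      obtain ⟨u, hu1⟩ := hS.face f hf
      have hc := NSx_cyc (fun p => (u p)⁻¹ • κ (S.src (S.bd f p))) p0 (by
        intro p hp
        have hm : S.bd f p ∈ S.Es.erase (S.bd f p0) :=
          Finset.mem_erase.mpr ⟨fun h => hp (hu' f hf p h).2, hS.bdE f hf p⟩
        have := hκ _ (Or.inl hm)
        simp only at this ⊢
        rw [this, hu1 p, hS.bdc f hf p, smul_smul, inv_mul_cancel_left])
      have h2 := hc p0 (p0 + 1)
      rw [hu1 p0, hS.bdc f hf p0, mul_smul, ← h2, smul_inv_smul]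
    · rcases he with he | he
      · exact hκ e (Or.inl (Finset.mem_erase.mpr ⟨hea, he⟩))
      · exact hκ e (Or.inr he)
  · have h1 := Finset.card_erase_add_one (hS.bdE f hf p0)
    have h2 := Finset.card_erase_add_one hf
    have := hS.count
    simp only
    omega
  · intro g hg g' hg'
    exact hS.clsC g (Finset.mem_of_mem_erase hg) g' (Finset.mem_of_mem_erase hg')
  · intro Q hQ
    exact hS.coll Q (hQ.trans (Finset.erase_subset _ _))

/-- dead conversion -/
theorem NPre.deaden (hS : NPre n φ x lam tau S) {e0 e1 : E} (h0 : e0 ∈ S.Es) (h1 : e1 ∈ S.Es)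
    (hne : e0 ≠ e1) (hl : S.lab e0 = S.lab e1) (hs : S.src e0 = S.src e1)
    (ht : S.tgt e0 = S.tgt e1) (hun : ∀ f ∈ S.Ts, ∀ p, S.bd f p ≠ e0) :
    NPre n φ x lam tau { S with
      Es := S.Es.erase e0, Ds := insert e0 S.Ds
      tgt := Function.update S.tgt e0 (S.src e0)
      c := Function.update S.c e0 (S.c e0 * (S.c e1)⁻¹) } := by
  have hd : ∀ e ∈ S.Ds, e ≠ e0 := fun e he h => hS.disj e0 h0 (h ▸ he)
  refine ⟨hS.vne, ?_, ?_, ?_, ?_, ?_, ?_, ?_, ?_, ?_, ?_, ?_, ?_, ?_⟩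
  · intro e he h
    obtain ⟨h1, h2⟩ := Finset.mem_erase.mp he
    rcases Finset.mem_insert.mp h with h | h
    · exact h1 h
    · exact hS.disj e h2 h
  · rintro e (he | he)
    · exact hS.srcE e (Or.inl (Finset.mem_of_mem_erase he))
    · rcases Finset.mem_insert.mp he with rfl | he
      · exact hS.srcE _ (Or.inl h0)
      · exact hS.srcE e (Or.inr he)
  · rintro e he
    simp only
    by_cases hee : e = e0
    · subst hee; rw [Function.update_self]; exact hS.srcE _ (Or.inl h0)
    · rw [Function.update_of_ne hee]
      rcases he with he | he
      · exact hS.tgtE e (Or.inl (Finset.mem_of_mem_erase he))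
      · exact hS.tgtE e (Or.inr (Finset.mem_of_mem_insert_of_ne he hee))
  · intro f hf p
    exact Finset.mem_erase.mpr ⟨hun f hf p, hS.bdE f hf p⟩
  · exact hS.bdl
  · intro f hf p
    simp only
    rw [Function.update_of_ne (hun f hf p)]
    exact hS.bdc f hf p
  · intro e he
    obtain ⟨h1, h2⟩ := Finset.mem_erase.mp he
    simp only
    rw [Function.update_of_ne h1, Function.update_of_ne h1]
    exact hS.hE e h2
  · intro e he
    simp only
    by_cases hee : e = e0
    · subst hee
      rw [Function.update_self, Function.update_self, map_mul, map_inv, hS.hE _ h0, hS.hE _ h1, hl, hs, ht]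
      group
    · rw [Function.update_of_ne hee, Function.update_of_ne hee]
      exact hS.hD e (Finset.mem_of_mem_insert_of_ne he hee)
  · intro f hf
    obtain ⟨u, hu⟩ := hS.face f hf
    refine ⟨u, fun p => ?_⟩
    simp only
    rw [Function.update_of_ne (hun f hf p)]
    exact hu p
  · intro Ω _ κ hκ
    simp only at hκ
    apply hS.gen Ω κ
    intro e he
    by_cases hee : e = e0
    · subst hee
      have a0 := hκ e (Or.inr (Finset.mem_insert_self _ _))
      have a1 := hκ e1 (Or.inl (Finset.mem_erase.mpr ⟨hne.symm, h1⟩))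
      rw [Function.update_self, Function.update_self] at a0
      rw [Function.update_of_ne hne.symm, Function.update_of_ne hne.symm, ← hs, ← ht] at a1
      rw [a0, a1, smul_smul, inv_mul_cancel_right]
    · have := hκ e (he.imp (fun h => Finset.mem_erase.mpr ⟨hee, h⟩) (fun h => Finset.mem_insert_of_mem h))
      rw [Function.update_of_ne hee, Function.update_of_ne hee] at this
      exact this
  · have h1 := Finset.card_erase_add_one h0
    have h2 := Finset.card_insert_of_notMem (hS.disj e0 h0)
    have := hS.count
    simp only
    omega
  · exact hS.clsC
  · exact hS.coll

theorem NSx_deaden_onto (hO : NOnto S) {e0 e1 : E} (h0 : e0 ∉ S.Ds) (h1 : e1 ∈ S.Es)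
    (hne : e0 ≠ e1) (hl : S.lab e0 = S.lab e1) (hs : S.src e0 = S.src e1)
    (ht : S.tgt e0 = S.tgt e1) :
    NOnto { S with
      Es := S.Es.erase e0, Ds := insert e0 S.Ds
      tgt := Function.update S.tgt e0 (S.src e0)
      c := Function.update S.c e0 (S.c e0 * (S.c e1)⁻¹) } := by
  intro Ω σ κ hE hD
  simp only at hE hD
  apply hO Ω σ κ
  · intro e he
    have a : ∀ e ∈ S.Es, e ≠ e0 → κ (S.src e) = σ (S.lab e) (κ (S.tgt e)) := by
      intro e he hee
      have := hE e (Finset.mem_erase.mpr ⟨hee, he⟩)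
      rwa [Function.update_of_ne hee] at this
    by_cases hee : e = e0
    · rw [hee, hs, hl, ht]; exact a e1 h1 hne.symm
    · exact a e he hee
  · intro e he
    have hee : e ≠ e0 := fun h => h0 (h ▸ he)
    have := hD e (Finset.mem_insert_of_mem he)
    rwa [Function.update_of_ne hee] at this

end

section
set_option linter.unusedSectionVars false
open Classical

variable {k L : ℕ} [NeZero L] {F N V E Φ : Type} [Group F] [Group N] {n : ℕ} {φ : F →* N}
    {x : Fin k → N} {lam : ZMod L → Fin k} {tau : ZMod L → ZMod L} {S : NSt k L F N V E Φ}

noncomputable def nsS (w0 w1 : V) (v : V) : V := if v = w0 then w1 else v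
noncomputable def nsG (w0 : V) (γ : F) (v : V) : F := if v = w0 then γ else 1

noncomputable def NSt.merge (S : NSt k L F N V E Φ) (w0 w1 : V) (γ : F) (t : E → E)
    (Es' Ds' : Finset E) : NSt k L F N V E Φ :=
  { Vs := S.Vs.erase w0
    Es := Es'
    Ds := Ds'
    Ts := S.Ts
    src := fun e => nsS w0 w1 (S.src e)
    tgt := fun e => nsS w0 w1 (S.tgt e)
    lab := S.lab
    bd := fun f p => t (S.bd f p)
    c := fun e => nsG w0 γ (S.src e) * S.c e * (nsG w0 γ (S.tgt e))⁻¹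
    h := S.h }

theorem nsS_mem {w0 w1 : V} (hw : w0 ≠ w1) (h1 : w1 ∈ S.Vs) {v : V} (hv : v ∈ S.Vs) :
    nsS w0 w1 v ∈ S.Vs.erase w0 := by
  unfold nsS
  split_ifs with h
  · exact Finset.mem_erase.mpr ⟨hw.symm, h1⟩
  · exact Finset.mem_erase.mpr ⟨h, hv⟩

theorem NPre.merge (hS : NPre n φ x lam tau S) {w0 w1 : V} (hw : w0 ≠ w1) (h0 : w0 ∈ S.Vs)
    (h1 : w1 ∈ S.Vs) {γ : F} (hγ : φ γ * S.h w0 = S.h w1) {t : E → E} {Es' Ds' : Finset E}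
    (hEs : Es' ⊆ S.Es) (hDs : Ds' ⊆ S.Ds)
    (htE : ∀ e ∈ S.Es, t e ∈ Es') (htl : ∀ e ∈ S.Es, S.lab (t e) = S.lab e)
    (hts : ∀ e ∈ S.Es, nsS w0 w1 (S.src (t e)) = nsS w0 w1 (S.src e))
    (htt : ∀ e ∈ S.Es, nsS w0 w1 (S.tgt (t e)) = nsS w0 w1 (S.tgt e))
    (htc : ∀ e ∈ S.Es, nsG w0 γ (S.src (t e)) * S.c (t e) * (nsG w0 γ (S.tgt (t e)))⁻¹ =
      nsG w0 γ (S.src e) * S.c e * (nsG w0 γ (S.tgt e))⁻¹)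
    (hdead : ∀ e ∈ S.Ds, e ∈ Ds' ∨ (nsS w0 w1 (S.src e) = nsS w0 w1 (S.tgt e) ∧
      nsG w0 γ (S.src e) * S.c e * (nsG w0 γ (S.tgt e))⁻¹ = 1))
    (hcount : Es'.card + Ds'.card + 1 = S.Es.card + S.Ds.card)
    (hclsC : ∀ f ∈ S.Ts, ∀ g ∈ S.Ts, ∀ p, t (S.bd f p) = t (S.bd g p) → f = g)
    (hcoll : ∀ Q ⊆ S.Ts, Q.Nonempty → ∃ f ∈ Q, ∃ p, ∀ g ∈ Q, t (S.bd g (tau p)) ≠ t (S.bd f p)) :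
    NPre n φ x lam tau (S.merge w0 w1 γ t Es' Ds') := by
  have hgs : ∀ v, φ (nsG w0 γ v) * S.h v = S.h (nsS w0 w1 v) := by
    intro v; unfold nsG nsS
    split_ifs with h
    · rw [h, hγ]
    · simp
  refine ⟨⟨w1, Finset.mem_erase.mpr ⟨hw.symm, h1⟩⟩, ?_, ?_, ?_, ?_, ?_, ?_, ?_, ?_, ?_, ?_, ?_,
    hclsC, hcoll⟩
  · intro e he h; exact hS.disj e (hEs he) (hDs h)
  · intro e he; exact nsS_mem hw h1 (hS.srcE e (he.imp (fun h => hEs h) (fun h => hDs h)))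
  · intro e he; exact nsS_mem hw h1 (hS.tgtE e (he.imp (fun h => hEs h) (fun h => hDs h)))
  · intro f hf p; exact htE _ (hS.bdE f hf p)
  · intro f hf p
    change S.lab (t (S.bd f p)) = _
    rw [htl _ (hS.bdE f hf p), hS.bdl f hf p]
  · intro f hf p
    change nsS w0 w1 (S.tgt (t (S.bd f p))) = nsS w0 w1 (S.src (t (S.bd f (p + 1))))
    rw [htt _ (hS.bdE f hf p), hts _ (hS.bdE f hf _), hS.bdc f hf p]
  · intro e he
    change φ (nsG w0 γ (S.src e) * S.c e * (nsG w0 γ (S.tgt e))⁻¹) =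
      S.h (nsS w0 w1 (S.src e)) * x (S.lab e) * (S.h (nsS w0 w1 (S.tgt e)))⁻¹
    rw [← hgs, ← hgs, map_mul, map_mul, map_inv, hS.hE e (hEs he)]
    group
  · intro e he
    change φ (nsG w0 γ (S.src e) * S.c e * (nsG w0 γ (S.tgt e))⁻¹) =
      S.h (nsS w0 w1 (S.src e)) * (S.h (nsS w0 w1 (S.tgt e)))⁻¹
    rw [← hgs, ← hgs, map_mul, map_mul, map_inv, hS.hD e (hDs he)]
    group
  · intro f hf
    obtain ⟨u, hu⟩ := hS.face f hf
    refine ⟨fun p => nsG w0 γ (S.src (S.bd f p)) * u p, fun p => ?_⟩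
    change nsG w0 γ (S.src (t (S.bd f p))) * S.c (t (S.bd f p)) * (nsG w0 γ (S.tgt (t (S.bd f p))))⁻¹ = _
    rw [htc _ (hS.bdE f hf p), hu p, hS.bdc f hf p]
    group
  · intro Ω _ κ hκ v hv g
    have hκ1 : ∀ e, e ∈ Es' ∨ e ∈ Ds' → κ (nsS w0 w1 (S.src e)) =
      (nsG w0 γ (S.src e) * S.c e * (nsG w0 γ (S.tgt e))⁻¹) • κ (nsS w0 w1 (S.tgt e)) := hκ
    have hv' : v ∈ S.Vs.erase w0 := hv
    obtain ⟨hv1, hv2⟩ := Finset.mem_erase.mp hv'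
    have main := hS.gen Ω (fun v => (nsG w0 γ v)⁻¹ • κ (nsS w0 w1 v)) (by
      intro e he
      have : κ (nsS w0 w1 (S.src e)) =
        (nsG w0 γ (S.src e) * S.c e * (nsG w0 γ (S.tgt e))⁻¹) • κ (nsS w0 w1 (S.tgt e)) := by
        rcases he with he | he
        · have := hκ1 (t e) (Or.inl (htE e he))
          rwa [htc e he, hts e he, htt e he] at this
        · rcases hdead e he with h | ⟨h2, h3⟩
          · exact hκ1 e (Or.inr h)
          · rw [h3, h2, one_smul]
      rw [this]
      simp only [smul_smul]
      congr 1
      group) v hv2 g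
    have e1 : nsG w0 γ v = 1 := by unfold nsG; rw [if_neg hv1]
    have e2 : nsS w0 w1 v = v := by unfold nsS; rw [if_neg hv1]
    simpa [e1, e2] using main
  · change Es'.card + Ds'.card + 1 = n + S.Ts.card + (S.Vs.erase w0).card
    have := Finset.card_erase_add_one h0
    have := hS.count
    omega

theorem NSx_merge_onto (hO : NOnto S) {w0 w1 : V} {γ : F} {t : E → E} {Es' Ds' : Finset E}
    (htE : ∀ e ∈ S.Es, t e ∈ Es') (htl : ∀ e ∈ S.Es, S.lab (t e) = S.lab e)
    (hts : ∀ e ∈ S.Es, nsS w0 w1 (S.src (t e)) = nsS w0 w1 (S.src e))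
    (htt : ∀ e ∈ S.Es, nsS w0 w1 (S.tgt (t e)) = nsS w0 w1 (S.tgt e))
    (hdead : ∀ e ∈ S.Ds, e ∈ Ds' ∨ (nsS w0 w1 (S.src e) = nsS w0 w1 (S.tgt e))) :
    NOnto (S.merge w0 w1 γ t Es' Ds') := by
  intro Ω σ κ hE hD v hv
  have hE1 : ∀ e ∈ Es', κ (nsS w0 w1 (S.src e)) = σ (S.lab e) (κ (nsS w0 w1 (S.tgt e))) := hE
  have hD1 : ∀ e ∈ Ds', κ (nsS w0 w1 (S.src e)) = κ (nsS w0 w1 (S.tgt e)) := hD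
  have hk : ∀ v ∈ S.Vs.erase w0, v ∈ S.Vs ∧ nsS w0 w1 v = v := by
    intro v hv
    obtain ⟨a, b⟩ := Finset.mem_erase.mp hv
    exact ⟨b, by unfold nsS; rw [if_neg a]⟩
  have main := hO Ω σ (fun v => κ (nsS w0 w1 v)) (by
    intro e he
    have := hE1 _ (htE e he)
    rwa [hts e he, htt e he, htl e he] at this) (by
    intro e he
    rcases hdead e he with h | h
    · exact hD1 e h
    · exact congrArg κ h) v (hk v hv).1
  have hv' := (hk v hv).2
  simp only [hv'] at main
  refine ⟨fun v' hv1 => ?_, main.2⟩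
  have := main.1 v' (hk v' hv1).1
  rwa [(hk v' hv1).2] at this

/-- Move A -/
theorem NSx_moveA (hS : NPre n φ x lam tau S) (hO : NOnto S) {d : E} (hd : d ∈ S.Ds)
    (hne : S.src d ≠ S.tgt d) :
    ∃ S' : NSt k L F N V E Φ, NPre n φ x lam tau S' ∧ NOnto S' ∧ NMeas S' < NMeas S := by
  have hw0 := hS.srcE d (Or.inr hd)
  refine ⟨S.merge (S.src d) (S.tgt d) (S.c d)⁻¹ id S.Es (S.Ds.erase d), ?_, ?_, ?_⟩
  · apply hS.merge hne hw0 (hS.tgtE d (Or.inr hd))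
    · rw [map_inv, hS.hD d hd]; group
    · exact subset_rfl
    · exact Finset.erase_subset _ _
    · intro e he; exact he
    · intro e he; rfl
    · intro e he; rfl
    · intro e he; rfl
    · intro e he; rfl
    · intro e he
      by_cases hee : e = d
      · right
        subst hee
        refine ⟨by simp [nsS], by simp [nsG, hne.symm]⟩
      · exact Or.inl (Finset.mem_erase.mpr ⟨hee, he⟩)
    · have := Finset.card_erase_add_one hd; omega
    · exact hS.clsC
    · exact hS.coll
  · apply NSx_merge_onto hO
    · intro e he; exact he
    · intro e he; rfl
    · intro e he; rfl
    · intro e he; rfl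
    · intro e he
      by_cases hee : e = d
      · right
        subst hee
        simp [nsS]
      · exact Or.inl (Finset.mem_erase.mpr ⟨hee, he⟩)
  · have := Finset.card_erase_add_one hw0
    change S.Es.card + (S.Vs.erase (S.src d)).card < S.Es.card + S.Vs.card
    omega

noncomputable def nsChi (S : NSt k L F N V E Φ) (w0 : V) (e : E) : ZMod 2 :=
  (if S.src e = w0 then 1 else 0) + (if S.tgt e = w0 then 1 else 0)

theorem NSx_two (a : ZMod 2) : a + a = 0 := CharTwo.add_self_eq_zero a

theorem NSx_foldcoll (hP : NPos lam tau) (hS : NPre n φ x lam tau S) {e0 e1 : E}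
    (hne : e0 ≠ e1)
    (hna : ∀ p, ∀ f ∈ S.Ts, ∀ g ∈ S.Ts, S.bd f p = e0 → S.bd g p ≠ e1)
    {w0 : V} (hpar : nsChi S w0 e0 + nsChi S w0 e1 = 1) {t : E → E}
    (ht0 : t e0 = e1) (ht1 : ∀ e, e ≠ e0 → t e = e)
    (hclsC : ∀ f ∈ S.Ts, ∀ g ∈ S.Ts, ∀ p, t (S.bd f p) = t (S.bd g p) → f = g) :
    ∀ Q ⊆ S.Ts, Q.Nonempty → ∃ f ∈ Q, ∃ p, ∀ g ∈ Q, t (S.bd g (tau p)) ≠ t (S.bd f p) := by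
  intro Q hQ hQn
  by_contra hcon
  push Not at hcon
  obtain ⟨f, hf, p, hfp⟩ := hS.coll Q hQ hQn
  obtain ⟨g, hg, hgf⟩ := hcon f hf p
  have hgne := hfp g hg
  -- find the use of e0
  have huse : ∃ f1 ∈ Q, ∃ q, S.bd f1 q = e0 ∧ ∃ g1 ∈ Q, S.bd g1 (tau q) = e1 := by
    by_cases h1 : S.bd f p = e0
    · refine ⟨f, hf, p, h1, g, hg, ?_⟩
      rw [h1, ht0, ht1 _ (by rw [← h1]; exact hgne)] at hgf
      exact hgf
    · rw [ht1 _ h1] at hgf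
      by_cases h2 : S.bd g (tau p) = e0
      · refine ⟨g, hg, tau p, h2, f, hf, ?_⟩
        rw [hP.inv, ← hgf, h2, ht0]
      · rw [ht1 _ h2] at hgf
        exact absurd hgf hgne
  obtain ⟨f1, hf1, q, hq, g1, hg1, hgq⟩ := huse
  have huniq : ∀ f ∈ Q, ∀ p, S.bd f p = e0 → f = f1 ∧ p = q := by
    intro f hf p h
    rcases hS.bdpos hP (hQ hf1) (hQ hf) (h.trans hq.symm) with h1 | h1
    · exact h1
    · subst h1
      exact absurd hgq (hna _ f (hQ hf) g1 (hQ hg1) h)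
  -- three sums
  have s1 : ∑ z ∈ Q ×ˢ (Finset.univ : Finset (ZMod L)), nsChi S w0 (S.bd z.1 z.2) = 0 := by
    rw [Finset.sum_product]
    apply Finset.sum_eq_zero
    intro f hf
    unfold nsChi
    rw [Finset.sum_add_distrib]
    have : ∑ p : ZMod L, (if S.tgt (S.bd f p) = w0 then (1 : ZMod 2) else 0) =
        ∑ p : ZMod L, (if S.src (S.bd f p) = w0 then (1 : ZMod 2) else 0) := by
      rw [← Equiv.sum_comp (Equiv.addRight (1 : ZMod L))
        (fun p => if S.src (S.bd f p) = w0 then (1 : ZMod 2) else 0)]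
      apply Finset.sum_congr rfl
      intro p _
      simp only [Equiv.coe_addRight, hS.bdc f (hQ hf) p]
      congr
    simp only
    rw [this]
    exact NSx_two _
  have s2 : ∑ z ∈ Q ×ˢ (Finset.univ : Finset (ZMod L)), nsChi S w0 (t (S.bd z.1 z.2)) = 0 := by
    choose! G hG1 hG2 using hcon
    have hinvo : ∀ z ∈ Q ×ˢ (Finset.univ : Finset (ZMod L)), G (G z.1 z.2) (tau z.2) = z.1 := by
      intro z hz
      have hz1 := (Finset.mem_product.mp hz).1
      apply hclsC _ (hQ (hG1 _ (hG1 _ hz1 _) _)) _ (hQ hz1) z.2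
      have a := hG2 _ (hG1 _ hz1 z.2) (tau z.2)
      rw [hP.inv] at a
      rw [a, hG2 _ hz1]
    refine Finset.sum_involution (fun z _ => (G z.1 z.2, tau z.2)) ?_ ?_ ?_ ?_
    · intro z hz
      simp only
      rw [hG2 _ (Finset.mem_product.mp hz).1]
      exact NSx_two _
    · intro z hz _ h
      exact hP.ne z.2 (congrArg Prod.snd h)
    · intro z hz
      exact Finset.mem_product.mpr ⟨hG1 _ (Finset.mem_product.mp hz).1 _, Finset.mem_univ _⟩
    · intro z hz
      exact Prod.ext (hinvo z hz) (hP.inv _)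
  have s3 : ∑ z ∈ Q ×ˢ (Finset.univ : Finset (ZMod L)),
      (nsChi S w0 (S.bd z.1 z.2) + nsChi S w0 (t (S.bd z.1 z.2))) = 1 := by
    rw [Finset.sum_eq_single (f1, q)]
    · simp only [hq, ht0]; exact hpar
    · intro z hz hzne
      have : S.bd z.1 z.2 ≠ e0 := by
        intro h
        have := huniq _ (Finset.mem_product.mp hz).1 _ h
        exact hzne (Prod.ext this.1 this.2)
      rw [ht1 _ this]
      exact NSx_two _
    · intro h
      exact absurd (Finset.mem_product.mpr ⟨hf1, Finset.mem_univ _⟩) h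
  rw [Finset.sum_add_distrib, s1, s2] at s3
  exact absurd s3 (by decide)

/-- Fold -/
theorem NSx_fold (hP : NPos lam tau) (hS : NPre n φ x lam tau S) (hO : NOnto S) {e0 e1 : E}
    (h0 : e0 ∈ S.Es) (h1 : e1 ∈ S.Es) (hne : e0 ≠ e1) (hl : S.lab e0 = S.lab e1)
    (hna : ∀ p, ∀ f ∈ S.Ts, ∀ g ∈ S.Ts, S.bd f p = e0 → S.bd g p ≠ e1)
    {w0 w1 : V} (hw : w0 ≠ w1) (hw0 : w0 ∈ S.Vs) (hw1 : w1 ∈ S.Vs)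
    (hpar : nsChi S w0 e0 + nsChi S w0 e1 = 1)
    {γ : F} (hγ : φ γ * S.h w0 = S.h w1)
    (hs : nsS w0 w1 (S.src e1) = nsS w0 w1 (S.src e0))
    (ht : nsS w0 w1 (S.tgt e1) = nsS w0 w1 (S.tgt e0))
    (hc : nsG w0 γ (S.src e1) * S.c e1 * (nsG w0 γ (S.tgt e1))⁻¹ =
      nsG w0 γ (S.src e0) * S.c e0 * (nsG w0 γ (S.tgt e0))⁻¹) :
    ∃ S' : NSt k L F N V E Φ, NPre n φ x lam tau S' ∧ NOnto S' ∧ NMeas S' < NMeas S := by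
  let t : E → E := fun e => if e = e0 then e1 else e
  have ht0 : t e0 = e1 := by simp [t]
  have ht1 : ∀ e, e ≠ e0 → t e = e := fun e he => by simp [t, he]
  have hcls : ∀ f ∈ S.Ts, ∀ g ∈ S.Ts, ∀ p, t (S.bd f p) = t (S.bd g p) → f = g := by
    intro f hf g hg p h
    by_cases a : S.bd f p = e0
    · by_cases b : S.bd g p = e0
      · exact hS.clsC f hf g hg p (a.trans b.symm)
      · rw [a, ht0, ht1 _ b] at h
        exact absurd h.symm (hna p f hf g hg a)
    · by_cases b : S.bd g p = e0
      · rw [b, ht0, ht1 _ a] at h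
        exact absurd h (hna p g hg f hf b)
      · rw [ht1 _ a, ht1 _ b] at h
        exact hS.clsC f hf g hg p h
  have htE : ∀ e ∈ S.Es, t e ∈ S.Es.erase e0 := by
    intro e he
    by_cases a : e = e0
    · rw [a, ht0]; exact Finset.mem_erase.mpr ⟨hne.symm, h1⟩
    · rw [ht1 _ a]; exact Finset.mem_erase.mpr ⟨a, he⟩
  have htl : ∀ e ∈ S.Es, S.lab (t e) = S.lab e := by
    intro e he
    by_cases a : e = e0
    · rw [a, ht0, hl]
    · rw [ht1 _ a]
  have hts : ∀ e ∈ S.Es, nsS w0 w1 (S.src (t e)) = nsS w0 w1 (S.src e) := by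
    intro e he
    by_cases a : e = e0
    · rw [a, ht0, hs]
    · rw [ht1 _ a]
  have htt : ∀ e ∈ S.Es, nsS w0 w1 (S.tgt (t e)) = nsS w0 w1 (S.tgt e) := by
    intro e he
    by_cases a : e = e0
    · rw [a, ht0, ht]
    · rw [ht1 _ a]
  refine ⟨S.merge w0 w1 γ t (S.Es.erase e0) S.Ds, ?_, ?_, ?_⟩
  · apply hS.merge hw hw0 hw1 hγ (Finset.erase_subset _ _) subset_rfl htE htl hts htt
    · intro e he
      by_cases a : e = e0
      · rw [a, ht0, hc]
      · rw [ht1 _ a]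
    · intro e he; exact Or.inl he
    · have := Finset.card_erase_add_one h0; omega
    · exact hcls
    · exact NSx_foldcoll hP hS hne hna hpar ht0 ht1 hcls
  · exact NSx_merge_onto hO htE htl hts htt (fun e he => Or.inl he)
  · have := Finset.card_erase_add_one hw0
    have := Finset.card_erase_add_one h0
    change (S.Es.erase e0).card + (S.Vs.erase w0).card < S.Es.card + S.Vs.card
    omega

end

section
set_option linter.unusedSectionVars false
open Classical

variable {k L : ℕ} [NeZero L] {F N V E Φ : Type} [Group F] [Group N] {n : ℕ} {φ : F →* N}
    {x : Fin k → N} {lam : ZMod L → Fin k} {tau : ZMod L → ZMod L} {S : NSt k L F N V E Φ}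

def nsR (tau : ZMod L → ZMod L) (S : NSt k L F N V E Φ) : ℕ → Φ → Prop
  | 0, _ => False
  | l + 1, f => ∃ p, ∀ g ∈ S.Ts, S.bd g (tau p) = S.bd f p → nsR tau S l g

theorem nsR_mono (l : ℕ) : ∀ f, nsR tau S l f → nsR tau S (l + 1) f := by
  induction l with
  | zero => intro f h; exact h.elim
  | succ l ih =>
    rintro f ⟨p, hp⟩
    exact ⟨p, fun g hg h => ih g (hp g hg h)⟩

theorem nsR_mono' {l m : ℕ} (hlm : l ≤ m) {f : Φ} (h : nsR tau S l f) : nsR tau S m f := by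
  induction m, hlm using Nat.le_induction with
  | base => exact h
  | succ m _ ih => exact nsR_mono m f ih

theorem nsR_exists (hS : NPre n φ x lam tau S) : ∀ f ∈ S.Ts, ∃ l, nsR tau S l f := by
  by_contra hcon
  push Not at hcon
  obtain ⟨f, hf, hfl⟩ := hcon
  obtain ⟨g, hg, p, hp⟩ := hS.coll (S.Ts.filter (fun f => ∀ l, ¬ nsR tau S l f))
    (Finset.filter_subset _ _) ⟨f, Finset.mem_filter.mpr ⟨hf, hfl⟩⟩
  -- all neighbours of g across p are reached
  have hr : ∀ g' ∈ S.Ts, S.bd g' (tau p) = S.bd g p → ∃ l, nsR tau S l g' := by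
    intro g' hg' h
    by_contra hc
    push Not at hc
    exact hp g' (Finset.mem_filter.mpr ⟨hg', hc⟩) h
  choose! l hl using hr
  refine (Finset.mem_filter.mp hg).2 (S.Ts.sup l + 1) ⟨p, fun g' hg' h => ?_⟩
  exact nsR_mono' (Finset.le_sup hg') (hl g' hg' h)

noncomputable def NSt.rem (S : NSt k L F N V E Φ) (A : Finset E) (B : Finset Φ) : NSt k L F N V E Φ :=
  { S with Es := S.Es \ A, Ts := S.Ts \ B }


theorem NSx_chain_fin (hP : NPos lam tau) (hS : NPre n φ x lam tau S) (l : ℕ) {f g : Φ}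
    (hf : f ∈ S.Ts) (hg : g ∈ S.Ts) (hfg : f ≠ g) {p0 : ZMod L}
    (hp0 : ∀ g ∈ S.Ts, S.bd g (tau p0) = S.bd f p0 → nsR tau S l g)
    (hnf : ¬ nsR tau S l f) (hng : ¬ nsR tau S l g)
    {A : Finset E} {B : Finset Φ} (hA : A ⊆ S.Es) (hpre : NPre n φ x lam tau (S.rem A B))
    (hB : ∀ b ∈ B, nsR tau S l b) (hAu : ∀ b ∈ S.Ts, ∀ p, S.bd b p ∈ A → nsR tau S l b)
    (hnb : ∀ b ∈ S.Ts, S.bd b (tau p0) = S.bd f p0 → b ∈ B)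
    (hprop : ∀ (Ω : Type) (σ : Fin k → Equiv.Perm Ω) (κ : V → Ω),
          (∀ e ∈ S.Es, e ∉ A → κ (S.src e) = σ (S.lab e) (κ (S.tgt e))) →
          κ (S.src (S.bd f p0)) = κ (S.src (S.bd g p0)) →
          ∀ e ∈ S.Es, κ (S.src e) = σ (S.lab e) (κ (S.tgt e))) :
      ∃ (A : Finset E) (B : Finset Φ), A ⊆ S.Es ∧ A.Nonempty ∧ NPre n φ x lam tau (S.rem A B) ∧
        f ∈ B ∧ (∀ b ∈ B, nsR tau S (l + 1) b) ∧
        (∀ b ∈ S.Ts, ∀ p, S.bd b p ∈ A → nsR tau S (l + 1) b) ∧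
        ∀ (Ω : Type) (σ : Fin k → Equiv.Perm Ω) (κ : V → Ω) (p : ZMod L),
          (∀ e ∈ S.Es, e ∉ A → κ (S.src e) = σ (S.lab e) (κ (S.tgt e))) →
          κ (S.src (S.bd f p)) = κ (S.src (S.bd g p)) →
          ∀ e ∈ S.Es, κ (S.src e) = σ (S.lab e) (κ (S.tgt e)) := by
  have hfB : f ∉ B := fun h => hnf (hB f h)
  have hRf : nsR tau S (l + 1) f := ⟨p0, hp0⟩
  have hpre' : NPre n φ x lam tau (S.rem (insert (S.bd f p0) A) (insert f B)) := by
    have := hpre.collapse hP (f := f) (Finset.mem_sdiff.mpr ⟨hf, hfB⟩) (p0 := p0) (by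
      intro b hb h
      obtain ⟨h1, h2⟩ := Finset.mem_sdiff.mp hb
      exact h2 (hnb b h1 h))
    unfold NSt.rem at this ⊢
    simp only at this
    rw [← Finset.sdiff_insert, ← Finset.sdiff_insert] at this
    exact this
  refine ⟨insert (S.bd f p0) A, insert f B, ?_, ⟨_, Finset.mem_insert_self _ _⟩, hpre',
    Finset.mem_insert_self _ _, ?_, ?_, ?_⟩
  · exact Finset.insert_subset (hS.bdE f hf p0) hA
  · intro b hb
    rcases Finset.mem_insert.mp hb with rfl | hb
    · exact hRf
    · exact nsR_mono _ _ (hB b hb)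
  · intro b hb p h
    rcases Finset.mem_insert.mp h with h | h
    · rcases hS.bdpos hP hf hb h with h1 | h1
      · rw [h1.1]; exact hRf
      · subst h1; exact nsR_mono _ _ (hp0 b hb h)
    · exact nsR_mono _ _ (hAu b hb p h)
  · intro Ω σ κ p hκ hag
    have hEf : ∀ q, q ≠ p0 → κ (S.src (S.bd f q)) = σ (lam q) (κ (S.src (S.bd f (q + 1)))) := by
      intro q hq
      rw [← hS.bdl f hf q, ← hS.bdc f hf q]
      apply hκ _ (hS.bdE f hf q)
      intro h
      rcases Finset.mem_insert.mp h with h | h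
      · rcases hS.bdpos hP hf hf h with h1 | h1
        · exact hq h1.2
        · subst h1; exact hnf (hp0 f hf h)
      · exact hnf (hAu f hf q h)
    have hEg : ∀ q, κ (S.src (S.bd g q)) = σ (lam q) (κ (S.src (S.bd g (q + 1)))) := by
      intro q
      rw [← hS.bdl g hg q, ← hS.bdc g hg q]
      apply hκ _ (hS.bdE g hg q)
      intro h
      rcases Finset.mem_insert.mp h with h | h
      · rcases hS.bdpos hP hf hg h with h1 | h1
        · exact hfg h1.1.symm
        · subst h1; exact hng (hp0 g hg h)
      · exact hng (hAu g hg q h)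
    have hc := NSx_cyc (fun q => κ (S.src (S.bd f q)) = κ (S.src (S.bd g q))) p0 (by
      intro q hq
      simp only [eq_iff_iff]
      rw [hEf q hq, hEg q]
      exact (σ (lam q)).injective.eq_iff)
    have hall : ∀ q, κ (S.src (S.bd f q)) = κ (S.src (S.bd g q)) := by
      intro q
      have := hc p q
      exact this.mp hag
    refine hprop Ω σ κ ?_ (hall p0)
    intro e he hea
    by_cases h : e = S.bd f p0
    · rw [h, hS.bdl f hf, hS.bdc f hf, hall, hall]; exact hEg p0
    · exact hκ e he (by rw [Finset.mem_insert]; push Not; exact ⟨h, hea⟩)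

theorem NSx_chain (hP : NPos lam tau) (hS : NPre n φ x lam tau S) (l : ℕ) :
    ∀ f ∈ S.Ts, ∀ g ∈ S.Ts, f ≠ g → nsR tau S (l + 1) f → ¬ nsR tau S l f → ¬ nsR tau S l g →
      ∃ (A : Finset E) (B : Finset Φ), A ⊆ S.Es ∧ A.Nonempty ∧ NPre n φ x lam tau (S.rem A B) ∧
        f ∈ B ∧ (∀ b ∈ B, nsR tau S (l + 1) b) ∧
        (∀ b ∈ S.Ts, ∀ p, S.bd b p ∈ A → nsR tau S (l + 1) b) ∧
        ∀ (Ω : Type) (σ : Fin k → Equiv.Perm Ω) (κ : V → Ω) (p : ZMod L),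
          (∀ e ∈ S.Es, e ∉ A → κ (S.src e) = σ (S.lab e) (κ (S.tgt e))) →
          κ (S.src (S.bd f p)) = κ (S.src (S.bd g p)) →
          ∀ e ∈ S.Es, κ (S.src e) = σ (S.lab e) (κ (S.tgt e)) := by
  induction l with
  | zero =>
    intro f hf g hg hfg hRf hnf hng
    obtain ⟨p0, hp0⟩ := hRf
    refine NSx_chain_fin hP hS 0 hf hg hfg hp0 hnf hng (A := ∅) (B := ∅) (by simp) ?_ (by simp)
      (by simp) (fun b hb h => (hp0 b hb h).elim) ?_
    · simpa [NSt.rem] using hS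
    · intro Ω σ κ h _ e he
      exact h e he (by simp)
  | succ l ih =>
    intro f hf g hg hfg hRf hnf hng
    obtain ⟨p0, hp0⟩ := hRf
    by_cases hex : ∃ f' ∈ S.Ts, S.bd f' (tau p0) = S.bd f p0
    · obtain ⟨f', hf', hff⟩ := hex
      have huq : ∀ b ∈ S.Ts, S.bd b (tau p0) = S.bd f p0 → b = f' := fun b hb h =>
        hS.clsC b hb f' hf' _ (h.trans hff.symm)
      have hnf' : ¬ nsR tau S l f' := fun h => hnf ⟨p0, fun b hb hh => by rw [huq b hb hh]; exact h⟩
      have hgx : ∃ g' ∈ S.Ts, S.bd g' (tau p0) = S.bd g p0 ∧ ¬ nsR tau S l g' := by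
        by_contra hc
        push Not at hc
        exact hng ⟨p0, fun b hb h => hc b hb h⟩
      obtain ⟨g', hg', hgg, hng'⟩ := hgx
      have hne' : f' ≠ g' := by
        intro h
        apply hfg
        apply hS.clsC f hf g hg p0
        rw [← hff, ← hgg, h]
      obtain ⟨A, B, hA, -, hpre, hfB, hB, hAu, hprop⟩ :=
        ih f' hf' g' hg' hne' (hp0 f' hf' hff) hnf' hng'
      refine NSx_chain_fin hP hS (l + 1) hf hg hfg hp0 hnf hng hA hpre hB hAu ?_ ?_
      · intro b hb h; rw [huq b hb h]; exact hfB
      · intro Ω σ κ h1 h2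
        apply hprop Ω σ κ (tau p0) h1
        rw [hff, hgg, h2]
    · push Not at hex
      refine NSx_chain_fin hP hS (l + 1) hf hg hfg hp0 hnf hng (A := ∅) (B := ∅) (by simp) ?_
        (by simp) (by simp) (fun b hb h => absurd h (hex b hb)) ?_
      · simpa [NSt.rem] using hS
      · intro Ω σ κ h _ e he
        exact h e he (by simp)

/-- Move B, case (a), ordered form -/
theorem NSx_moveBa' (hP : NPos lam tau) (hS : NPre n φ x lam tau S) (hO : NOnto S) {f g : Φ}
    (hf : f ∈ S.Ts) (hg : g ∈ S.Ts) (hfg : f ≠ g) {p : ZMod L}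
    (hs : S.src (S.bd f p) = S.src (S.bd g p)) (l : ℕ)
    (h1 : nsR tau S (l + 1) f) (h2 : ¬ nsR tau S l f) (h3 : ¬ nsR tau S l g) :
    ∃ S' : NSt k L F N V E Φ, NPre n φ x lam tau S' ∧ NOnto S' ∧ NMeas S' < NMeas S := by
  obtain ⟨A, B, hA, hAne, hpre, -, -, -, hprop⟩ := NSx_chain hP hS l f hf g hg hfg h1 h2 h3
  refine ⟨S.rem A B, hpre, ?_, ?_⟩
  · intro Ω σ κ hE hD
    exact hO Ω σ κ (hprop Ω σ κ p (fun e he hea => hE e (Finset.mem_sdiff.mpr ⟨he, hea⟩))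
      (by rw [hs])) hD
  · have := Finset.card_sdiff_add_card_eq_card hA
    have := hAne.card_pos
    change (S.Es \ A).card + S.Vs.card < S.Es.card + S.Vs.card
    omega

theorem NSx_moveBa (hP : NPos lam tau) (hS : NPre n φ x lam tau S) (hO : NOnto S) {f g : Φ}
    (hf : f ∈ S.Ts) (hg : g ∈ S.Ts) (hfg : f ≠ g) {p : ZMod L}
    (hs : S.src (S.bd f p) = S.src (S.bd g p)) :
    ∃ S' : NSt k L F N V E Φ, NPre n φ x lam tau S' ∧ NOnto S' ∧ NMeas S' < NMeas S := by
  have hex : ∃ l, nsR tau S l f ∨ nsR tau S l g := by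
    obtain ⟨l, hl⟩ := nsR_exists hS f hf
    exact ⟨l, Or.inl hl⟩
  have hsp := Nat.find_spec hex
  rcases hl : Nat.find hex with _ | l
  · rw [hl] at hsp
    rcases hsp with h | h <;> exact h.elim
  · rw [hl] at hsp
    have hn := Nat.find_min hex (m := l) (by omega)
    push Not at hn
    rcases hsp with h | h
    · exact NSx_moveBa' hP hS hO hf hg hfg hs l h hn.1 hn.2
    · exact NSx_moveBa' hP hS hO hg hf hfg.symm hs.symm l h hn.2 hn.1

/-- Move B -/
theorem NSx_moveB (hP : NPos lam tau) (hS : NPre n φ x lam tau S) (hO : NOnto S) {e0 e1 : E}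
    (h0 : e0 ∈ S.Es) (h1 : e1 ∈ S.Es) (hne : e0 ≠ e1) (hl : S.lab e0 = S.lab e1)
    (hst : S.src e0 = S.src e1 ∨ S.tgt e0 = S.tgt e1) :
    ∃ S' : NSt k L F N V E Φ, NPre n φ x lam tau S' ∧ NOnto S' ∧ NMeas S' < NMeas S := by
  by_cases hna : ∀ p, ∀ f ∈ S.Ts, ∀ g ∈ S.Ts, S.bd f p = e0 → S.bd g p ≠ e1
  swap
  · push Not at hna
    obtain ⟨p, f, hf, g, hg, hfe, hge⟩ := hna
    have hfg : f ≠ g := by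
      rintro rfl
      exact hne (hfe.symm.trans hge)
    rcases hst with h | h
    · exact NSx_moveBa hP hS hO hf hg hfg (p := p) (by rw [hfe, hge, h])
    · exact NSx_moveBa hP hS hO hf hg hfg (p := p + 1)
        (by rw [← hS.bdc f hf, ← hS.bdc g hg, hfe, hge, h])
  by_cases hs : S.src e0 = S.src e1
  · by_cases ht : S.tgt e0 = S.tgt e1
    · -- parallel
      by_cases hu0 : ∀ f ∈ S.Ts, ∀ p, S.bd f p ≠ e0
      · refine ⟨_, hS.deaden h0 h1 hne hl hs ht hu0, NSx_deaden_onto hO (hS.disj _ h0) h1 hne hl hs ht, ?_⟩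
        have := Finset.card_erase_add_one h0
        change (S.Es.erase e0).card + S.Vs.card < S.Es.card + S.Vs.card
        omega
      by_cases hu1 : ∀ f ∈ S.Ts, ∀ p, S.bd f p ≠ e1
      · refine ⟨_, hS.deaden h1 h0 hne.symm hl.symm hs.symm ht.symm hu1,
          NSx_deaden_onto hO (hS.disj _ h1) h0 hne.symm hl.symm hs.symm ht.symm, ?_⟩
        have := Finset.card_erase_add_one h1
        change (S.Es.erase e1).card + S.Vs.card < S.Es.card + S.Vs.card
        omega
      push Not at hu0 hu1
      obtain ⟨f0, hf0, p, hp⟩ := hu0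
      obtain ⟨f1, hf1, q, hq⟩ := hu1
      have hqp : q = tau p := by
        rcases hP.eqv p q (by rw [← hS.bdl f0 hf0 p, ← hS.bdl f1 hf1 q, hp, hq, hl]) with h | h
        · subst h; exact absurd hq (hna q f0 hf0 f1 hf1 hp)
        · exact h
      have hcol := hS.collapse hP hf0 (p0 := p) (by
        intro g hg h
        rw [hp] at h
        exact hna _ g hg f1 hf1 h (hqp ▸ hq))
      refine ⟨_, hcol, ?_, ?_⟩
      · intro Ω σ κ hE hD
        apply hO Ω σ κ _ hD
        intro e he
        simp only [hp] at hE
        by_cases hee : e = e0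
        · rw [hee, hs, hl, ht]; exact hE e1 (Finset.mem_erase.mpr ⟨hne.symm, h1⟩)
        · exact hE e (Finset.mem_erase.mpr ⟨hee, he⟩)
      · have := Finset.card_erase_add_one (hS.bdE f0 hf0 p)
        change (S.Es.erase (S.bd f0 p)).card + S.Vs.card < S.Es.card + S.Vs.card
        omega
    · -- same source
      refine NSx_fold hP hS hO h0 h1 hne hl hna (w0 := S.tgt e0) (w1 := S.tgt e1) ht
        (hS.tgtE _ (Or.inl h0)) (hS.tgtE _ (Or.inl h1)) ?_ (γ := (S.c e1)⁻¹ * S.c e0) ?_ ?_ ?_ ?_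
      · have ht' := Ne.symm ht
        simp only [nsChi, hs, if_true, if_neg ht', add_zero]
        rw [add_right_comm, NSx_two, zero_add]
      · rw [map_mul, map_inv, hS.hE _ h0, hS.hE _ h1, hs, hl]; group
      · rw [hs]
      · simp [nsS]
      · have ht' := Ne.symm ht
        simp only [hs]
        simp [nsG, ht', mul_assoc]
  · have ht : S.tgt e0 = S.tgt e1 := hst.resolve_left hs
    refine NSx_fold hP hS hO h0 h1 hne hl hna (w0 := S.src e0) (w1 := S.src e1) hs
        (hS.srcE _ (Or.inl h0)) (hS.srcE _ (Or.inl h1)) ?_ (γ := S.c e1 * (S.c e0)⁻¹) ?_ ?_ ?_ ?_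
    · have hs' := Ne.symm hs
      simp only [nsChi, ht, if_true, if_neg hs', zero_add]
      rw [add_assoc, NSx_two, add_zero]
    · rw [map_mul, map_inv, hS.hE _ h0, hS.hE _ h1, ht, hl]; group
    · simp [nsS]
    · rw [ht]
    · have hs' := Ne.symm hs
      simp only [ht]
      simp [nsG, hs', mul_assoc]

theorem NSx_reduce (hP : NPos lam tau) (m : ℕ) : ∀ S : NSt k L F N V E Φ, NMeas S = m →
    NPre n φ x lam tau S → NOnto S →
    ∃ S' : NSt k L F N V E Φ, NPre n φ x lam tau S' ∧ NOnto S' ∧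
      (∀ d ∈ S'.Ds, S'.src d = S'.tgt d) ∧
      (∀ e0 ∈ S'.Es, ∀ e1 ∈ S'.Es, S'.lab e0 = S'.lab e1 →
        (S'.src e0 = S'.src e1 ∨ S'.tgt e0 = S'.tgt e1) → e0 = e1) := by
  induction m using Nat.strong_induction_on with
  | _ m ih =>
    intro S hm hS hO
    by_cases hd : ∀ d ∈ S.Ds, S.src d = S.tgt d
    · by_cases he : ∀ e0 ∈ S.Es, ∀ e1 ∈ S.Es, S.lab e0 = S.lab e1 →
        (S.src e0 = S.src e1 ∨ S.tgt e0 = S.tgt e1) → e0 = e1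
      · exact ⟨S, hS, hO, hd, he⟩
      · push Not at he
        obtain ⟨e0, h0, e1, h1, hl, hst, hne⟩ := he
        obtain ⟨S', a, b, c⟩ := NSx_moveB hP hS hO h0 h1 hne hl hst
        exact ih _ (hm ▸ c) S' rfl a b
    · push Not at hd
      obtain ⟨d, hd, hne⟩ := hd
      obtain ⟨S', a, b, c⟩ := NSx_moveA hS hO hd hne
      exact ih _ (hm ▸ c) S' rfl a b
end

section
set_option linter.unusedSectionVars false
open Classical

theorem NSx_terminal {k L n : ℕ} {N V E Φ : Type} [Group N] (hkn : k ≤ n)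
    {φ : FreeGroup (Fin n) →* N} (hφ : Function.Surjective φ)
    {x : Fin k → N} {lam : ZMod L → Fin k} {tau : ZMod L → ZMod L}
    {S : NSt k L (FreeGroup (Fin n)) N V E Φ} (hP : NPos lam tau)
    (hS : NPre n φ x lam tau S) (hO : NOnto S)
    (hd : ∀ d ∈ S.Ds, S.src d = S.tgt d)
    (he : ∀ e0 ∈ S.Es, ∀ e1 ∈ S.Es, S.lab e0 = S.lab e1 →
        (S.src e0 = S.src e1 ∨ S.tgt e0 = S.tgt e1) → e0 = e1) :
    ∃ α : FreeGroup (Fin n) ≃* FreeGroup (Fin n), ∀ i : Fin n,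
      φ (α (FreeGroup.of i)) = if h : (i : ℕ) < k then x ⟨i, h⟩ else 1 := by
  obtain ⟨v0, hv0⟩ := hS.vne
  have hone : ∀ v ∈ S.Vs, v = v0 := by
    have hσ : ∀ i : Fin k, ∃ σ : Equiv.Perm {v // v ∈ S.Vs}, ∀ u v : {v // v ∈ S.Vs},
        (∃ e ∈ S.Es, S.lab e = i ∧ S.tgt e = u.1 ∧ S.src e = v.1) → σ u = v := by
      intro i
      apply NSx_extend
      · rintro u v v' ⟨e, h1, h2, h3, h4⟩ ⟨e', h1', h2', h3', h4'⟩
        have := he e h1 e' h1' (h2.trans h2'.symm) (Or.inr (h3.trans h3'.symm))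
        subst this
        exact Subtype.ext (h4.symm.trans h4')
      · rintro u v v' ⟨e, h1, h2, h3, h4⟩ ⟨e', h1', h2', h3', h4'⟩
        have := he e h1 e' h1' (h2.trans h2'.symm) (Or.inl (h4.trans h4'.symm))
        subst this
        exact Subtype.ext (h3.symm.trans h3')
    choose σ hσ using hσ
    let κ : V → {v // v ∈ S.Vs} := fun v => if h : v ∈ S.Vs then ⟨v, h⟩ else ⟨v0, hv0⟩
    have hκ : ∀ v ∈ S.Vs, (κ v).1 = v := by
      intro v hv; simp [κ, hv]
    have := hO _ σ κ (by
      intro e hee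
      symm
      apply hσ
      exact ⟨e, hee, rfl, (hκ _ (hS.tgtE e (Or.inl hee))).symm, (hκ _ (hS.srcE e (Or.inl hee))).symm⟩)
      (fun e hee => by rw [hd e hee])
    intro v hv
    have h2 := (this v hv).1 v0 hv0
    rw [← hκ v hv, ← hκ v0 hv0, h2]
  have hsrc : ∀ e, e ∈ S.Es ∨ e ∈ S.Ds → S.src e = v0 := fun e h => hone _ (hS.srcE e h)
  have htgt : ∀ e, e ∈ S.Es ∨ e ∈ S.Ds → S.tgt e = v0 := fun e h => hone _ (hS.tgtE e h)
  have hlabinj : ∀ e0 ∈ S.Es, ∀ e1 ∈ S.Es, S.lab e0 = S.lab e1 → e0 = e1 := by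
    intro e0 h0 e1 h1 hl
    exact he e0 h0 e1 h1 hl (Or.inl ((hsrc _ (Or.inl h0)).trans (hsrc _ (Or.inl h1)).symm))
  have hVcard : S.Vs.card = 1 := Finset.card_eq_one.mpr ⟨v0, Finset.eq_singleton_iff_unique_mem.mpr ⟨hv0, hone⟩⟩
  have hTs : S.Ts = ∅ := by
    rw [Finset.eq_empty_iff_forall_notMem]
    intro f hf
    obtain ⟨g, hg, p, hp⟩ := hS.coll {f} (by simpa using hf) ⟨f, by simp⟩
    rw [Finset.mem_singleton] at hg
    subst hg
    apply hp g (by simp)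
    apply hlabinj _ (hS.bdE g hf _) _ (hS.bdE g hf _)
    rw [hS.bdl g hf, hS.bdl g hf, hP.lamtau]
  have hlab : ∀ i : Fin k, ∃ e ∈ S.Es, S.lab e = i := by
    intro i
    by_contra hc
    push Not at hc
    have := (hO Bool (fun j => if j = i then Equiv.swap true false else 1) (fun _ => true) (by
      intro e hee
      simp [hc e hee]) (fun e _ => rfl) v0 hv0).2 i
    simp at this
  choose ε hε1 hε2 using hlab
  have hεs : ∀ e ∈ S.Es, ε (S.lab e) = e := by
    intro e hee
    exact hlabinj _ (hε1 _) _ hee (hε2 _)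
  have hEcard : S.Es.card = k := by
    have : S.Es = Finset.univ.image ε := by
      ext e
      simp only [Finset.mem_image, Finset.mem_univ, true_and]
      constructor
      · intro h; exact ⟨_, hεs e h⟩
      · rintro ⟨i, rfl⟩; exact hε1 i
    rw [this, Finset.card_image_of_injective]
    · simp
    · intro i j h
      rw [← hε2 i, ← hε2 j, h]
  have hDcard : S.Ds.card = n - k := by
    have := hS.count
    rw [hEcard, hVcard, hTs, Finset.card_empty] at this
    omega
  let δ : Fin (n - k) ≃ {e // e ∈ S.Ds} := (Finset.equivFinOfCardEq hDcard).symm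
  obtain ⟨g, hg⟩ := hφ (S.h v0)
  let y : Fin n → FreeGroup (Fin n) := fun i =>
    if h : (i : ℕ) < k then g⁻¹ * S.c (ε ⟨i, h⟩) * g
    else g⁻¹ * S.c (δ ⟨i - k, by omega⟩).1 * g
  have hmem : ∀ e, e ∈ S.Es ∨ e ∈ S.Ds → g⁻¹ * S.c e * g ∈ (FreeGroup.lift y).range := by
    intro e hee
    rcases hee with hee | hee
    · refine ⟨FreeGroup.of ⟨S.lab e, lt_of_lt_of_le (S.lab e).2 hkn⟩, ?_⟩
      rw [FreeGroup.lift_apply_of]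
      simp [y, hεs e hee]
    · obtain ⟨j, hj⟩ := δ.surjective ⟨e, hee⟩
      refine ⟨FreeGroup.of ⟨k + j, by omega⟩, ?_⟩
      rw [FreeGroup.lift_apply_of]
      simp [y, hj]
  have hsurj : Function.Surjective (FreeGroup.lift y) := by
    rw [← MonoidHom.range_eq_top, Subgroup.eq_top_iff']
    intro w
    have := hS.gen (FreeGroup (Fin n) ⧸ (FreeGroup.lift y).range)
      (fun _ => ((g : FreeGroup (Fin n)) : FreeGroup (Fin n) ⧸ (FreeGroup.lift y).range)) (by
        intro e hee
        rw [MulAction.Quotient.smul_coe, QuotientGroup.eq, smul_eq_mul, ← mul_assoc]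
        exact hmem e hee) v0 hv0 (g * w * g⁻¹)
    rw [MulAction.Quotient.smul_coe, eq_comm, QuotientGroup.eq, smul_eq_mul] at this
    simpa [mul_assoc] using this
  refine ⟨MulEquiv.ofBijective (FreeGroup.lift y) ⟨NSx_hopf _ hsurj, hsurj⟩, fun i => ?_⟩
  change φ (FreeGroup.lift y (FreeGroup.of i)) = _
  rw [FreeGroup.lift_apply_of]
  by_cases h : (i : ℕ) < k
  · have hm := hε1 ⟨i, h⟩
    simp only [y, dif_pos h]
    rw [map_mul, map_mul, map_inv, hS.hE _ hm, hsrc _ (Or.inl hm), htgt _ (Or.inl hm), hg, hε2]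
    group
  · have hm := (δ ⟨i - k, by omega⟩).2
    simp only [y, dif_neg h]
    rw [map_mul, map_mul, map_inv, hS.hD _ hm, hsrc _ (Or.inr hm), htgt _ (Or.inr hm), hg]
    group

end

section
set_option linter.unusedSectionVars false
open Classical

structure NTree {k : ℕ} (Vt : Finset (FreeGroup (Fin k)))
    (Et : Finset (FreeGroup (Fin k) × Fin k)) : Prop where
  one : 1 ∈ Vt
  src : ∀ e ∈ Et, e.1 ∈ Vt
  tgt : ∀ e ∈ Et, e.1 * FreeGroup.of e.2 ∈ Vt
  card : Et.card + 1 = Vt.card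
  conn : ∀ (Ω : Type) (κ : FreeGroup (Fin k) → Ω),
    (∀ e ∈ Et, κ e.1 = κ (e.1 * FreeGroup.of e.2)) → ∀ v ∈ Vt, κ v = κ 1

theorem NTree.grow {k : ℕ} {Vt : Finset (FreeGroup (Fin k))}
    {Et : Finset (FreeGroup (Fin k) × Fin k)} (hT : NTree Vt Et) {v w : FreeGroup (Fin k)}
    (hv : v ∈ Vt) (hw : w ∉ Vt) {e : FreeGroup (Fin k) × Fin k}
    (he : (e.1 = v ∧ e.1 * FreeGroup.of e.2 = w) ∨ (e.1 = w ∧ e.1 * FreeGroup.of e.2 = v)) :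
    NTree (insert w Vt) (insert e Et) := by
  have hne : e ∉ Et := by
    intro h
    rcases he with ⟨h1, h2⟩ | ⟨h1, h2⟩
    · exact hw (h2 ▸ hT.tgt e h)
    · exact hw (h1 ▸ hT.src e h)
  refine ⟨Finset.mem_insert_of_mem hT.one, ?_, ?_, ?_, ?_⟩
  · intro e' h
    rcases Finset.mem_insert.mp h with rfl | h
    · rcases he with ⟨h1, h2⟩ | ⟨h1, h2⟩
      · rw [h1]; exact Finset.mem_insert_of_mem hv
      · rw [h1]; exact Finset.mem_insert_self _ _
    · exact Finset.mem_insert_of_mem (hT.src _ h)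
  · intro e' h
    rcases Finset.mem_insert.mp h with rfl | h
    · rcases he with ⟨h1, h2⟩ | ⟨h1, h2⟩
      · rw [h2]; exact Finset.mem_insert_self _ _
      · rw [h2]; exact Finset.mem_insert_of_mem hv
    · exact Finset.mem_insert_of_mem (hT.tgt _ h)
  · rw [Finset.card_insert_of_notMem hne, Finset.card_insert_of_notMem hw, hT.card]
  · intro Ω κ hκ u hu
    have hold := hT.conn Ω κ (fun e' h => hκ e' (Finset.mem_insert_of_mem h))
    rcases Finset.mem_insert.mp hu with rfl | hu
    · have := hκ e (Finset.mem_insert_self _ _)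
      rcases he with ⟨h1, h2⟩ | ⟨h1, h2⟩
      · rw [h2, h1] at this; rw [← this]; exact hold v hv
      · rw [h2, h1] at this; rw [this]; exact hold v hv
    · exact hold u hu

theorem NTree.extend1 {k : ℕ} (l : List (Fin k × Bool)) : ∀ {Vt : Finset (FreeGroup (Fin k))}
    {Et : Finset (FreeGroup (Fin k) × Fin k)}, NTree Vt Et →
    ∃ Vt' Et', NTree Vt' Et' ∧ Vt ⊆ Vt' ∧ FreeGroup.mk l ∈ Vt' := by
  induction l using List.reverseRecOn with
  | nil => intro Vt Et hT; exact ⟨Vt, Et, hT, subset_rfl, hT.one⟩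
  | append_singleton l a ih =>
    intro Vt Et hT
    obtain ⟨Vt', Et', hT', hsub, hm⟩ := ih hT
    by_cases hw : FreeGroup.mk (l ++ [a]) ∈ Vt'
    · exact ⟨Vt', Et', hT', hsub, hw⟩
    · obtain ⟨i, b⟩ := a
      have hmk : FreeGroup.mk (l ++ [(i, b)]) = FreeGroup.mk l * FreeGroup.mk [(i, b)] :=
        FreeGroup.mul_mk.symm
      cases b
      · have : FreeGroup.mk [(i, false)] = (FreeGroup.of i)⁻¹ := rfl
        refine ⟨_, _, hT'.grow hm hw (e := (FreeGroup.mk (l ++ [(i, false)]), i)) (Or.inr ⟨rfl, ?_⟩),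
          hsub.trans (Finset.subset_insert _ _), Finset.mem_insert_self _ _⟩
        simp only
        rw [hmk, this, inv_mul_cancel_right]
      · have : FreeGroup.mk [(i, true)] = FreeGroup.of i := rfl
        refine ⟨_, _, hT'.grow hm hw (e := (FreeGroup.mk l, i)) (Or.inl ⟨rfl, ?_⟩),
          hsub.trans (Finset.subset_insert _ _), Finset.mem_insert_self _ _⟩
        simp only
        rw [hmk, this]

theorem NTree.existence {k : ℕ} (X : Finset (FreeGroup (Fin k))) :
    ∃ Vt Et, NTree (k := k) Vt Et ∧ X ⊆ Vt := by
  induction X using Finset.induction_on with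
  | empty =>
    refine ⟨{1}, ∅, ⟨by simp, by simp, by simp, by simp, ?_⟩, by simp⟩
    intro Ω κ _ v hv
    rw [Finset.mem_singleton.mp hv]
  | insert a X _ ih =>
    obtain ⟨Vt, Et, hT, hX⟩ := ih
    obtain ⟨Vt', Et', hT', hs, ha⟩ := NTree.extend1 a.toWord hT
    rw [FreeGroup.mk_toWord] at ha
    exact ⟨Vt', Et', hT', Finset.insert_subset ha (hX.trans hs)⟩

theorem NSx_nc {G : Type} [Group G] (r z : G) (hz : z ∈ Subgroup.normalClosure {r}) :
    ∃ X : Finset G, ∀ H : Subgroup G, (∀ g ∈ X, g * r * g⁻¹ ∈ H) → z ∈ H := by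
  unfold Subgroup.normalClosure at hz
  induction hz using Subgroup.closure_induction with
  | mem y hy =>
    rw [Group.mem_conjugatesOfSet_iff] at hy
    obtain ⟨a, ha, hc⟩ := hy
    rw [Set.mem_singleton_iff] at ha
    subst ha
    obtain ⟨g, hg⟩ := isConj_iff.mp hc
    exact ⟨{g}, fun H h => hg ▸ h g (by simp)⟩
  | one => exact ⟨∅, fun H _ => H.one_mem⟩
  | mul a b _ _ iha ihb =>
    obtain ⟨X, hX⟩ := iha
    obtain ⟨Y, hY⟩ := ihb
    exact ⟨X ∪ Y, fun H h => H.mul_mem (hX H fun g hg => h g (Finset.mem_union_left _ hg))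
      (hY H fun g hg => h g (Finset.mem_union_right _ hg))⟩
  | inv a _ iha =>
    obtain ⟨X, hX⟩ := iha
    exact ⟨X, fun H h => H.inv_mem (hX H h)⟩

theorem NSx_fg {k n : ℕ} {N : Type} [Group N] {φ : FreeGroup (Fin n) →* N}
    (hφ : Function.Surjective φ) {ρ : FreeGroup (Fin k) →* N} {r : FreeGroup (Fin k)}
    (hker : ρ.ker = Subgroup.normalClosure {r}) {w : Fin n → FreeGroup (Fin k)}
    (hw : ∀ j, ρ (w j) = φ (FreeGroup.of j)) :
    ∃ X : Finset (FreeGroup (Fin k)), ∀ H : Subgroup (FreeGroup (Fin k)), (∀ j, w j ∈ H) →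
      (∀ g ∈ X, g * r * g⁻¹ ∈ H) → ∀ z, z ∈ H := by
  have hcomp : ∀ u, ρ (FreeGroup.lift w u) = φ u := by
    intro u
    have : ρ.comp (FreeGroup.lift w) = φ := by
      ext j; simp [hw]
    rw [← this]; rfl
  have h1 : ∀ i : Fin k, ∃ u : FreeGroup (Fin n), ∃ X : Finset (FreeGroup (Fin k)),
      ∀ H : Subgroup (FreeGroup (Fin k)), (∀ g ∈ X, g * r * g⁻¹ ∈ H) →
        (FreeGroup.lift w u)⁻¹ * FreeGroup.of i ∈ H := by
    intro i
    obtain ⟨u, hu⟩ := hφ (ρ (FreeGroup.of i))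
    refine ⟨u, NSx_nc r _ ?_⟩
    rw [← hker, MonoidHom.mem_ker, map_mul, map_inv, hcomp, hu, inv_mul_cancel]
  choose u X hX using h1
  refine ⟨Finset.univ.biUnion X, fun H hwH hH z => ?_⟩
  have hlift : ∀ u, FreeGroup.lift w u ∈ H := by
    intro u
    induction u using FreeGroup.induction_on with
    | C1 => simp
    | of j => simpa using hwH j
    | inv_of j _ => simpa using hwH j
    | mul a b ha hb => rw [map_mul]; exact H.mul_mem ha hb
  have hof : ∀ i, FreeGroup.of i ∈ H := by
    intro i
    have := hX i H (fun g hg => hH g (Finset.mem_biUnion.mpr ⟨i, Finset.mem_univ _, hg⟩))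
    have := H.mul_mem (hlift (u i)) this
    rwa [mul_inv_cancel_left] at this
  induction z using FreeGroup.induction_on with
  | C1 => simp
  | of j => exact hof j
  | inv_of j _ => exact H.inv_mem (hof j)
  | mul a b ha hb => exact H.mul_mem ha hb

def nsPre {k L : ℕ} (lam : ZMod L → Fin k) : ℕ → FreeGroup (Fin k)
  | 0 => 1
  | j + 1 => nsPre lam j * FreeGroup.of (lam (j : ZMod L))

theorem NSx_val {L : ℕ} [NeZero L] (p : ZMod L) :
    (p + 1).val = p.val + 1 ∨ (p.val + 1 = L ∧ (p + 1).val = 0) := by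
  have h := ZMod.val_lt p
  have h2 : (p + 1).val = (p.val + 1) % L := by
    have : p + 1 = ((p.val + 1 : ℕ) : ZMod L) := by push_cast; rw [ZMod.natCast_zmod_val]
    rw [this, ZMod.val_natCast]
  rcases Nat.lt_or_ge (p.val + 1) L with h3 | h3
  · left; rw [h2, Nat.mod_eq_of_lt h3]
  · right
    have : p.val + 1 = L := by omega
    exact ⟨this, by rw [h2, this, Nat.mod_self]⟩

theorem NSx_start {k L n : ℕ} [NeZero L] {N : Type} [Group N] {φ : FreeGroup (Fin n) →* N}
    (hφ : Function.Surjective φ) {ρ : FreeGroup (Fin k) →* N} (hρ : Function.Surjective ρ)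
    {lam : ZMod L → Fin k} {tau : ZMod L → ZMod L} (hP : NPos lam tau)
    (hker : ρ.ker = Subgroup.normalClosure {nsPre lam L}) :
    ∃ (V E Φ : Type) (S : NSt k L (FreeGroup (Fin n)) N V E Φ),
      NPre n φ (fun i => ρ (FreeGroup.of i)) lam tau S ∧ NOnto S := by
  have hw : ∀ j : Fin n, ∃ w, ρ w = φ (FreeGroup.of j) := fun j => hρ _
  choose w hw using hw
  obtain ⟨X, hX⟩ := NSx_fg hφ hker hw
  obtain ⟨Vt, Et, hT, hsub⟩ := NTree.existence (X ∪ Finset.univ.image w)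
  have hwV : ∀ j, w j ∈ Vt := fun j => hsub (Finset.mem_union_right _ (Finset.mem_image_of_mem _ (Finset.mem_univ _)))
  have hXV : ∀ g ∈ X, g ∈ Vt := fun g hg => hsub (Finset.mem_union_left _ hg)
  have hρr : ρ (nsPre lam L) = 1 := by
    rw [← MonoidHom.mem_ker, hker]
    exact Subgroup.subset_normalClosure (Set.mem_singleton _)
  let I := {g // g ∈ X}
  let S : NSt k L (FreeGroup (Fin n)) N (FreeGroup (Fin k) ⊕ (I × ZMod L))
      ((FreeGroup (Fin k) × Fin k) ⊕ ((I × ZMod L) ⊕ (Fin n ⊕ I))) I :=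
    { Vs := Vt.disjSum Finset.univ
      Es := Et.disjSum (Finset.univ.disjSum ∅)
      Ds := Finset.disjSum ∅ (Finset.disjSum ∅ Finset.univ)
      Ts := Finset.univ
      src := Sum.elim (fun e => Sum.inl e.1) (Sum.elim (fun e => Sum.inr e)
        (Sum.elim (fun j => Sum.inl (w j)) (fun i => Sum.inr (i, 0))))
      tgt := Sum.elim (fun e => Sum.inl (e.1 * FreeGroup.of e.2))
        (Sum.elim (fun e => Sum.inr (e.1, e.2 + 1))
        (Sum.elim (fun _ => Sum.inl 1) (fun i => Sum.inl i.1)))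
      lab := Sum.elim (fun e => e.2) (Sum.elim (fun e => lam e.2) (fun _ => lam 0))
      bd := fun i p => Sum.inr (Sum.inl (i, p))
      c := Sum.elim (fun _ => 1) (Sum.elim (fun _ => 1)
        (Sum.elim (fun j => FreeGroup.of j) (fun _ => 1)))
      h := Sum.elim (fun v => ρ v) (fun e => ρ (e.1.1 * nsPre lam e.2.val)) }
  have hEs : ∀ e, e ∈ S.Es ↔ (∃ a ∈ Et, e = Sum.inl a) ∨ ∃ a, e = Sum.inr (Sum.inl a) := by
    intro e
    rcases e with a | a | a | a <;> simp [S]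
  have hDs : ∀ e, e ∈ S.Ds ↔ (∃ a, e = Sum.inr (Sum.inr a)) := by
    intro e
    rcases e with a | a | a | a <;> simp [S]
  have hVl : ∀ v, Sum.inl v ∈ S.Vs ↔ v ∈ Vt := by intro v; simp [S]
  have hVr : ∀ v, Sum.inr v ∈ S.Vs := by intro v; simp [S]
  refine ⟨_, _, _, S, ?_, ?_⟩
  · refine ⟨⟨Sum.inl 1, (hVl 1).mpr hT.one⟩, ?_, ?_, ?_, ?_, ?_, ?_, ?_, ?_, ?_, ?_, ?_, ?_, ?_⟩
    · intro e he hd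
      rw [hEs] at he; rw [hDs] at hd
      obtain ⟨b, rfl⟩ := hd
      rcases he with ⟨a, _, h⟩ | ⟨a, h⟩ <;> simp at h
    · intro e he
      rw [hEs, hDs] at he
      rcases he with (⟨a, ha, rfl⟩ | ⟨a, rfl⟩) | ⟨a | a, rfl⟩
      · exact (hVl _).mpr (hT.src a ha)
      · exact hVr _
      · exact (hVl _).mpr (hwV a)
      · exact hVr _
    · intro e he
      rw [hEs, hDs] at he
      rcases he with (⟨a, ha, rfl⟩ | ⟨a, rfl⟩) | ⟨a | a, rfl⟩
      · exact (hVl _).mpr (hT.tgt a ha)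
      · exact hVr _
      · exact (hVl _).mpr hT.one
      · exact (hVl _).mpr (hXV _ a.2)
    · intro f _ p
      rw [hEs]; exact Or.inr ⟨_, rfl⟩
    · intro f _ p; rfl
    · intro f _ p; rfl
    · intro e he
      rw [hEs] at he
      rcases he with ⟨a, ha, rfl⟩ | ⟨a, rfl⟩
      · change φ 1 = ρ a.1 * ρ (FreeGroup.of a.2) * (ρ (a.1 * FreeGroup.of a.2))⁻¹
        rw [map_one, map_mul, mul_inv_cancel]
      · change φ 1 = ρ (a.1.1 * nsPre lam a.2.val) * ρ (FreeGroup.of (lam a.2)) *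
          (ρ (a.1.1 * nsPre lam (a.2 + 1).val))⁻¹
        have hs : nsPre lam (a.2.val + 1) = nsPre lam a.2.val * FreeGroup.of (lam a.2) := by
          rw [nsPre, ZMod.natCast_zmod_val]
        have : ρ (nsPre lam (a.2 + 1).val) = ρ (nsPre lam (a.2.val + 1)) := by
          rcases NSx_val a.2 with h | ⟨h, h'⟩
          · rw [h]
          · rw [h, h', hρr, nsPre, map_one]
        rw [map_mul, map_mul, this, hs, map_mul, map_one]
        group
    · intro e he
      rw [hDs] at he
      rcases he with ⟨a | a, rfl⟩
      · change φ (FreeGroup.of a) = ρ (w a) * (ρ 1)⁻¹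
        rw [hw, map_one, inv_one, mul_one]
      · change φ 1 = ρ (a.1 * nsPre lam (0 : ZMod L).val) * (ρ a.1)⁻¹
        rw [ZMod.val_zero, nsPre, mul_one, map_one, mul_inv_cancel]
    · intro f _
      exact ⟨fun _ => 1, fun p => by simp [S]⟩
    · intro Ω _ κ hκ
      have k1 : ∀ v ∈ Vt, κ (Sum.inl v) = κ (Sum.inl 1) := by
        apply hT.conn Ω (fun v => κ (Sum.inl v))
        intro e he
        have := hκ (Sum.inl e) (Or.inl ((hEs _).mpr (Or.inl ⟨e, he, rfl⟩)))
        simpa [S] using this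
      have k2 : ∀ j : Fin n, κ (Sum.inl 1) = FreeGroup.of j • κ (Sum.inl 1) := by
        intro j
        have := hκ (Sum.inr (Sum.inr (Sum.inl j))) (Or.inr ((hDs _).mpr ⟨_, rfl⟩))
        exact (k1 _ (hwV j)).symm.trans this
      have k3 : ∀ (i : I) p, κ (Sum.inr (i, p)) = κ (Sum.inl 1) := by
        intro i p
        have h0 := NSx_cyc (fun p => κ (Sum.inr (i, p))) 0 (by
          intro p _
          have := hκ (Sum.inr (Sum.inl (i, p))) (Or.inl ((hEs _).mpr (Or.inr ⟨_, rfl⟩)))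
          simpa [S] using this) p 0
        have := hκ (Sum.inr (Sum.inr (Sum.inr i))) (Or.inr ((hDs _).mpr ⟨_, rfl⟩))
        simp only [S, Sum.elim_inr, Sum.elim_inl, one_smul] at this
        rw [← k1 _ (hXV _ i.2), ← this]
        exact h0
      have k4 : ∀ g : FreeGroup (Fin n), g • κ (Sum.inl 1) = κ (Sum.inl 1) := by
        intro g
        induction g using FreeGroup.induction_on with
        | C1 => simp
        | of j => exact (k2 j).symm
        | inv_of j _ => rw [inv_smul_eq_iff]; exact k2 j
        | mul a b ha hb => rw [mul_smul, hb, ha]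
      rintro (v | v) hv g
      · rw [k1 v ((hVl v).mp hv)]; exact k4 g
      · rw [k3 v.1 v.2]; exact k4 g
    · have := hT.card
      simp only [S, Finset.card_disjSum, Finset.card_univ, Finset.card_empty, Fintype.card_sum,
        Fintype.card_fin]
      omega
    · intro f _ g _ p h
      simpa [S] using h
    · intro Q _ ⟨f, hf⟩
      refine ⟨f, hf, 0, fun g _ h => ?_⟩
      simp only [S, Sum.inr.injEq, Sum.inl.injEq, Prod.mk.injEq] at h
      exact hP.ne 0 h.2
  · intro Ω σ κ hE hD
    have ofa : ∀ i (y : Ω), FreeGroup.lift σ (FreeGroup.of i) y = σ i y := by intro i y; simp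
    have k1 : ∀ v ∈ Vt, FreeGroup.lift σ v (κ (Sum.inl v)) = κ (Sum.inl 1) := by
      intro v hv
      have := hT.conn Ω (fun v => FreeGroup.lift σ v (κ (Sum.inl v))) (by
        intro e he
        have := hE (Sum.inl e) ((hEs _).mpr (Or.inl ⟨e, he, rfl⟩))
        change κ (Sum.inl e.1) = σ e.2 (κ (Sum.inl (e.1 * FreeGroup.of e.2))) at this
        rw [this, map_mul, Equiv.Perm.mul_apply, ofa]) v hv
      simpa using this
    have k2 : ∀ j, FreeGroup.lift σ (w j) (κ (Sum.inl 1)) = κ (Sum.inl 1) := by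
      intro j
      have := hD (Sum.inr (Sum.inr (Sum.inl j))) ((hDs _).mpr ⟨_, rfl⟩)
      change κ (Sum.inl (w j)) = κ (Sum.inl 1) at this
      have h1 := k1 _ (hwV j)
      rwa [this] at h1
    have k3 : ∀ (i : I) (j : ℕ), FreeGroup.lift σ (nsPre lam j) (κ (Sum.inr (i, (j : ZMod L)))) =
        κ (Sum.inr (i, 0)) := by
      intro i j
      induction j with
      | zero => simp [nsPre]
      | succ j ih =>
        have := hE (Sum.inr (Sum.inl (i, (j : ZMod L)))) ((hEs _).mpr (Or.inr ⟨_, rfl⟩))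
        change κ (Sum.inr (i, (j : ZMod L))) = σ (lam (j : ZMod L)) (κ (Sum.inr (i, (j : ZMod L) + 1))) at this
        rw [nsPre, map_mul, Equiv.Perm.mul_apply, ofa]
        push_cast
        rw [← this, ih]
    have k4 : ∀ i : I, FreeGroup.lift σ i.1 (κ (Sum.inr (i, 0))) = κ (Sum.inl 1) := by
      intro i
      have := hD (Sum.inr (Sum.inr (Sum.inr i))) ((hDs _).mpr ⟨_, rfl⟩)
      change κ (Sum.inr (i, 0)) = κ (Sum.inl i.1) at this
      rw [this]; exact k1 _ (hXV _ i.2)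
    have k5 : ∀ z, FreeGroup.lift σ z (κ (Sum.inl 1)) = κ (Sum.inl 1) := by
      intro z
      let H : Subgroup (FreeGroup (Fin k)) :=
        (MulAction.stabilizer (Equiv.Perm Ω) (κ (Sum.inl 1))).comap (FreeGroup.lift σ)
      have hH : ∀ z, z ∈ H ↔ FreeGroup.lift σ z (κ (Sum.inl 1)) = κ (Sum.inl 1) := fun z => Iff.rfl
      rw [← hH]
      apply hX H
      · intro j; rw [hH]; exact k2 j
      · intro g hg
        rw [hH, map_mul, map_mul, Equiv.Perm.mul_apply, Equiv.Perm.mul_apply]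
        have h4 := k4 ⟨g, hg⟩
        have h3 := k3 ⟨g, hg⟩ L
        rw [ZMod.natCast_self] at h3
        have h5 : FreeGroup.lift σ g⁻¹ (κ (Sum.inl 1)) = κ (Sum.inr (⟨g, hg⟩, 0)) := by
          rw [map_inv, Equiv.Perm.inv_eq_iff_eq]; exact h4.symm
        rw [h5, h3, h4]
    have k6 : ∀ z y, FreeGroup.lift σ z y = κ (Sum.inl 1) → y = κ (Sum.inl 1) := by
      intro z y h
      rw [← k5 z] at h
      exact (FreeGroup.lift σ z).injective h
    have hall : ∀ v ∈ S.Vs, κ v = κ (Sum.inl 1) := by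
      rintro (v | ⟨i, p⟩) hv
      · exact k6 v _ (k1 v ((hVl v).mp hv))
      · have h0 : κ (Sum.inr (i, 0)) = κ (Sum.inl 1) := k6 _ _ (k4 i)
        have h3 := k3 i p.val
        rw [ZMod.natCast_zmod_val, h0] at h3
        exact k6 _ _ h3
    intro v hv
    refine ⟨fun v' hv' => (hall v hv).trans (hall v' hv').symm, fun i => ?_⟩
    rw [hall v hv, ← ofa]
    exact k5 _

end

def nsLam (k : ℕ) [NeZero (2 * k)] (p : ZMod (2 * k)) : Fin k :=
  ⟨p.val / 2, by have := ZMod.val_lt p; omega⟩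

def nsTauN (a : ℕ) : ℕ := if a % 2 = 0 then a + 1 else a - 1

def nsTau (k : ℕ) (p : ZMod (2 * k)) : ZMod (2 * k) := (nsTauN p.val : ℕ)

theorem nsTau_val (k : ℕ) [NeZero (2 * k)] (p : ZMod (2 * k)) :
    (nsTau k p).val = nsTauN p.val := by
  unfold nsTau
  rw [ZMod.val_natCast, Nat.mod_eq_of_lt]
  have := ZMod.val_lt p
  unfold nsTauN
  split_ifs <;> omega

theorem nsPos (k : ℕ) [NeZero (2 * k)] : NPos (nsLam k) (nsTau k) := by
  have hl : ∀ p q : ZMod (2 * k), nsLam k p = nsLam k q ↔ p.val / 2 = q.val / 2 := by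
    intro p q; simp [nsLam]
  refine ⟨?_, ?_, ?_, ?_⟩
  · intro p q h
    rw [hl] at h
    by_cases hpq : q.val = p.val
    · exact Or.inl (ZMod.val_injective _ hpq)
    · right
      apply ZMod.val_injective
      rw [nsTau_val, nsTauN]
      split_ifs <;> omega
  · intro p
    rw [hl, nsTau_val, nsTauN]
    split_ifs <;> omega
  · intro p
    apply ZMod.val_injective
    rw [nsTau_val, nsTau_val]
    unfold nsTauN
    split_ifs <;> omega
  · intro p h
    have := congrArg ZMod.val h
    rw [nsTau_val, nsTauN] at this
    split_ifs at this <;> omega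

theorem nsLam_natCast (k : ℕ) [NeZero (2 * k)] (a j : ℕ) (hj : j < k) (ha : a / 2 = j) :
    nsLam k (a : ZMod (2 * k)) = ⟨j, hj⟩ := by
  unfold nsLam
  apply Fin.ext
  simp only [ZMod.val_natCast]
  rw [Nat.mod_eq_of_lt (by omega)]
  exact ha

theorem nsPre_relator (k : ℕ) [NeZero (2 * k)] :
    nsPre (nsLam k) (2 * k) = nonorientableRelator k := by
  have key : ∀ j, j ≤ k → nsPre (nsLam k) (2 * j) =
      (((List.finRange k).take j).map (fun i => (FreeGroup.of i) ^ 2)).prod := by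
    intro j
    induction j with
    | zero => intro _; simp [nsPre]
    | succ j ih =>
      intro hj
      have hlen : j < (List.finRange k).length := by simpa using hj
      rw [List.take_succ_eq_append_getElem hlen, List.map_append, List.prod_append, ← ih (by omega)]
      change nsPre (nsLam k) (2 * j + 1 + 1) = _
      rw [nsPre, nsPre, nsLam_natCast k (2 * j) j (by omega) (by omega),
        nsLam_natCast k (2 * j + 1) j (by omega) (by omega)]
      simp [pow_two, mul_assoc]
  rw [key k le_rfl, nonorientableRelator, List.take_of_length_le (by simp)]

theorem epi_to_nonorientable_surface_group_nielsen_equivalent_padded_standard (k n : ℕ)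
    (hk : 1 ≤ k) (hn : k ≤ n)
    (φ : FreeGroup (Fin n) →* NonorientableSurfaceGroup k) (hφ : Function.Surjective φ) :
    ∃ α : FreeGroup (Fin n) ≃* FreeGroup (Fin n),
      ∀ i : Fin n,
        (φ.comp α.toMonoidHom) (FreeGroup.of i) =
          if h : (i : ℕ) < k then standardRho k (FreeGroup.of ⟨i, h⟩) else 1 := by
  have : NeZero (2 * k) := ⟨by omega⟩
  have hρ : Function.Surjective (standardRho k) := PresentedGroup.mk_surjective _
  have hker : (standardRho k).ker = Subgroup.normalClosure {nsPre (nsLam k) (2 * k)} := by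
    rw [nsPre_relator]
    exact QuotientGroup.ker_mk' _
  obtain ⟨V, E, Φ, S, hS, hO⟩ := NSx_start hφ hρ (nsPos k) hker
  obtain ⟨S', hS', hO', hd, he⟩ := NSx_reduce (nsPos k) _ S rfl hS hO
  obtain ⟨α, hα⟩ := NSx_terminal hn hφ (nsPos k) hS' hO' hd he
  exact ⟨α, fun i => hα i⟩
end
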